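/- arXiv:1809.06251 — 5 statements merged into one kernel-verified Lean document; each statement's English description precedes it below -/
import Mathlib

section
/- Let m and r be coprime positive integers with 2 ≤ m ≤ 12, and suppose that the multiplicative order of r modulo m equals 2 (i.e. r² ≡ 1 (mod m) and r ≢ 1 (mod m)), so n = 2. Set s = gcd(r−1, m) and t = m/s, and assume gcd(2, t) = 1 and gcd(s, t) = 1. Then the group G_{m,r} can be embedded in a division ring if and only if G_{m,r} is isomorphic to the cyclic group ℤ/4ℤ, to the dicyclic group Dic₁₂ of order 12, or to the dicyclic group Dic₂₀ of order 20. -/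
/-- The set of relations defining the dicyclic-type group `G_{m,r}` (with `n = 2`):
`a ^ m = 1`, `b ^ 2 = a ^ t`, `b * a * b⁻¹ = a ^ r`, where the two generators `a`, `b`
are `FreeGroup.of 0` and `FreeGroup.of 1`. -/
def GmrRels (m t r : ℕ) : Set (FreeGroup (Fin 2)) :=
  {FreeGroup.of 0 ^ m,
   FreeGroup.of 1 ^ 2 * (FreeGroup.of 0 ^ t)⁻¹,
   FreeGroup.of 1 * FreeGroup.of 0 * (FreeGroup.of 1)⁻¹ * (FreeGroup.of 0 ^ r)⁻¹}

/-- The group `G_{m,r}` (for the case `n = 2`), presented as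
`⟨a, b | a^m = 1, b^2 = a^t, b a b⁻¹ = a^r⟩`. -/
abbrev Gmr (m t r : ℕ) : Type := PresentedGroup (GmrRels m t r)

theorem arith_aux : ∀ m < 13, 2 ≤ m → ∀ c < m, c ^ 2 % m = 1 % m → c ≠ 1 →
    Nat.gcd 2 (m / Nat.gcd (c - 1) m) = 1 →
    Nat.gcd (Nat.gcd (c - 1) m) (m / Nat.gcd (c - 1) m) = 1 →
    (m / Nat.gcd (c - 1) m = m ∧ c = m - 1) ∨
    (m = 6 ∧ m / Nat.gcd (c - 1) m = 3 ∧ c = 5) ∨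
    (m = 10 ∧ m / Nat.gcd (c - 1) m = 5 ∧ c = 9) ∨
    (m = 12 ∧ m / Nat.gcd (c - 1) m = 3 ∧ c = 5) := by
  intro m hm h2
  interval_cases m <;> intro c hc <;> interval_cases c <;> decide

theorem sq_one_cases {D : Type*} [DivisionRing D] {z : D} (h : z ^ 2 = 1) : z = 1 ∨ z = -1 := by
  rw [pow_two] at h
  exact mul_self_eq_one_iff.mp h

/-- the quaternion unit `j`. -/
def qj : Quaternion ℝ := ⟨0, 0, 1, 0⟩

theorem qj_re : qj.re = 0 := rfl
theorem qj_imI : qj.imI = 0 := rfl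
theorem qj_imJ : qj.imJ = 1 := rfl
theorem qj_imK : qj.imK = 0 := rfl

theorem q1_re : (1 : Quaternion ℝ).re = 1 := rfl
theorem q1_imI : (1 : Quaternion ℝ).imI = 0 := rfl
theorem q1_imJ : (1 : Quaternion ℝ).imJ = 0 := rfl
theorem q1_imK : (1 : Quaternion ℝ).imK = 0 := rfl

theorem qj_sq : qj * qj = -1 := by
  ext <;> simp [qj_re, qj_imI, qj_imJ, qj_imK, q1_re, q1_imI, q1_imJ, q1_imK]

section quat
variable {H : Type*} [Group H] (k : ℕ) (x y : H)

/-- powers of `x` indexed by `ZMod (2 * k)`. -/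
noncomputable def phiHom (hx : x ^ (2 * k) = 1) : ZMod (2 * k) →+ Additive H :=
  ZMod.lift (2 * k) ⟨zmultiplesHom (Additive H) (Additive.ofMul x), by
    simp only [zmultiplesHom_apply]
    rw [natCast_zsmul, ← ofMul_pow, hx]; rfl⟩

/-- the same as a plain function. -/
noncomputable def phi (hx : x ^ (2 * k) = 1) (i : ZMod (2 * k)) : H :=
  (phiHom k x hx i).toMul

theorem phi_add (hx : x ^ (2 * k) = 1) (i j : ZMod (2 * k)) :
    phi k x hx (i + j) = phi k x hx i * phi k x hx j := by
  simp [phi]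

theorem phi_neg (hx : x ^ (2 * k) = 1) (i : ZMod (2 * k)) :
    phi k x hx (-i) = (phi k x hx i)⁻¹ := by
  simp [phi]

theorem phi_int (hx : x ^ (2 * k) = 1) (i : ℤ) :
    phi k x hx (i : ZMod (2 * k)) = x ^ i := by
  simp [phi, phiHom]

theorem phi_nat (hx : x ^ (2 * k) = 1) (i : ℕ) :
    phi k x hx (i : ZMod (2 * k)) = x ^ i := by
  have := phi_int k x hx i
  simpa using this

theorem phi_comm (hx : x ^ (2 * k) = 1) (hyx : y * x * y⁻¹ = x⁻¹) (i : ZMod (2 * k)) :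
    phi k x hx i * y = y * phi k x hx (-i) := by
  obtain ⟨i, rfl⟩ := ZMod.intCast_surjective i
  rw [phi_neg, phi_int, ← zpow_neg]
  have h1 : (y * x * y⁻¹) ^ i = (x⁻¹) ^ i := by rw [hyx]
  rw [conj_zpow, inv_zpow', ] at h1
  have h2 : (y * x * y⁻¹) ^ (-i) = (x⁻¹) ^ (-i) := by rw [hyx]
  rw [conj_zpow, inv_zpow', neg_neg] at h2
  rw [← h2]; group

/-- lift from the dicyclic group. -/
noncomputable def quatLift (hx : x ^ (2 * k) = 1) (hy : y ^ 2 = x ^ k)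
    (hyx : y * x * y⁻¹ = x⁻¹) : QuaternionGroup k →* H :=
  MonoidHom.mk' (fun g => match g with
    | .a i => phi k x hx i
    | .xa i => y * phi k x hx i) (by
    rintro (i | i) (j | j)
    · simp [phi_add]
    · simp only [QuaternionGroup.a_mul_xa]
      rw [← mul_assoc, phi_comm k x y hx hyx, mul_assoc, ← phi_add]
      congr 2; ring
    · simp [phi_add, mul_assoc]
    · simp only [QuaternionGroup.xa_mul_xa]
      rw [mul_assoc, ← mul_assoc (phi k x hx i), phi_comm k x y hx hyx, mul_assoc, ← phi_add,
        ← mul_assoc, ← pow_two, hy, ← phi_nat k x hx, ← phi_add]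
      congr 1; ring)

end quat

theorem quat_embed (k : ℕ) [NeZero k] :
    ∃ f : QuaternionGroup k →* (Quaternion ℝ)ˣ, Function.Injective f := by
  have hk : 2 * k ≠ 0 := by have := NeZero.ne k; omega
  have hζ := Complex.isPrimitiveRoot_exp (2 * k) hk
  set ζ := Complex.exp (2 * Real.pi * Complex.I / (2 * k : ℕ)) with hζd
  have hζ0 : ζ ≠ 0 := Complex.exp_ne_zero _
  have hn : ‖ζ‖ = 1 := hζ.norm'_eq_one hk
  have hconj : (starRingEnd ℂ) ζ = ζ⁻¹ := (Complex.inv_eq_conj hn).symm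
  have hk1 : ζ ^ k = -1 := by
    have h := hζ.pow_eq_one
    have hh : ζ ^ k ≠ 1 := fun hh => by
      have := Nat.le_of_dvd (Nat.pos_of_ne_zero (NeZero.ne k)) (hζ.dvd_of_pow_eq_one k hh)
      have := NeZero.ne k
      omega
    rw [mul_comm, pow_mul] at h
    rcases sq_one_cases h with h | h
    · exact absurd h hh
    · exact h
  let x : (Quaternion ℝ)ˣ := Units.map (Quaternion.ofComplex : ℂ →ₐ[ℝ] Quaternion ℝ).toMonoidHom
    (Units.mk0 ζ hζ0)
  have hxv : ∀ n : ℕ, ((x ^ n : (Quaternion ℝ)ˣ) : Quaternion ℝ) =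
      Quaternion.coeComplex (ζ ^ n) := by
    intro n
    rw [← map_pow]
    simp [← Quaternion.coe_ofComplex]
  let y : (Quaternion ℝ)ˣ := ⟨qj, -qj, by simp [qj_sq], by simp [qj_sq]⟩
  have hx : x ^ (2 * k) = 1 := by
    apply Units.ext
    rw [hxv, hζ.pow_eq_one]; simp
  have hy : y ^ 2 = x ^ k := by
    apply Units.ext
    rw [hxv, hk1, pow_two]
    change qj * qj = _
    rw [qj_sq]; ext <;> simp [q1_re, q1_imI, q1_imJ, q1_imK]
  have hyx : y * x * y⁻¹ = x⁻¹ := by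
    have h1 : ζ.re * ζ.re + ζ.im * ζ.im = 1 := by
      have := Complex.normSq_eq_norm_sq ζ
      rw [hn, Complex.normSq_apply] at this
      simpa using this
    rw [mul_inv_eq_iff_eq_mul, eq_inv_mul_iff_mul_eq]
    apply Units.ext
    have := hxv 1
    simp only [pow_one] at this
    rw [Units.val_mul, Units.val_mul, this]
    ext <;> simp [y, qj_re, qj_imI, qj_imJ, qj_imK, q1_re, q1_imI, q1_imJ, q1_imK]
    · linarith
    · ring
  refine ⟨quatLift k x y hx hy hyx, ?_⟩
  rw [injective_iff_map_eq_one]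
  rintro (i | i) h
  · obtain ⟨n, rfl⟩ := ZMod.natCast_zmod_surjective (n := 2 * k) i
    change phi k x hx _ = 1 at h
    rw [phi_nat] at h
    have h2 := congrArg Units.val h
    rw [hxv, ← Quaternion.coe_ofComplex] at h2
    have h3 : ζ ^ n = 1 := Quaternion.ofComplex.toRingHom.injective (by simpa using h2)
    have := hζ.dvd_of_pow_eq_one n h3
    rw [(ZMod.natCast_eq_zero_iff n (2 * k)).2 this]
    rfl
  · exfalso
    obtain ⟨n, rfl⟩ := ZMod.natCast_zmod_surjective (n := 2 * k) i
    change y * phi k x hx _ = 1 at h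
    rw [phi_nat] at h
    have h2 := congrArg Units.val h
    rw [Units.val_mul, hxv] at h2
    have h3 := congrArg (fun q : Quaternion ℝ => q.re) h2
    simp [y, qj_re, qj_imI, qj_imJ, qj_imK, q1_re, q1_imI, q1_imJ, q1_imK] at h3

theorem zmod4_embed : ∃ f : Multiplicative (ZMod 4) →* ℂˣ, Function.Injective f := by
  have hζ := Complex.isPrimitiveRoot_exp 4 (by norm_num)
  have h2 := hζ.isUnit_unit (by norm_num)
  let e := h2.zmodEquivZPowers
  refine ⟨(Subgroup.subtype _).comp (AddMonoidHom.toMultiplicativeLeft e.toAddMonoidHom), ?_⟩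
  intro p q h
  have h := Subtype.ext h
  exact e.injective h

section rels
variable (m t r : ℕ)

/-- the generator `a`. -/
def ga : Gmr m t r := PresentedGroup.of 0
/-- the generator `b`. -/
def gb : Gmr m t r := PresentedGroup.of 1

theorem ga_pow : ga m t r ^ m = 1 := by
  have := PresentedGroup.one_of_mem (rels := GmrRels m t r) (x := FreeGroup.of 0 ^ m)
    (by simp [GmrRels])
  simpa [ga, gb, PresentedGroup.of] using this

theorem gb_sq : gb m t r ^ 2 = ga m t r ^ t := by
  have := PresentedGroup.one_of_mem (rels := GmrRels m t r)
    (x := FreeGroup.of 1 ^ 2 * (FreeGroup.of 0 ^ t)⁻¹) (by simp [GmrRels])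
  rw [map_mul, map_inv, mul_inv_eq_one] at this
  simpa [ga, gb, PresentedGroup.of] using this

theorem g_conj : gb m t r * ga m t r * (gb m t r)⁻¹ = ga m t r ^ r := by
  have := PresentedGroup.one_of_mem (rels := GmrRels m t r)
    (x := FreeGroup.of 1 * FreeGroup.of 0 * (FreeGroup.of 1)⁻¹ * (FreeGroup.of 0 ^ r)⁻¹)
    (by simp [GmrRels])
  rw [map_mul, map_inv, mul_inv_eq_one] at this
  simpa [ga, gb, PresentedGroup.of] using this

theorem g_lift {H : Type*} [Group H] (x y : H) (h1 : x ^ m = 1) (h2 : y ^ 2 = x ^ t)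
    (h3 : y * x * y⁻¹ = x ^ r) :
    ∃ f : Gmr m t r →* H, f (ga m t r) = x ∧ f (gb m t r) = y := by
  refine ⟨PresentedGroup.toGroup (f := ![x, y]) ?_, ?_, ?_⟩
  · intro w hw
    simp only [GmrRels, Set.mem_insert_iff, Set.mem_singleton_iff] at hw
    rcases hw with rfl | rfl | rfl
    · simpa using h1
    · simp [h2]
    · simp [h3]
  · exact PresentedGroup.toGroup.of _
  · exact PresentedGroup.toGroup.of _

end rels

theorem g_quat (k r : ℕ) (hr : r % (2 * k) = 2 * k - 1) (hk : 0 < k) :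
    Nonempty (Gmr (2 * k) k r ≃* QuaternionGroup k) := by
  have hr1 : 2 * k ∣ r + 1 := by
    have := Nat.div_add_mod r (2 * k)
    exact ⟨r / (2 * k) + 1, by rw [mul_add]; omega⟩
  have hinv : ∀ {H : Type} [Group H] (x : H), x ^ (2 * k) = 1 → x ^ r = x⁻¹ := by
    intro H _ x hx
    obtain ⟨c, hc⟩ := hr1
    rw [eq_inv_iff_mul_eq_one, ← pow_succ, hc, pow_mul, hx, one_pow]
  have ha : (QuaternionGroup.a 1 : QuaternionGroup k) ^ (2 * k) = 1 := by
    rw [QuaternionGroup.a_one_pow]; rw [QuaternionGroup.one_def, ZMod.natCast_self]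
  obtain ⟨f, hfa, hfb⟩ := g_lift (2 * k) k r (QuaternionGroup.a 1 : QuaternionGroup k)
    (QuaternionGroup.xa 0) ha (by
      rw [QuaternionGroup.a_one_pow, pow_two]; simp) (by
      rw [hinv _ ha, mul_inv_eq_iff_eq_mul, eq_inv_mul_iff_mul_eq]; simp)
  let g := quatLift k (ga (2 * k) k r) (gb (2 * k) k r) (ga_pow _ _ _) (gb_sq _ _ _)
    (by rw [g_conj]; exact hinv _ (ga_pow _ _ _))
  have hga : ∀ i : ℕ, g (.a (i : ZMod (2 * k))) = ga _ _ _ ^ i := fun i => phi_nat _ _ _ _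
  have hgb : ∀ i : ℕ, g (.xa (i : ZMod (2 * k))) = gb _ _ _ * ga _ _ _ ^ i := fun i =>
    congrArg (gb _ _ _ * ·) (phi_nat _ _ _ _)
  have : NeZero (2 * k) := ⟨by omega⟩
  refine ⟨MonoidHom.toMulEquiv f g ?_ ?_⟩
  · apply PresentedGroup.ext
    intro i
    fin_cases i
    · change g (f (ga _ _ _)) = ga _ _ _
      rw [hfa]; simpa using hga 1
    · change g (f (gb _ _ _)) = gb _ _ _
      rw [hfb]; simpa using hgb 0
  · ext q
    rcases q with i | i
    · obtain ⟨n, rfl⟩ := ZMod.natCast_zmod_surjective (n := 2 * k) i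
      change f (g _) = _
      rw [hga, map_pow, hfa, QuaternionGroup.a_one_pow]; rfl
    · obtain ⟨n, rfl⟩ := ZMod.natCast_zmod_surjective (n := 2 * k) i
      change f (g _) = _
      rw [hgb, map_mul, map_pow, hfa, hfb, QuaternionGroup.a_one_pow]; simp

theorem no_dihedral (m r : ℕ) (hm : 2 < m) (hr : r % m = m - 1) {D : Type} [DivisionRing D]
    (f : Gmr m m r →* Dˣ) (hf : Function.Injective f) : False := by
  have hr0 : (r : ZMod m) = -1 := by
    rw [← ZMod.natCast_mod, hr, Nat.cast_sub (by omega)]; simp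
  have hb : ((f (gb m m r) : Dˣ) : D) ^ 2 = 1 := by
    rw [← Units.val_pow_eq_pow_val, ← map_pow, gb_sq, ga_pow]; simp
  have hc : f (gb m m r) * f (ga m m r) = f (ga m m r) * f (gb m m r) := by
    apply Units.ext
    rw [Units.val_mul, Units.val_mul]
    rcases sq_one_cases hb with h | h <;> rw [h] <;> simp
  rw [← map_mul, ← map_mul] at hc
  have hc := hf hc
  obtain ⟨g, hga, hgb⟩ := g_lift m m r (DihedralGroup.r 1 : DihedralGroup m)
    (DihedralGroup.sr 0) (by simp) (by rw [pow_two]; simp) (by simp [hr0])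
  have := congrArg g hc
  rw [map_mul, map_mul, hga, hgb] at this
  simp at this
  have h2 : ((2 : ℕ) : ZMod m) = 0 := by
    push_cast
    linear_combination this
  rw [ZMod.natCast_eq_zero_iff] at h2
  have := Nat.le_of_dvd (by norm_num) h2
  omega

theorem no_twelve (r : ℕ) (hr : r % 12 = 5) {D : Type} [DivisionRing D]
    (f : Gmr 12 3 r →* Dˣ) (hf : Function.Injective f) : False := by
  obtain ⟨q, hq⟩ : ∃ q, r = 12 * q + 5 := ⟨r / 12, by omega⟩
  have h5 : ∀ {H : Type} [Group H] (x : H), x ^ 12 = 1 → x ^ r = x ^ 5 := by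
    intro H _ x hx
    rw [hq, pow_add, pow_mul, hx]; simp
  have ha4 : ga 12 3 r ^ 4 ≠ 1 := by
    intro h
    have h12 : (DihedralGroup.r 1 : DihedralGroup 3) ^ 12 = 1 := by decide
    obtain ⟨g, hga, -⟩ := g_lift 12 3 r (DihedralGroup.r 1 : DihedralGroup 3)
      (DihedralGroup.sr 0) h12 (by decide) (by rw [h5 _ h12]; decide)
    have := congrArg g h
    rw [map_pow, hga, map_one] at this
    revert this; decide
  have ha6 : ga 12 3 r ^ 6 ≠ 1 := by
    intro h
    have h12 : (Multiplicative.ofAdd 6 : Multiplicative (ZMod 8)) ^ 12 = 1 := by decide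
    obtain ⟨g, hga, -⟩ := g_lift 12 3 r (Multiplicative.ofAdd 6 : Multiplicative (ZMod 8))
      (Multiplicative.ofAdd 1) h12 (by decide) (by rw [h5 _ h12]; decide)
    have := congrArg g h
    rw [map_pow, hga, map_one] at this
    revert this; decide
  have hval : ∀ n : ℕ, ((f (ga 12 3 r) : Dˣ) : D) ^ n = 1 → ga 12 3 r ^ n = 1 := by
    intro n h
    apply hf
    apply Units.ext
    rw [map_pow, map_one]; simpa using h
  have e12 : ((f (ga 12 3 r) : Dˣ) : D) ^ 12 = 1 := by
    rw [← Units.val_pow_eq_pow_val, ← map_pow, ga_pow]; simp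
  have eb : ((f (gb 12 3 r) : Dˣ) : D) ^ 2 = ((f (ga 12 3 r) : Dˣ) : D) ^ 3 := by
    rw [← Units.val_pow_eq_pow_val, ← Units.val_pow_eq_pow_val, ← map_pow, gb_sq, map_pow]
  have ec : ((f (gb 12 3 r) : Dˣ) : D) * ((f (ga 12 3 r) : Dˣ) : D) =
      ((f (ga 12 3 r) : Dˣ) : D) ^ 5 * ((f (gb 12 3 r) : Dˣ) : D) := by
    have h := g_conj 12 3 r
    rw [h5 _ (ga_pow 12 3 r), mul_inv_eq_iff_eq_mul] at h
    have h := congrArg (fun z => ((f z : Dˣ) : D)) h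
    simpa using h
  have hb0 : ((f (gb 12 3 r) : Dˣ) : D) ≠ 0 := Units.ne_zero _
  have ha0 : ((f (ga 12 3 r) : Dˣ) : D) ≠ 0 := Units.ne_zero _
  generalize ((f (ga 12 3 r) : Dˣ) : D) = a at *
  generalize ((f (gb 12 3 r) : Dˣ) : D) = b at *
  have n4 : a ^ 4 ≠ 1 := fun h => ha4 (hval 4 h)
  have n6 : a ^ 6 ≠ 1 := fun h => ha6 (hval 6 h)
  have a6 : a ^ 6 = -1 := by
    have : (a ^ 6) ^ 2 = 1 := by rw [← pow_mul]; exact e12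
    rcases sq_one_cases this with h | h
    · exact absurd h n6
    · exact h
  have hcyc : a ^ 4 - a ^ 2 + 1 = 0 := by
    have : (a ^ 2 + 1) * (a ^ 4 - a ^ 2 + 1) = 0 := by
      have : (a ^ 2 + 1) * (a ^ 4 - a ^ 2 + 1) = a ^ 6 + 1 := by noncomm_ring
      rw [this, a6]; simp
    rcases mul_eq_zero.mp this with h | h
    · exfalso
      apply n4
      have h : a ^ 2 = -1 := eq_neg_of_add_eq_zero_left h
      rw [show 4 = 2 * 2 from rfl, pow_mul, h]; simp
    · exact h
  have key : ((1 - a) * b) ^ 2 = 1 := by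
    have h1 : ((1 - a) * b) ^ 2 = (1 - a) * (1 - a ^ 5) * b ^ 2 := by
      have : b * (1 - a) = (1 - a ^ 5) * b := by rw [mul_sub, ec]; noncomm_ring
      calc ((1 - a) * b) ^ 2 = (1 - a) * (b * (1 - a)) * b := by noncomm_ring
        _ = _ := by rw [this]; noncomm_ring
    have h2 : (1 - a) * (1 - a ^ 5) * a ^ 3 = -a ^ 6 + (a ^ 6 + 1) * a ^ 3
        - (a ^ 4 - a ^ 2 + 1) * a ^ 4 := by noncomm_ring
    rw [h1, eb, h2, hcyc, a6]; simp
  have hcomm : a * b = b * a := by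
    have hu : (1 - a) * b = b * (1 - a) := by
      rcases sq_one_cases key with h | h
      · rw [h, mul_eq_one_comm.mp h]
      · have hh : (-(1 - a)) * b = 1 := by rw [neg_mul, h, neg_neg]
        have hh := mul_eq_one_comm.mp hh
        rw [h, eq_comm, ← neg_eq_iff_eq_neg, ← mul_neg, hh]
    rw [sub_mul, mul_sub] at hu
    simpa using hu
  apply n4
  rw [← hcomm] at ec
  have := mul_right_cancel₀ hb0 ec
  have h : a ^ 4 * a = 1 * a := by rw [one_mul, ← pow_succ]; exact this.symm
  exact mul_right_cancel₀ ha0 h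

theorem amitsur_C1_case (m r s t : ℕ) (hm2 : 2 ≤ m) (hm12 : m ≤ 12) (hr : 0 < r)
    (hcop : Nat.Coprime r m)
    (hord1 : r ^ 2 ≡ 1 [MOD m]) (hord2 : ¬ r ≡ 1 [MOD m])
    (hs : s = Nat.gcd (r - 1) m) (ht : t = m / s)
    (h2t : Nat.gcd 2 t = 1) (hst : Nat.gcd s t = 1) :
    (∃ (D : Type) (_ : DivisionRing D) (f : Gmr m t r →* Dˣ), Function.Injective f) ↔
      (Nonempty (Gmr m t r ≃* Multiplicative (ZMod 4)) ∨
       Nonempty (Gmr m t r ≃* QuaternionGroup 3) ∨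
       Nonempty (Gmr m t r ≃* QuaternionGroup 5)) := by
  constructor
  · rintro ⟨D, _, f, hf⟩
    have hc1 : r % m ≠ 0 := by
      intro h
      have h1 := Nat.eq_one_of_dvd_coprimes hcop (Nat.dvd_of_mod_eq_zero h) dvd_rfl
      omega
    have hg : Nat.gcd (r - 1) m = Nat.gcd (r % m - 1) m := by
      have h := Nat.div_add_mod r m
      have h2 : r - 1 = (r % m - 1) + m * (r / m) := by omega
      conv_lhs => rw [h2]
      simp
    rw [hg] at hs
    have hsq : (r % m) ^ 2 % m = 1 % m := by rw [← Nat.pow_mod]; exact hord1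
    have hne : r % m ≠ 1 := by
      intro h
      apply hord2
      rw [Nat.ModEq, h, Nat.mod_eq_of_lt (by omega)]
    subst hs
    have key := arith_aux m (by omega) hm2 (r % m) (Nat.mod_lt _ (by omega)) hsq hne
      (by rw [← ht]; exact h2t) (by rw [← ht]; exact hst)
    rw [← ht] at key
    clear ht hst hg
    rcases key with ⟨rfl, h⟩ | ⟨rfl, rfl, h⟩ | ⟨rfl, rfl, h⟩ | ⟨rfl, rfl, h⟩
    · exact (no_dihedral t r (by omega) h f hf).elim
    · exact Or.inr (Or.inl (g_quat 3 r h (by norm_num)))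
    · exact Or.inr (Or.inr (g_quat 5 r h (by norm_num)))
    · exact (no_twelve r h f hf).elim
  · rintro (⟨⟨e⟩⟩ | ⟨⟨e⟩⟩ | ⟨⟨e⟩⟩)
    · obtain ⟨f, hf⟩ := zmod4_embed
      exact ⟨ℂ, inferInstance, f.comp e.toMonoidHom, hf.comp e.injective⟩
    · obtain ⟨f, hf⟩ := quat_embed 3
      exact ⟨Quaternion ℝ, inferInstance, f.comp e.toMonoidHom, hf.comp e.injective⟩
    · obtain ⟨f, hf⟩ := quat_embed 5
      exact ⟨Quaternion ℝ, inferInstance, f.comp e.toMonoidHom, hf.comp e.injective⟩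
end

section
/- Let m and r be coprime positive integers and suppose the multiplicative order of r modulo m equals 2, so n = 2. Write m = 2^α·m′ with m′ odd and assume α ≥ 2 and m ≤ 12. Set s = gcd(r−1, m) and t = m/s, and assume s = 2s′ with s′ odd, gcd(s, t) = 2, gcd(2, t) = 2, and r ≡ −1 (mod 2^α). Then the group G_{m,r} can be embedded in a division ring if and only if G_{m,r} is isomorphic to the quaternion group Q₈, to the dicyclic group Dic₁₆ of order 16, or to the dicyclic group Dic₂₄ of order 24. -/
namespace AmitsurAux

/-- The additive-to-multiplicative power map `i ↦ x ^ i` on `ZMod N`. -/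
noncomputable def E {G : Type*} [Group G] (N : ℕ) (x : G) (hx : x ^ N = 1) :
    ZMod N →+ Additive G :=
  ZMod.lift N ⟨zmultiplesHom (Additive G) (Additive.ofMul x), by
    rw [zmultiplesHom_apply, ← ofMul_zpow, zpow_natCast, hx]; rfl⟩

theorem E_int {G : Type*} [Group G] (N : ℕ) (x : G) (hx : x ^ N = 1) (z : ℤ) :
    (E N x hx (z : ZMod N)).toMul = x ^ z := by
  unfold E
  rw [ZMod.lift_coe]
  simp [zmultiplesHom_apply]

theorem E_conj {G : Type*} [Group G] (N : ℕ) (x y : G) (hx : x ^ N = 1)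
    (hxy : y * x * y⁻¹ = x⁻¹) (i : ZMod N) :
    (E N x hx i).toMul * y = y * (E N x hx (-i)).toMul := by
  obtain ⟨z, rfl⟩ := ZMod.intCast_surjective i
  rw [← Int.cast_neg, E_int, E_int]
  have h : y * x ^ (-z) * y⁻¹ = x ^ z := by
    rw [← conj_zpow, hxy]; simp
  rw [← h]; group

/-- The universal property of the quaternion (dicyclic) group. -/
noncomputable def quatLift {G : Type*} [Group G] (k : ℕ) (x y : G) (hx : x ^ (2 * k) = 1)
    (hy : y ^ 2 = x ^ k) (hxy : y * x * y⁻¹ = x⁻¹) : QuaternionGroup k →* G :=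
  MonoidHom.mk' (fun g => match g with
    | .a i => (E (2 * k) x hx i).toMul
    | .xa i => y * (E (2 * k) x hx i).toMul) (by
    have hk : (E (2 * k) x hx (k : ZMod (2 * k))).toMul = y * y := by
      have := E_int (2 * k) x hx (k : ℤ)
      rw [Int.cast_natCast] at this
      rw [this, zpow_natCast, ← hy, sq]
    rintro (i | i) (j | j)
    · simp [map_add, toMul_add]
    · have h := E_conj (2 * k) x y hx hxy i
      simp only [QuaternionGroup.a_mul_xa]
      rw [← mul_assoc, h, mul_assoc, ← toMul_add, ← map_add]
      congr 4; ring
    · simp [map_add, toMul_add, mul_assoc]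
    · have h := E_conj (2 * k) x y hx hxy i
      simp only [QuaternionGroup.xa_mul_xa]
      rw [mul_assoc, ← mul_assoc _ y, h, ← mul_assoc, ← mul_assoc, ← hk, ← toMul_add, ← map_add,
        ← toMul_add, ← map_add]
      congr 3; ring)

section Pres

variable {m t r : ℕ}

theorem rel1 : (PresentedGroup.of 0 : Gmr m t r) ^ m = 1 :=
  PresentedGroup.one_of_mem (rels := GmrRels m t r) (x := FreeGroup.of 0 ^ m) (by simp [GmrRels])

theorem rel2 : (PresentedGroup.of 1 : Gmr m t r) ^ 2 = PresentedGroup.of 0 ^ t := by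
  have := PresentedGroup.one_of_mem (rels := GmrRels m t r)
    (x := FreeGroup.of 1 ^ 2 * (FreeGroup.of 0 ^ t)⁻¹) (by simp [GmrRels])
  exact mul_inv_eq_one.mp this

theorem rel3 : (PresentedGroup.of 1 : Gmr m t r) * PresentedGroup.of 0 * (PresentedGroup.of 1)⁻¹
    = PresentedGroup.of 0 ^ r := by
  have := PresentedGroup.one_of_mem (rels := GmrRels m t r)
    (x := FreeGroup.of 1 * FreeGroup.of 0 * (FreeGroup.of 1)⁻¹ * (FreeGroup.of 0 ^ r)⁻¹)
    (by simp [GmrRels])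
  exact mul_inv_eq_one.mp this

theorem exists_hom {G : Type*} [Group G] (x y : G) (h1 : x ^ m = 1) (h2 : y ^ 2 = x ^ t)
    (h3 : y * x * y⁻¹ = x ^ r) :
    ∃ f : Gmr m t r →* G, f (PresentedGroup.of 0) = x ∧ f (PresentedGroup.of 1) = y := by
  have h : ∀ w ∈ GmrRels m t r, FreeGroup.lift (![x, y] : Fin 2 → G) w = 1 := by
    rintro w (rfl | rfl | rfl)
    · simp [h1]
    · simp [h2]
    · simp [h3]
  exact ⟨PresentedGroup.toGroup h, by simp, by simp⟩

end Pres

theorem iso (k r : ℕ) (hr : 2 * k ∣ r + 1) :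
    Nonempty (Gmr (2 * k) k r ≃* QuaternionGroup k) := by
  have key : ∀ {G : Type} [Group G] (x : G), x ^ (2 * k) = 1 → x ^ r = x⁻¹ := by
    intro G _ x hx
    obtain ⟨c, hc⟩ := hr
    rw [eq_inv_iff_mul_eq_one, ← pow_succ, hc, pow_mul, hx, one_pow]
  have hx0 : (QuaternionGroup.a 1 : QuaternionGroup k) ^ (2 * k) = 1 :=
    QuaternionGroup.a_one_pow_n
  obtain ⟨f, f0, f1⟩ := exists_hom (m := 2 * k) (t := k) (r := r)
    (QuaternionGroup.a 1 : QuaternionGroup k) (QuaternionGroup.xa 0) hx0 (by simp) (by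
      rw [key _ hx0, mul_inv_eq_iff_eq_mul, eq_inv_mul_iff_mul_eq]
      simp)
  let g := quatLift k (PresentedGroup.of 0 : Gmr (2 * k) k r) (PresentedGroup.of 1) rel1 rel2
    (by rw [rel3, key _ rel1])
  have ga : g (.a 1) = PresentedGroup.of 0 := by
    have := E_int (2 * k) (PresentedGroup.of 0 : Gmr (2 * k) k r) rel1 1
    rw [Int.cast_one, zpow_one] at this
    exact this
  have gx : g (.xa 0) = PresentedGroup.of 1 := by
    change PresentedGroup.of 1 * (E _ _ _ 0).toMul = _
    simp
  have hgf : g.comp f = MonoidHom.id _ := by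
    apply PresentedGroup.ext
    intro i
    fin_cases i
    · simp [f0, ga]
    · simp [f1, gx]
  have fsurj : Function.Surjective f := by
    have ha : ∀ i, ∃ w, f w = .a i := by
      intro i
      obtain ⟨z, rfl⟩ := ZMod.intCast_surjective i
      refine ⟨PresentedGroup.of 0 ^ z, ?_⟩
      rw [map_zpow, f0]
      cases z with
      | ofNat n => simp
      | negSucc n =>
        rw [zpow_negSucc, QuaternionGroup.a_one_pow, inv_eq_iff_mul_eq_one]
        simp
    rintro (i | i)
    · exact ha i
    · obtain ⟨w, hw⟩ := ha i
      exact ⟨PresentedGroup.of 1 * w, by rw [map_mul, f1, hw]; simp⟩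
  have finj : Function.Injective f := by
    intro u v huv
    have := congrArg g huv
    have e : ∀ u, g (f u) = u := fun u => DFunLike.congr_fun hgf u
    rwa [e, e] at this
  exact ⟨MulEquiv.ofBijective f ⟨finj, fsurj⟩⟩

open Quaternion in
theorem embed (k : ℕ) (hk : k ≠ 0) :
    ∃ f : QuaternionGroup k →* ℍ[ℝ]ˣ, Function.Injective f := by
  have hk2 : 2 * k ≠ 0 := by omega
  obtain ⟨ζ, hζ⟩ : ∃ ζ : ℂ, IsPrimitiveRoot ζ (2 * k) :=
    ⟨_, Complex.isPrimitiveRoot_exp (2 * k) hk2⟩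
  have hpow : ζ ^ (2 * k) = 1 := hζ.pow_eq_one
  have hζ0 : ζ ≠ 0 := hζ.ne_zero hk2
  have hζk : ζ ^ k = -1 := by
    have h1 : ζ ^ k * ζ ^ k = 1 := by rw [← pow_add, ← two_mul, hpow]
    rcases mul_self_eq_one_iff.mp h1 with h | h
    · exact absurd (hζ.dvd_of_pow_eq_one k h) (fun hd => by
        have := Nat.le_of_dvd (by omega) hd; omega)
    · exact h
  have hnorm : ‖ζ‖ = 1 := Complex.norm_eq_one_of_pow_eq_one hpow hk2
  have hconj : (starRingEnd ℂ) ζ = ζ⁻¹ := (Complex.inv_eq_conj hnorm).symm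
  let φ : ℂˣ →* ℍ[ℝ]ˣ := Units.map (Quaternion.ofComplex : ℂ →ₐ[ℝ] ℍ[ℝ]).toRingHom.toMonoidHom
  let u : ℂˣ := Units.mk0 ζ hζ0
  obtain ⟨J, J0, J1, J2, J3⟩ : ∃ J : ℍ[ℝ], J.re = 0 ∧ J.imI = 0 ∧ J.imJ = 1 ∧ J.imK = 0 :=
    ⟨⟨0, 0, 1, 0⟩, rfl, rfl, rfl, rfl⟩
  have hJJ : J * J = -1 := by ext <;> simp [J0, J1, J2, J3]
  let y : ℍ[ℝ]ˣ := ⟨J, -J, by rw [mul_neg, hJJ, neg_neg], by rw [neg_mul, hJJ, neg_neg]⟩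
  have φval : ∀ w : ℂˣ, (φ w : ℍ[ℝ]) = Quaternion.coeComplex w := fun w => rfl
  have φinj : Function.Injective φ := by
    intro a b hab
    have := congrArg Units.val hab
    rw [φval, φval] at this
    apply Units.ext
    apply Complex.ext
    · simpa using congrArg (fun q : ℍ[ℝ] => q.re) this
    · simpa using congrArg (fun q : ℍ[ℝ] => q.imI) this
  have hu : IsPrimitiveRoot u (2 * k) := by
    rw [← IsPrimitiveRoot.coe_units_iff]; exact hζ
  have hx : φ u ^ (2 * k) = 1 := by rw [← map_pow, hu.pow_eq_one, map_one]
  let f := quatLift k (φ u) y hx (by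
      rw [← map_pow]
      apply Units.ext
      rw [φval, Units.val_pow_eq_pow_val, Units.val_pow_eq_pow_val]
      change J ^ 2 = Quaternion.coeComplex (ζ ^ k)
      rw [hζk, sq, hJJ]
      ext <;> simp) (by
      rw [mul_inv_eq_iff_eq_mul, ← map_inv]
      apply Units.ext
      rw [Units.val_mul, Units.val_mul, φval, φval]
      change J * Quaternion.coeComplex ζ = Quaternion.coeComplex (((u⁻¹ : ℂˣ) : ℂ)) * J
      have : ((u⁻¹ : ℂˣ) : ℂ) = (starRingEnd ℂ) ζ := by
        rw [hconj, Units.val_inv_eq_inv_val]; rfl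
      rw [this]
      ext <;> simp [J0, J1, J2, J3])
  refine ⟨f, (injective_iff_map_eq_one f).mpr ?_⟩
  rintro (i | i) h
  · obtain ⟨z, rfl⟩ := ZMod.intCast_surjective i
    have h' : φ u ^ z = 1 := (E_int _ _ hx z).symm.trans h
    rw [← map_zpow] at h'
    have h2 : u ^ z = 1 := φinj (h'.trans (map_one φ).symm)
    rw [hu.zpow_eq_one_iff_dvd] at h2
    rw [(ZMod.intCast_zmod_eq_zero_iff_dvd z (2 * k)).mpr h2]
    rfl
  · exfalso
    obtain ⟨z, rfl⟩ := ZMod.intCast_surjective i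
    have h' : y * φ u ^ z = 1 := by
      rw [← E_int _ _ hx z]; exact h
    rw [← map_zpow] at h'
    have h2 := congrArg Units.val h'
    rw [Units.val_mul, φval] at h2
    have h3 := congrArg (fun q : ℍ[ℝ] => q.re) h2
    change (J * Quaternion.coeComplex _).re = (1 : ℍ[ℝ]).re at h3
    simp [J0, J1, J2, J3] at h3

/-- `C₃ × Q₈` does not embed in a division ring. -/
theorem no_embed (D : Type) [DivisionRing D] (x y : D) (h12 : x ^ 12 = 1) (h6 : x ^ 6 ≠ 1)
    (h4 : x ^ 4 ≠ 1) (hy : y ^ 2 = x ^ 2) (hxy : y * x = x ^ 7 * y) : False := by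
  have h6' : x ^ 6 = -1 := by
    have : x ^ 6 * x ^ 6 = 1 := by rw [← pow_add]; exact h12
    exact (mul_self_eq_one_iff.mp this).resolve_left h6
  have hne : (-1 : D) ≠ 1 := fun h => h6 (h6'.trans h)
  have h2 : (2 : D) ≠ 0 := by
    intro h
    apply hne
    have : (1 : D) + 1 = 0 := by rw [one_add_one_eq_two, h]
    exact neg_eq_of_add_eq_zero_left this
  have hxy' : y * x = - (x * y) := by
    rw [hxy, pow_succ, h6']; noncomm_ring
  have hq : x ^ 4 = x ^ 2 - 1 := by
    have : (x ^ 4 - 1) * (x ^ 4 - x ^ 2 + 1) = 0 := by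
      have e : (x ^ 4 - 1) * (x ^ 4 - x ^ 2 + 1) = (x ^ 2 - 1) * (x ^ 6 + 1) := by noncomm_ring
      rw [e, h6']; simp
    have := (mul_eq_zero.mp this).resolve_left (sub_ne_zero.mpr h4)
    rw [← sub_eq_zero, ← this]; noncomm_ring
  have hyx2 : y * x ^ 4 = x ^ 4 * y := by
    have e : y * x ^ 4 = (y * x) * x * x * x := by noncomm_ring
    have e1 : ∀ w : D, -(x * y) * w = -(x * (y * w)) := by intro w; noncomm_ring
    have c2 : y * x * x = x * x * y := by
      rw [hxy', e1, hxy']; noncomm_ring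
    rw [e, c2]
    have e2 : x * x * y * x * x = x * x * (y * x * x) := by noncomm_ring
    rw [e2, c2]; noncomm_ring
  have hz : x ^ 4 * y * (x ^ 4 * y) = -x ^ 4 := by
    have e : x ^ 4 * y * (x ^ 4 * y) = x ^ 4 * (y * x ^ 4) * y := by noncomm_ring
    have e2 : x ^ 4 * (x ^ 4 * y) * y = x ^ 8 * y ^ 2 := by noncomm_ring
    rw [e, hyx2, e2, hy]
    have e3 : x ^ 8 * x ^ 2 = x ^ 6 * x ^ 4 := by noncomm_ring
    rw [e3, h6']; noncomm_ring
  have hc : x ^ 4 * y * x = -(x * (x ^ 4 * y)) := by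
    rw [mul_assoc, hxy']; noncomm_ring
  generalize x ^ 4 * y = z at hz hc
  have hp : (x + z) * (x + z) = 1 := by
    have e : (x + z) * (x + z) = x ^ 2 + x * z + z * x + z * z := by noncomm_ring
    rw [e, hz, hc, hq]; noncomm_ring
  have hp' : (x - z) * (x - z) = 1 := by
    have e : (x - z) * (x - z) = x ^ 2 - x * z - z * x + z * z := by noncomm_ring
    rw [e, hz, hc, hq]; noncomm_ring
  have hsum : 2 * x = (x + z) + (x - z) := by noncomm_ring
  rcases mul_self_eq_one_iff.mp hp with h | h <;> rcases mul_self_eq_one_iff.mp hp' with h' | h' <;>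
    rw [h, h'] at hsum
  · have : x = 1 := mul_left_cancel₀ h2 (by rw [hsum]; norm_num)
    exact h6 (by rw [this]; simp)
  · have : x = 0 := mul_left_cancel₀ h2 (by rw [hsum]; norm_num)
    rw [this] at h12; simp at h12
  · have : x = 0 := mul_left_cancel₀ h2 (by rw [hsum]; norm_num)
    rw [this] at h12; simp at h12
  · have : x = -1 := mul_left_cancel₀ h2 (by rw [hsum]; norm_num)
    exact h6 (by rw [this]; norm_num)

theorem no_embed_group (r : ℕ) (hr : r % 12 = 7) (D : Type) [DivisionRing D]
    (f : Gmr 12 2 r →* Dˣ) (hf : Function.Injective f) : False := by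
  have key : ∀ {G : Type} [Group G] (x : G), x ^ 12 = 1 → x ^ r = x ^ 7 := by
    intro G _ x hx
    rw [← Nat.div_add_mod r 12, hr, pow_add, pow_mul, hx, one_pow, one_mul]
  let X : QuaternionGroup 2 × Multiplicative (ZMod 3) := (.a 1, Multiplicative.ofAdd 1)
  let Y : QuaternionGroup 2 × Multiplicative (ZMod 3) := (.xa 0, Multiplicative.ofAdd 1)
  have hX : X ^ 12 = 1 := by decide
  obtain ⟨g, g0, -⟩ := exists_hom (m := 12) (t := 2) (r := r) X Y hX (by decide)
    (by rw [key _ hX]; decide)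
  have n4 : (PresentedGroup.of 0 : Gmr 12 2 r) ^ 4 ≠ 1 := by
    intro h
    have h' := congrArg g h
    rw [map_pow, g0, map_one] at h'
    revert h'; decide
  have n6 : (PresentedGroup.of 0 : Gmr 12 2 r) ^ 6 ≠ 1 := by
    intro h
    have h' := congrArg g h
    rw [map_pow, g0, map_one] at h'
    revert h'; decide
  have r3 := rel3 (m := 12) (t := 2) (r := r)
  rw [key _ rel1, mul_inv_eq_iff_eq_mul] at r3
  refine no_embed D (f (PresentedGroup.of 0)) (f (PresentedGroup.of 1)) ?_ ?_ ?_ ?_ ?_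
  · rw [← Units.val_pow_eq_pow_val, ← map_pow, rel1, map_one, Units.val_one]
  · rw [← Units.val_pow_eq_pow_val, ← map_pow]
    intro h
    exact n6 (hf ((Units.ext h).trans (map_one f).symm))
  · rw [← Units.val_pow_eq_pow_val, ← map_pow]
    intro h
    exact n4 (hf ((Units.ext h).trans (map_one f).symm))
  · rw [← Units.val_pow_eq_pow_val, ← map_pow, rel2, map_pow, Units.val_pow_eq_pow_val]
  · rw [← Units.val_pow_eq_pow_val, ← Units.val_mul, ← map_mul, r3, map_mul, map_pow,
      Units.val_mul]

theorem gcd_aux (n m c : ℕ) (h : n % m = c) : Nat.gcd n m = Nat.gcd c m := by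
  rw [Nat.gcd_comm, Nat.gcd_rec, h]

end AmitsurAux

theorem amitsur_C2_case (m r s t α m' s' : ℕ) (hr : 0 < r)
    (hcop : Nat.Coprime r m)
    (hord1 : r ^ 2 ≡ 1 [MOD m]) (hord2 : ¬ r ≡ 1 [MOD m])
    (hα : 2 ≤ α) (hm' : Odd m') (hm : m = 2 ^ α * m') (hm12 : m ≤ 12)
    (hs : s = Nat.gcd (r - 1) m) (ht : t = m / s)
    (hs' : Odd s') (hss' : s = 2 * s')
    (hst : Nat.gcd s t = 2) (h2t : Nat.gcd 2 t = 2)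
    (hrα : (r : ZMod (2 ^ α)) = -1) :
    (∃ (D : Type) (_ : DivisionRing D) (f : Gmr m t r →* Dˣ), Function.Injective f) ↔
      (Nonempty (Gmr m t r ≃* QuaternionGroup 2) ∨
       Nonempty (Gmr m t r ≃* QuaternionGroup 4) ∨
       Nonempty (Gmr m t r ≃* QuaternionGroup 6)) := by
  constructor
  · rintro ⟨D, _, f, hf⟩
    have hd : 2 ^ α ∣ r + 1 := by
      rw [← ZMod.natCast_eq_zero_iff]
      push_cast
      rw [hrα]; simp
    have hm'0 : 0 < m' := hm'.pos
    have hα3 : α ≤ 3 := by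
      by_contra hcon
      have h16 : 2 ^ 4 ≤ 2 ^ α := Nat.pow_le_pow_right (by norm_num) (by omega)
      nlinarith
    have hcases : α = 2 ∧ m' = 1 ∨ α = 2 ∧ m' = 3 ∨ α = 3 ∧ m' = 1 := by
      obtain ⟨c, rfl⟩ := hm'
      interval_cases α <;> omega
    rcases hcases with ⟨rfl, rfl⟩ | ⟨rfl, rfl⟩ | ⟨rfl, rfl⟩
    · norm_num at hm hd
      subst hm
      rw [AmitsurAux.gcd_aux (r - 1) 4 2 (by omega)] at hs
      norm_num at hs
      subst hs
      norm_num at ht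
      subst ht
      exact Or.inl (AmitsurAux.iso 2 r hd)
    · norm_num at hm hd
      subst hm
      have h3 : r % 12 = 3 ∨ r % 12 = 7 ∨ r % 12 = 11 := by omega
      rcases h3 with h3 | h3 | h3
      · exfalso
        have := AmitsurAux.gcd_aux r 12 3 h3
        rw [hcop] at this
        norm_num at this
      · exfalso
        rw [AmitsurAux.gcd_aux (r - 1) 12 6 (by omega)] at hs
        norm_num at hs
        subst hs
        norm_num at ht
        subst ht
        exact AmitsurAux.no_embed_group r h3 D f hf
      · rw [AmitsurAux.gcd_aux (r - 1) 12 10 (by omega)] at hs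
        norm_num at hs
        subst hs
        norm_num at ht
        subst ht
        exact Or.inr (Or.inr (AmitsurAux.iso 6 r (by omega)))
    · norm_num at hm hd
      subst hm
      rw [AmitsurAux.gcd_aux (r - 1) 8 6 (by omega)] at hs
      norm_num at hs
      subst hs
      norm_num at ht
      subst ht
      exact Or.inr (Or.inl (AmitsurAux.iso 4 r hd))
  · have main : ∀ k, k ≠ 0 → Nonempty (Gmr m t r ≃* QuaternionGroup k) →
        ∃ (D : Type) (_ : DivisionRing D) (f : Gmr m t r →* Dˣ), Function.Injective f := by
      rintro k hk ⟨e⟩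
      obtain ⟨f, hf⟩ := AmitsurAux.embed k hk
      exact ⟨Quaternion ℝ, inferInstance, f.comp e.toMonoidHom, hf.comp e.injective⟩
    rintro (h | h | h)
    · exact main 2 (by norm_num) h
    · exact main 4 (by norm_num) h
    · exact main 6 (by norm_num) h
end

section
/- Let D be a division ring that is a finite-dimensional ℚ-algebra with dim_ℚ D ≤ 8, and let K be the center of D; assume dim_K D = 4 (so D is a quaternion division algebra over K). If G is a finite group of even order admitting an injective group homomorphism into the unit group Dˣ, then G is isomorphic to one of the following groups: the cyclic groups ℤ/2ℤ, ℤ/4ℤ, ℤ/6ℤ, ℤ/8ℤ, ℤ/10ℤ, ℤ/12ℤ; the quaternion group Q₈; the dicyclic groups Dic₁₂, Dic₁₆, Dic₂₀, Dic₂₄; the binary tetrahedral group SL(2, 𝔽₃); the binary octahedral group 2O; or the binary icosahedral group SL(2, 𝔽₅). Moreover, if G is isomorphic to 2O then 2 is a square in K, and if G is isomorphic to SL(2, 𝔽₅) then 5 is a square in K. -/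
/-- A group `G` is a binary octahedral group `2O` if it has order `48` and possesses a unique
element `z` of order `2` such that the quotient by the (normal) subgroup generated by `z` is
isomorphic to the symmetric group on four letters. -/
def IsBinaryOctahedralGroup (G : Type) [Group G] [Fintype G] : Prop :=
  Fintype.card G = 48 ∧
    ∃! z : G, orderOf z = 2 ∧
      Nonempty ((G ⧸ Subgroup.normalClosure ({z} : Set G)) ≃* Equiv.Perm (Fin 4))


/-- Abstract properties of finite nonabelian even-order subgroups of norm-one quaternions. -/
structure BP (G : Type) [Group G] (z : G) : Prop where
  z_ne : z ≠ 1
  z_sq : z * z = 1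
  inv : ∀ g : G, g * g = 1 → g = 1 ∨ g = z
  ct : ∀ g x y : G, g ≠ 1 → g ≠ z → g * x = x * g → g * y = y * g → x * y = y * x
  ord : ∀ g : G, orderOf g ∈ ({1, 2, 3, 4, 5, 6, 8, 10, 12} : Finset ℕ)
  cj : ∀ g x : G, g ≠ 1 → g ≠ z → g * (x * g * x⁻¹) = (x * g * x⁻¹) * g →
    x * g * x⁻¹ = g ∨ x * g * x⁻¹ = g⁻¹
  cyc : ∀ H : Subgroup G, (∀ x ∈ H, ∀ y ∈ H, x * y = y * x) → IsCyclic H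

/-- There is a noncentral element generating a normal subgroup. -/
def CaseI (G : Type) [Group G] (z : G) : Prop :=
  ∃ g : G, g ≠ 1 ∧ g ≠ z ∧ ∀ x, x * g * x⁻¹ = g ∨ x * g * x⁻¹ = g⁻¹

namespace BP

variable {G : Type} [Group G] {z : G}

theorem z_comm (h : BP G z) (g : G) : g * z = z * g := by
  have h1 : (g * z * g⁻¹) * (g * z * g⁻¹) = 1 := by
    have : (g * z * g⁻¹) * (g * z * g⁻¹) = g * (z * z) * g⁻¹ := by group
    rw [this, h.z_sq]; group
  rcases h.inv _ h1 with h2 | h2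
  · exfalso; apply h.z_ne
    have : z = g⁻¹ * (g * z * g⁻¹) * g := by group
    rw [this, h2]; group
  · exact mul_inv_eq_iff_eq_mul.mp h2

theorem sub (h : BP G z) (H : Subgroup G) (hz : z ∈ H) : BP H ⟨z, hz⟩ where
  z_ne := fun e => h.z_ne (congrArg Subtype.val e)
  z_sq := Subtype.ext h.z_sq
  inv := fun g hg => (h.inv g (congrArg Subtype.val hg)).imp
    (fun e => Subtype.ext e) (fun e => Subtype.ext e)
  ct := fun g x y h1 h2 hx hy => Subtype.ext (h.ct g x y (fun e => h1 (Subtype.ext e))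
    (fun e => h2 (Subtype.ext e)) (congrArg Subtype.val hx) (congrArg Subtype.val hy))
  ord := fun g => by rw [← Subgroup.orderOf_coe]; exact h.ord g
  cj := fun g x h1 h2 hx => (h.cj g x (fun e => h1 (Subtype.ext e))
    (fun e => h2 (Subtype.ext e)) (congrArg Subtype.val hx)).imp
    (fun e => Subtype.ext e) (fun e => Subtype.ext e)
  cyc := fun K hK => by
    have := h.cyc (K.map H.subtype) (by
      rintro _ ⟨x, hx, rfl⟩ _ ⟨y, hy, rfl⟩
      exact congrArg Subtype.val (hK x hx y hy))
    exact (K.equivMapOfInjective H.subtype H.subtype_injective).isCyclic.mpr this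

theorem orderOf_z (h : BP G z) : orderOf z = 2 :=
  orderOf_eq_prime (by rw [pow_two]; exact h.z_sq) h.z_ne

theorem orderOf_eq_two (h : BP G z) {g : G} (hg : orderOf g = 2) : g = z := by
  have h1 : g * g = 1 := by rw [← pow_two, ← hg]; exact pow_orderOf_eq_one g
  rcases h.inv g h1 with h2 | h2
  · subst h2; simp at hg
  · exact h2

/-- a commutative normal subgroup with a noncentral element gives case I -/
theorem caseI_of_normal (h : BP G z) (N : Subgroup G) [hN : N.Normal]
    (hc : ∀ x ∈ N, ∀ y ∈ N, x * y = y * x) (g : G) (hg : g ∈ N) (h1 : g ≠ 1) (h2 : g ≠ z) :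
    CaseI G z :=
  ⟨g, h1, h2, fun x => h.cj g x h1 h2 (hc g hg _ (hN.conj_mem g hg x))⟩

/-- commutativity of subgroups of odd prime power order -/
theorem comm_of_pgroup (h : BP G z) [Finite G] (N : Subgroup G) (p : ℕ) [Fact p.Prime] (hp2 : p ≠ 2)
    (hN : IsPGroup p N) : ∀ x ∈ N, ∀ y ∈ N, x * y = y * x := by
  rcases subsingleton_or_nontrivial N with hs | hs
  · intro x hx y hy
    have := congrArg Subtype.val (Subsingleton.elim (⟨x, hx⟩ : N) ⟨y, hy⟩)
    simp only at this
    rw [this]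
  · have := hN.center_nontrivial
    obtain ⟨⟨⟨c, hcN⟩, hc⟩, hc1⟩ := exists_ne (1 : Subgroup.center N)
    have hc1' : c ≠ 1 := fun e => hc1 (by ext; simpa using e)
    have hcz : c ≠ z := by
      rintro rfl
      obtain ⟨k, hk⟩ := hN ⟨c, hcN⟩
      have hk' : c ^ (p ^ k) = 1 := by simpa using congrArg Subtype.val hk
      have := orderOf_dvd_of_pow_eq_one hk'
      rw [h.orderOf_z] at this
      have := Nat.Prime.dvd_of_dvd_pow Nat.prime_two this
      exact hp2 ((Nat.prime_dvd_prime_iff_eq Nat.prime_two Fact.out).mp this).symm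
    have key : ∀ x ∈ N, c * x = x * c := fun x hx => by
      have := Subgroup.mem_center_iff.mp hc ⟨x, hx⟩
      exact (congrArg Subtype.val this).symm
    intro x hx y hy
    exact h.ct c x y hc1' hcz (key x hx) (key y hy)

theorem caseI_of_normal_pgroup (h : BP G z) [Finite G] (N : Subgroup G) [hN : N.Normal]
    (p : ℕ) [Fact p.Prime] (hp2 : p ≠ 2) (hP : IsPGroup p N) (hne : N ≠ ⊥) : CaseI G z := by
  obtain ⟨⟨g, hg⟩, hg1⟩ := Subgroup.ne_bot_iff_exists_ne_one.mp hne
  have hg1' : g ≠ 1 := fun e => hg1 (by ext; simpa using e)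
  refine h.caseI_of_normal N (h.comm_of_pgroup N p hp2 hP) g hg hg1' ?_
  rintro rfl
  obtain ⟨k, hk⟩ := hP ⟨g, hg⟩
  have hk' : g ^ (p ^ k) = 1 := by simpa using congrArg Subtype.val hk
  have := orderOf_dvd_of_pow_eq_one hk'
  rw [h.orderOf_z] at this
  have := Nat.Prime.dvd_of_dvd_pow Nat.prime_two this
  exact hp2 ((Nat.prime_dvd_prime_iff_eq Nat.prime_two Fact.out).mp this).symm

/-- A commutative subgroup is generated by an element of its cardinality. -/
theorem card_mem (h : BP G z) [Finite G] (H : Subgroup G) (hc : ∀ x ∈ H, ∀ y ∈ H, x * y = y * x) :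
    ∃ a ∈ H, orderOf a = Nat.card H ∧ H = Subgroup.zpowers a := by
  obtain ⟨⟨a, ha⟩, hg⟩ := (h.cyc H hc).exists_generator
  refine ⟨a, ha, ?_, ?_⟩
  · rw [← orderOf_eq_card_of_forall_mem_zpowers hg, ← Subgroup.orderOf_coe]
  · apply le_antisymm
    · intro x hx
      obtain ⟨k, hk⟩ := Subgroup.mem_zpowers_iff.mp (hg ⟨x, hx⟩)
      exact Subgroup.mem_zpowers_iff.mpr ⟨k, by simpa using congrArg Subtype.val hk⟩
    · simpa using ha

/-- odd Sylow subgroups -/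
theorem card_odd_sylow (h : BP G z) [Finite G] (N : Subgroup G) (p : ℕ) [Fact p.Prime] (hp2 : p ≠ 2)
    (hN : IsPGroup p N) : Nat.card N = 1 ∨ (Nat.card N = p ∧ (p = 3 ∨ p = 5)) := by
  obtain ⟨a, ha, ho, -⟩ := h.card_mem N (h.comm_of_pgroup N p hp2 hN)
  obtain ⟨k, hk⟩ := IsPGroup.iff_card.mp hN
  have hp : p.Prime := Fact.out
  have hord := h.ord a
  rw [ho] at hord
  rcases Nat.eq_zero_or_pos k with rfl | hk0
  · left; simpa using hk
  right
  have hodd : p % 2 = 1 := hp.eq_two_or_odd.resolve_left hp2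
  have h3 : 3 ≤ p := by have := hp.two_le; omega
  have hle : p ^ k ≤ 12 := by
    rw [← hk]
    simp only [Finset.mem_insert, Finset.mem_singleton] at hord
    omega
  have hk1 : k = 1 := by
    by_contra hne
    have hk2 : 2 ≤ k := by omega
    have hp3 : p = 3 := by
      by_contra hp3
      have : 5 ≤ p := by omega
      have := Nat.pow_le_pow_left this k
      have := Nat.pow_le_pow_right (n := 5) (by norm_num) hk2
      omega
    subst hp3
    have : k = 2 := by
      by_contra h2
      have := Nat.pow_le_pow_right (n := 3) (by norm_num) (show 3 ≤ k by omega)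
      omega
    subst this
    rw [hk] at hord
    simp at hord
  subst hk1
  rw [pow_one] at hk
  refine ⟨hk, ?_⟩
  rw [hk] at hord
  simp only [Finset.mem_insert, Finset.mem_singleton] at hord
  rcases hord with e | e | e | e | e | e | e | e | e <;> omega

/-- the centralizer in case I -/
theorem caseI_index (h : BP G z) [Finite G] (g : G) (h1 : g ≠ 1) (h2 : g ≠ z)
    (hx : ∀ x, x * g * x⁻¹ = g ∨ x * g * x⁻¹ = g⁻¹) (hn : ∃ x y : G, x * y ≠ y * x) :
    (Subgroup.centralizer {g}).index = 2 := by
  rw [Subgroup.index_eq_two_iff_exists_notMem_and]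
  have mem : ∀ x : G, x ∈ Subgroup.centralizer {g} ↔ g * x = x * g := by
    intro x; rw [Subgroup.mem_centralizer_singleton_iff]; exact eq_comm
  have : ∃ b, ¬ (g * b = b * g) := by
    by_contra hcon
    push Not at hcon
    obtain ⟨x, y, hxy⟩ := hn
    exact hxy (h.ct g x y h1 h2 (hcon x) (hcon y))
  obtain ⟨b, hb⟩ := this
  refine ⟨b, by rwa [mem], fun c => ?_⟩
  by_cases hc : g * c = c * g
  · right; rwa [mem]
  · left
    rw [mem]
    have key : ∀ x, ¬ (g * x = x * g) → x * g * x⁻¹ = g⁻¹ := by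
      intro x hx'
      rcases hx x with e | e
      · exfalso; apply hx'; rw [mul_inv_eq_iff_eq_mul] at e; exact e.symm
      · exact e
    have e1 := key b hb
    have e2 := key c hc
    have : (c * b) * g * (c * b)⁻¹ = g := by
      calc (c * b) * g * (c * b)⁻¹ = c * (b * g * b⁻¹) * c⁻¹ := by group
        _ = (c * g * c⁻¹)⁻¹ := by rw [e1]; group
        _ = g := by rw [e2, inv_inv]
    rw [mul_inv_eq_iff_eq_mul] at this
    exact this.symm

theorem centralizer_comm (h : BP G z) (g : G) (h1 : g ≠ 1) (h2 : g ≠ z) :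
    ∀ x ∈ Subgroup.centralizer {g}, ∀ y ∈ Subgroup.centralizer {g}, x * y = y * x := by
  intro x hx y hy
  rw [Subgroup.mem_centralizer_singleton_iff] at hx hy
  exact h.ct g x y h1 h2 hx.symm hy.symm

/-- nonabelian 2-groups are in case I -/
theorem caseI_of_two_group (h : BP G z) [Finite G] (hP : IsPGroup 2 G)
    (hn : ∃ x y : G, x * y ≠ y * x) : CaseI G z := by
  have hQ : IsPGroup 2 (G ⧸ Subgroup.center G) := hP.to_quotient _
  have : Nontrivial (G ⧸ Subgroup.center G) := by
    rw [QuotientGroup.nontrivial_iff]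
    intro htop
    obtain ⟨x, y, hxy⟩ := hn
    apply hxy
    have : y ∈ Subgroup.center G := by rw [htop]; trivial
    exact Subgroup.mem_center_iff.mp this x
  have := hQ.center_nontrivial
  obtain ⟨⟨c, hc⟩, hc1⟩ := exists_ne (1 : Subgroup.center (G ⧸ Subgroup.center G))
  obtain ⟨g, rfl⟩ := QuotientGroup.mk_surjective c
  have hg : g ∉ Subgroup.center G := fun hg => hc1 (by
    ext; simpa using (QuotientGroup.eq_one_iff g).mpr hg)
  have h1 : g ≠ 1 := by rintro rfl; exact hg (Subgroup.one_mem _)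
  have h2 : g ≠ z := by
    rintro rfl; exact hg (Subgroup.mem_center_iff.mpr fun x => h.z_comm x)
  refine ⟨g, h1, h2, fun x => h.cj g x h1 h2 ?_⟩
  have e := Subgroup.mem_center_iff.mp hc (x : G ⧸ Subgroup.center G)
  have e2 : ((x * g * x⁻¹ * g⁻¹ : G) : G ⧸ Subgroup.center G) = 1 := by
    rw [QuotientGroup.mk_mul, QuotientGroup.mk_mul, QuotientGroup.mk_mul, e]
    rw [QuotientGroup.mk_inv, QuotientGroup.mk_inv]; group
  rw [QuotientGroup.eq_one_iff] at e2
  have e3 := Subgroup.mem_center_iff.mp e2 g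
  calc g * (x * g * x⁻¹) = g * (x * g * x⁻¹ * g⁻¹) * g := by group
    _ = _ := by rw [e3]; group

theorem card_two_group (h : BP G z) [Finite G] (hP : IsPGroup 2 G) :
    Nat.card G ∈ ({2, 4, 8, 16} : Finset ℕ) ∧ (∀ x : G, orderOf x ≠ 8) →
    Nat.card G ∈ ({2, 4, 8} : Finset ℕ) := by
  rintro ⟨h1, h8⟩
  simp only [Finset.mem_insert, Finset.mem_singleton] at h1 ⊢
  rcases h1 with h1 | h1 | h1 | h1
  · simp [h1]
  · simp [h1]
  · simp [h1]
  exfalso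
  by_cases hn : ∃ x y : G, x * y ≠ y * x
  · obtain ⟨g, g1, g2, hx⟩ := h.caseI_of_two_group hP hn
    have hi := h.caseI_index g g1 g2 hx hn
    have := (Subgroup.centralizer {g}).card_mul_index
    obtain ⟨a, -, ha, -⟩ := h.card_mem _ (h.centralizer_comm g g1 g2)
    rw [hi] at this
    exact h8 a (by omega)
  · push Not at hn
    obtain ⟨a, -, ha, -⟩ := h.card_mem ⊤ (fun x _ y _ => hn x y)
    have := h.ord a
    rw [ha, Subgroup.card_top, h1] at this
    simp at this

theorem card_two_group' (h : BP G z) [Finite G] (hP : IsPGroup 2 G) :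
    Nat.card G ∈ ({2, 4, 8, 16} : Finset ℕ) := by
  obtain ⟨k, hk⟩ := IsPGroup.iff_card.mp hP
  have hz : 2 ∣ Nat.card G := by rw [← h.orderOf_z]; exact orderOf_dvd_natCard z
  have key : ∀ m, (m ∈ ({1, 2, 3, 4, 5, 6, 8, 10, 12} : Finset ℕ)) → m ≤ 12 := by decide
  have hle : Nat.card G ≤ 24 := by
    by_cases hn : ∃ x y : G, x * y ≠ y * x
    · obtain ⟨g, g1, g2, hx⟩ := h.caseI_of_two_group hP hn
      have hi := h.caseI_index g g1 g2 hx hn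
      have := (Subgroup.centralizer {g}).card_mul_index
      obtain ⟨a, -, ha, -⟩ := h.card_mem _ (h.centralizer_comm g g1 g2)
      have := key _ (h.ord a)
      rw [hi] at *
      omega
    · push Not at hn
      obtain ⟨a, -, ha, -⟩ := h.card_mem ⊤ (fun x _ y _ => hn x y)
      have := key _ (h.ord a)
      rw [Subgroup.card_top] at ha
      omega
  have hk5 : k < 5 := by
    by_contra hcon
    have := Nat.pow_le_pow_right (n := 2) (by norm_num) (show 5 ≤ k by omega)
    omega
  rw [hk] at hz ⊢
  interval_cases k <;> simp_all

end BP

namespace BP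

variable {G : Type} [Group G] {z : G}

theorem dicyclic (h : BP G z) [Finite G] (hn : ∃ x y : G, x * y ≠ y * x) (hI : CaseI G z) :
    ∃ k ∈ ({2, 3, 4, 5, 6} : Finset ℕ), Nonempty (G ≃* QuaternionGroup k) := by
  obtain ⟨g, g1, g2, hx⟩ := hI
  have hi := h.caseI_index g g1 g2 hx hn
  obtain ⟨a, haC, ha, hCa⟩ := h.card_mem _ (h.centralizer_comm g g1 g2)
  have hcard := (Subgroup.centralizer {g}).card_mul_index
  rw [hi] at hcard
  have hCn : (Subgroup.centralizer {g}).Normal := Subgroup.normal_of_index_eq_two hi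
  set C := Subgroup.centralizer {g} with hC
  have hgC : g ∈ C := by rw [hC, Subgroup.mem_centralizer_singleton_iff]
  have hzC : z ∈ C := by rw [hC, Subgroup.mem_centralizer_singleton_iff]; exact (h.z_comm g).symm
  have h2 : 2 ∣ orderOf a := by
    rw [ha, ← h.orderOf_z]; exact Subgroup.orderOf_dvd_natCard C hzC
  have a1 : a ≠ 1 := by
    rintro rfl; rw [Subgroup.zpowers_one_eq_bot] at hCa
    rw [hCa] at hgC; exact g1 (Subgroup.mem_bot.mp hgC)
  have a2 : a ≠ z := by
    rintro rfl
    rw [hCa] at hgC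
    obtain ⟨j, hj⟩ := Subgroup.mem_zpowers_iff.mp hgC
    have hsq : g * g = 1 := by
      rw [← hj, ← zpow_add, ← two_mul, zpow_mul, zpow_two, h.z_sq, one_zpow]
    rcases h.inv g hsq with e | e
    · exact g1 e
    · exact g2 e
  obtain ⟨k, hk⟩ := h2
  have hk2 : k ∈ ({2, 3, 4, 5, 6} : Finset ℕ) := by
    have := h.ord a
    have n2 : orderOf a ≠ 2 := fun e => a2 (h.orderOf_eq_two e)
    have n1 : orderOf a ≠ 1 := fun e => a1 (orderOf_eq_one_iff.mp e)
    simp only [Finset.mem_insert, Finset.mem_singleton] at this ⊢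
    omega
  have hkpos : 0 < k := by
    simp only [Finset.mem_insert, Finset.mem_singleton] at hk2; omega
  obtain ⟨b, hb⟩ : ∃ b, b ∉ C := by
    by_contra hcon
    push Not at hcon
    have : C = ⊤ := by ext; simp [hcon]
    rw [this] at hi; simp at hi
  have hab : a * b ≠ b * a := by
    intro e
    apply hb
    have := h.ct a g b a1 a2 (h.centralizer_comm g g1 g2 a haC g hgC) e
    rw [hC, Subgroup.mem_centralizer_singleton_iff]; exact this.symm
  have hbab : b * a * b⁻¹ = a⁻¹ := by
    rcases h.cj a b a1 a2 (h.centralizer_comm g g1 g2 a haC _ (hCn.conj_mem a haC b)) with e | e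
    · exfalso; rw [mul_inv_eq_iff_eq_mul] at e; exact hab e.symm
    · exact e
  have hba : b * a = a⁻¹ * b := by rwa [mul_inv_eq_iff_eq_mul] at hbab
  have hbb : b * b = z := by
    by_contra hne
    by_cases h1 : b * b = 1
    · rcases h.inv b h1 with e | e
      · exact hb (e ▸ C.one_mem)
      · exact hb (e ▸ hzC)
    · apply hab
      refine h.ct (b * b) a b h1 hne ?_ (by group)
      calc b * b * a = b * (b * a * b⁻¹) * b := by group
        _ = b * a⁻¹ * b⁻¹ * (b * b) := by rw [hbab]; simp [mul_assoc]
        _ = (b * a * b⁻¹)⁻¹ * (b * b) := by simp [mul_assoc]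
        _ = a * (b * b) := by rw [hbab, inv_inv]
  have hak : a ^ k = z := by
    have h1 : a ^ k * a ^ k = 1 := by
      rw [← pow_add, ← two_mul, ← hk, pow_orderOf_eq_one]
    rcases h.inv _ h1 with e | e
    · have := orderOf_dvd_of_pow_eq_one e
      have := Nat.le_of_dvd hkpos this
      omega
    · exact e
  refine ⟨k, hk2, ?_⟩
  have : NeZero k := ⟨by omega⟩
  let F : ZMod (2 * k) →+ Additive G := ZMod.lift (2 * k)
    ⟨zmultiplesHom (Additive G) (Additive.ofMul a), by
      simp only [zmultiplesHom_apply]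
      rw [← ofMul_zpow, ← hk, zpow_natCast, pow_orderOf_eq_one]; rfl⟩
  let e : ZMod (2 * k) → G := fun i => (F i).toMul
  have e_add : ∀ i j, e (i + j) = e i * e j := fun i j => by simp [e]
  have e_int : ∀ i : ℤ, e i = a ^ i := fun i => by
    simp only [e, F, ZMod.lift_coe, zmultiplesHom_apply]; rfl
  have e_neg : ∀ i, e (-i) = (e i)⁻¹ := fun i => by simp [e]
  have e_sub : ∀ i j, e (i - j) = e i * (e j)⁻¹ := fun i j => by rw [sub_eq_add_neg, e_add, e_neg]
  have e_k : e k = z := by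
    have := e_int k
    rw [← hak, ← zpow_natCast]; simpa using this
  have e_comm : ∀ i j, e i * e j = e j * e i := fun i j => by rw [← e_add, add_comm, e_add]
  have e_b : ∀ i, e i * b = b * (e i)⁻¹ := by
    intro i
    obtain ⟨n, rfl⟩ := ZMod.intCast_surjective i
    rw [e_int]
    have : b * (a ^ n)⁻¹ * b⁻¹ = a ^ n := by
      rw [← inv_zpow, ← conj_zpow, ]
      congr 1
      calc b * a⁻¹ * b⁻¹ = (b * a * b⁻¹)⁻¹ := by group
        _ = a := by rw [hbab, inv_inv]
    rw [mul_inv_eq_iff_eq_mul] at this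
    exact this.symm
  have e_mem : ∀ i, e i ∈ C := by
    intro i
    obtain ⟨n, rfl⟩ := ZMod.intCast_surjective i
    rw [e_int]; exact C.zpow_mem haC n
  have e_inj : Function.Injective e := by
    intro i j hij
    have h1 : e (i - j) = 1 := by rw [e_sub, hij, mul_inv_cancel]
    obtain ⟨n, hn⟩ := ZMod.intCast_surjective (i - j)
    rw [← hn, e_int, ← orderOf_dvd_iff_zpow_eq_one, hk] at h1
    rw [← sub_eq_zero, ← hn]
    exact (ZMod.intCast_zmod_eq_zero_iff_dvd n (2 * k)).mpr h1
  have e_zero : e 0 = 1 := by simp [e]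
  let φ : QuaternionGroup k →* G :=
    { toFun := fun x => match x with
        | .a i => e i
        | .xa i => b * e i
      map_one' := by rw [QuaternionGroup.one_def]; exact e_zero
      map_mul' := by
        rintro (i | i) (j | j)
        · rw [QuaternionGroup.a_mul_a]; exact e_add i j
        · rw [QuaternionGroup.a_mul_xa]
          simp only
          rw [e_sub, ← mul_assoc (e i) b, e_b, mul_assoc b, ← e_neg, e_comm]
        · rw [QuaternionGroup.xa_mul_a]; simp only
          rw [e_add, mul_assoc]
        · rw [QuaternionGroup.xa_mul_xa]; simp only
          rw [e_sub, e_add, e_k, mul_assoc b, ← mul_assoc (e i), e_b, ← hbb, ← e_neg]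
          simp only [mul_assoc]
          rw [e_comm] }
  have φ_inj : Function.Injective φ := by
    have key : ∀ i j, e i ≠ b * e j := by
      intro i j hij
      apply hb
      have : b = e i * (e j)⁻¹ := by rw [hij]; group
      rw [this]; exact C.mul_mem (e_mem i) (C.inv_mem (e_mem j))
    rintro (i | i) (j | j) hij
    · exact congrArg _ (e_inj hij)
    · exact absurd hij (key i j)
    · exact absurd hij.symm (key j i)
    · exact congrArg _ (e_inj (mul_left_cancel hij))
  have hb : Function.Bijective φ := by
    rw [Nat.bijective_iff_injective_and_card]
    refine ⟨φ_inj, ?_⟩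
    rw [Nat.card_eq_fintype_card, QuaternionGroup.card, ← hcard, ← ha, hk]; ring
  exact ⟨(MulEquiv.ofBijective φ hb).symm⟩

theorem card_dvd (h : BP G z) [Finite G] (P : Sylow 2 G) : Nat.card G ∣ Nat.card P * 15 := by
  rw [Nat.dvd_iff_prime_pow_dvd_dvd]
  intro p k hp hpk
  have : Fact p.Prime := ⟨hp⟩
  by_cases h2 : p = 2
  · subst h2
    exact (P.pow_dvd_card_of_pow_dvd_card hpk).mul_right 15
  · obtain ⟨H, hH⟩ := Sylow.exists_subgroup_card_pow_prime p hpk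
    rcases h.card_odd_sylow H p h2 (IsPGroup.of_card hH) with e | ⟨e, e3 | e5⟩
    · rw [← hH, e]; exact one_dvd _
    · rw [← hH, e, e3]; exact Dvd.dvd.mul_left (by norm_num) _
    · rw [← hH, e, e5]; exact Dvd.dvd.mul_left (by norm_num) _

theorem z_mem_sylow (h : BP G z) [Finite G] (P : Sylow 2 G) : z ∈ P := by
  have hz : z ∈ Subgroup.center G := Subgroup.mem_center_iff.mpr fun x => h.z_comm x
  have hn : (Subgroup.zpowers z).Normal := by
    constructor
    intro n hn g
    obtain ⟨j, rfl⟩ := Subgroup.mem_zpowers_iff.mp hn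
    have := Subgroup.mem_center_iff.mp ((Subgroup.center G).zpow_mem hz j) g
    rw [this]; simpa using hn
  have hp : IsPGroup 2 (Subgroup.zpowers z) := IsPGroup.of_card (n := 1) (by
    rw [Nat.card_zpowers, h.orderOf_z, pow_one])
  exact hp.le_sylow_of_normal P (Subgroup.mem_zpowers z)

theorem index_mem (h : BP G z) [Finite G] (P : Sylow 2 G) :
    P.index = 1 ∨ P.index = 3 ∨ P.index = 5 ∨ P.index = 15 := by
  have h1 := h.card_dvd P
  rw [← P.card_mul_index] at h1
  have h2 : P.index ∣ 15 := Nat.dvd_of_mul_dvd_mul_left Nat.card_pos h1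
  have : P.index ∈ Nat.divisors 15 := by simp [h2]
  have e : Nat.divisors 15 = {1, 3, 5, 15} := by decide
  rw [e] at this
  simpa using this

theorem normal_sylow_of_card [Finite G] (p : ℕ) [Fact p.Prime] (P : Sylow p G)
    (hc : Nat.card (Sylow p G) = 1) : (P : Subgroup G).Normal := by
  have := (Nat.card_eq_one_iff_unique.mp hc).1
  exact P.normal_of_subsingleton

theorem caseI_of_cyclic (h : BP G z) [Finite G] (hn : ∃ x y : G, x * y ≠ y * x)
    (P : Sylow 2 G) (hP : IsCyclic P) : CaseI G z := by
  have hz : 2 ∣ Nat.card G := by rw [← h.orderOf_z]; exact orderOf_dvd_natCard z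
  have hle := hP.normalizer_le_centralizer ((Nat.minFac_eq_two_iff _).mpr hz)
  have hcomp := MonoidHom.ker_transferSylow_isComplement' P hle
  set K := (MonoidHom.transferSylow P hle).ker
  have hK : Nat.card K = P.index := hcomp.index_eq_card.symm
  have hKp : ∀ p : ℕ, p.Prime → p ≠ 2 → Nat.card K = p → CaseI G z := by
    intro p hp h2 hc
    have : Fact p.Prime := ⟨hp⟩
    refine h.caseI_of_normal_pgroup K p h2 (IsPGroup.of_card (n := 1) (by rw [hc, pow_one])) ?_
    intro hb
    rw [hb] at hc
    simp at hc
    exact hp.one_lt.ne hc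
  rcases h.index_mem P with e | e | e | e
  · exfalso
    have : (P : Subgroup G) = ⊤ := Subgroup.index_eq_one.mp e
    obtain ⟨x, y, hxy⟩ := hn
    have hx : x ∈ (P : Subgroup G) := by rw [this]; trivial
    have hy : y ∈ (P : Subgroup G) := by rw [this]; trivial
    letI := hP.commGroup
    exact hxy (congrArg Subtype.val (mul_comm (⟨x, hx⟩ : P) ⟨y, hy⟩))
  · exact hKp 3 (by norm_num) (by norm_num) (by rw [hK, e])
  · exact hKp 5 (by norm_num) (by norm_num) (by rw [hK, e])
  · have : Fact (Nat.Prime 5) := ⟨by norm_num⟩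
    rw [e] at hK
    let Q : Sylow 5 K := default
    have hQc : 5 ^ 1 ∣ Nat.card Q := Q.pow_dvd_card_of_pow_dvd_card (by rw [hK]; norm_num)
    have hnQ : Nat.card (Sylow 5 K) = 1 := by
      have h1 := card_sylow_modEq_one 5 K
      have h2 := Q.card_dvd_index
      have h3 := Q.card_mul_index
      rw [hK] at h3
      obtain ⟨c, hc⟩ := hQc
      rw [hc] at h3
      have h4 : Q.index ∣ 3 := ⟨c, by nlinarith⟩
      have h5 := Nat.le_of_dvd (by norm_num) (h2.trans h4)
      have h1' : Nat.card (Sylow 5 K) % 5 = 1 % 5 := h1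
      omega
    have hQn := normal_sylow_of_card 5 Q hnQ
    have hQch := Q.characteristic_of_normal hQn
    have hne : ((Q : Subgroup K).map K.subtype) ≠ ⊥ := by
      intro hb
      rw [Subgroup.map_eq_bot_iff_of_injective _ K.subtype_injective] at hb
      rw [hb] at hQc
      simp at hQc
    refine h.caseI_of_normal_pgroup ((Q : Subgroup K).map K.subtype) 5 (by norm_num) ?_ hne
    exact Q.isPGroup'.map _

/-- the case of order 48 -/
theorem case48 (h : BP G z) [Finite G] (hI : ¬ CaseI G z) (hc : Nat.card G = 48) :
    Nonempty ((G ⧸ Subgroup.normalClosure ({z} : Set G)) ≃* Equiv.Perm (Fin 4)) := by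
  have : Fact (Nat.Prime 3) := ⟨by norm_num⟩
  have hcP : ∀ P : Sylow 3 G, Nat.card P = 3 := by
    intro P
    have h1 := P.dvd_card_of_dvd_card (by rw [hc]; norm_num)
    rcases h.card_odd_sylow P 3 (by norm_num) P.isPGroup' with e | ⟨e, -⟩
    · have e' : Nat.card P = 1 := e
      rw [e'] at h1; norm_num at h1
    · exact e
  have hzN : ∀ P : Sylow 3 G, z ∈ Subgroup.normalizer (P : Set G) := by
    intro P
    apply Subgroup.center_le_normalizer
    exact Subgroup.mem_center_iff.mpr fun x => h.z_comm x
  have hn3 : Nat.card (Sylow 3 G) = 4 := by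
    let P : Sylow 3 G := default
    have h1 := card_sylow_modEq_one 3 G
    have h2 := P.card_eq_index_normalizer
    have h3 := (Subgroup.normalizer (P : Set G)).card_mul_index
    have h4 : 2 ∣ Nat.card (Subgroup.normalizer (P : Set G)) := by
      rw [← h.orderOf_z]; exact Subgroup.orderOf_dvd_natCard _ (hzN P)
    have h5 : 3 ∣ Nat.card (Subgroup.normalizer (P : Set G)) := by
      have := Subgroup.card_dvd_of_le (Subgroup.le_normalizer (H := (P : Subgroup G)))
      have h' : Nat.card (P : Subgroup G) = 3 := hcP P
      rwa [h'] at this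
    have h6 : 6 ∣ Nat.card (Subgroup.normalizer (P : Set G)) :=
      Nat.Coprime.mul_dvd_of_dvd_of_dvd (by norm_num) h4 h5
    rw [← h2, hc] at h3
    have h7 : Nat.card (Sylow 3 G) ∣ 8 := by
      obtain ⟨c, hc'⟩ := h6
      rw [hc'] at h3
      exact ⟨c, by nlinarith⟩
    have h8 := Nat.le_of_dvd (by norm_num) h7
    have h1' : Nat.card (Sylow 3 G) % 3 = 1 % 3 := h1
    have hne : Nat.card (Sylow 3 G) ≠ 1 := by
      intro e
      have := normal_sylow_of_card 3 P e
      apply hI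
      refine h.caseI_of_normal_pgroup P 3 (by norm_num) P.isPGroup' ?_
      intro hb
      have := hcP P
      have e : Nat.card (P : Subgroup G) = 3 := this
      rw [hb] at e
      simp at e
    clear h2 h3
    generalize Nat.card (Sylow 3 G) = n at *
    interval_cases n <;> omega
  let φ : G →* Equiv.Perm (Sylow 3 G) := MulAction.toPermHom G (Sylow 3 G)
  have hker : ∀ x : G, x ∈ φ.ker ↔ ∀ P : Sylow 3 G, x ∈ Subgroup.normalizer (P : Set G) := by
    intro x
    rw [MonoidHom.mem_ker]
    constructor
    · intro hx P
      rw [← Sylow.smul_eq_iff_mem_normalizer]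
      exact congrArg (fun f : Equiv.Perm (Sylow 3 G) => f P) hx
    · intro hx
      ext1 P
      exact Sylow.smul_eq_iff_mem_normalizer.mpr (hx P)
  have hzk : z ∈ φ.ker := (hker z).mpr hzN
  have hk3 : ¬ 3 ∣ Nat.card φ.ker := by
    intro h3
    obtain ⟨⟨x, hx⟩, hxo⟩ := exists_prime_orderOf_dvd_card' 3 h3
    rw [← Subgroup.orderOf_coe] at hxo
    simp only at hxo
    have hpx : IsPGroup 3 (Subgroup.zpowers x) := IsPGroup.of_card (n := 1) (by
      rw [Nat.card_zpowers, hxo, pow_one])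
    have key : ∀ P : Sylow 3 G, Subgroup.zpowers x = P := by
      intro P
      have h1 := hpx.inf_normalizer_sylow P
      have h2 : Subgroup.zpowers x ≤ Subgroup.normalizer (P : Set G) := by
        rw [Subgroup.zpowers_le]; exact (hker x).mp hx P
      have h3 : Subgroup.zpowers x ≤ P := by
        have h4 : Subgroup.zpowers x ⊓ Subgroup.normalizer (P : Set G) = Subgroup.zpowers x :=
          inf_eq_left.mpr h2
        have h5 := h4.symm.trans h1
        exact inf_eq_left.mp h5.symm
      apply Subgroup.eq_of_le_of_card_ge h3
      rw [Nat.card_zpowers, hxo]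
      exact (hcP P).le
    have : Subsingleton (Sylow 3 G) := ⟨fun P Q => Sylow.ext ((key P).symm.trans (key Q))⟩
    have := Finite.card_le_one_iff_subsingleton.mpr this
    omega
  have hk12 : Nat.card φ.ker ∣ 12 := by
    let P : Sylow 3 G := default
    have h1 : φ.ker ≤ Subgroup.normalizer (P : Set G) := fun x hx => (hker x).mp hx P
    have h2 := P.card_eq_index_normalizer
    have h3 := (Subgroup.normalizer (P : Set G)).card_mul_index
    have h4 := Subgroup.card_dvd_of_le h1
    have : Nat.card (Subgroup.normalizer (P : Set G)) = 12 := by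
      rw [← h2, hn3, hc] at h3; omega
    rwa [this] at h4
  have hk4 : Nat.card φ.ker ∣ 4 :=
    Nat.Coprime.dvd_of_dvd_mul_left (m := 3) (n := 4)
      ((Nat.Prime.coprime_iff_not_dvd (by norm_num)).mpr hk3).symm (by simpa using hk12)
  have hk2 : 2 ∣ Nat.card φ.ker := by
    rw [← h.orderOf_z]; exact Subgroup.orderOf_dvd_natCard _ hzk
  have hkne : Nat.card φ.ker ≠ 4 := by
    intro h4
    have : Fact (Nat.Prime 2) := ⟨by norm_num⟩
    have hcomm : ∀ x ∈ φ.ker, ∀ y ∈ φ.ker, x * y = y * x := by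
      intro x hx y hy
      letI := IsPGroup.commGroupOfCardEqPrimeSq (p := 2) (G := φ.ker) (by rw [h4]; norm_num)
      exact congrArg Subtype.val (mul_comm (⟨x, hx⟩ : φ.ker) ⟨y, hy⟩)
    obtain ⟨a, haK, ha, -⟩ := h.card_mem _ hcomm
    rw [h4] at ha
    apply hI
    refine h.caseI_of_normal φ.ker hcomm a haK ?_ ?_
    · rintro rfl; simp at ha
    · rintro rfl; rw [h.orderOf_z] at ha; norm_num at ha
  have hkc : Nat.card φ.ker = 2 := by
    have h8 := Nat.le_of_dvd (by norm_num) hk4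
    interval_cases Nat.card φ.ker <;> simp_all
  have hzp : Subgroup.zpowers z = φ.ker := by
    apply Subgroup.eq_of_le_of_card_ge (by simpa using hzk)
    rw [Nat.card_zpowers, h.orderOf_z, hkc]
  have hnc : Subgroup.normalClosure ({z} : Set G) = φ.ker := by
    apply le_antisymm
    · apply Subgroup.normalClosure_le_normal; simpa using hzk
    · rw [← hzp, Subgroup.zpowers_le]
      exact Subgroup.subset_normalClosure rfl
  have hsurj : Function.Surjective φ := by
    rw [← MonoidHom.range_eq_top]
    apply Subgroup.eq_top_of_card_eq
    have h1 := φ.ker.card_mul_index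
    rw [Subgroup.index_ker, hkc, hc] at h1
    rw [Nat.card_perm, hn3]
    have : Nat.factorial 4 = 24 := rfl
    omega
  have e1 := QuotientGroup.quotientKerEquivOfSurjective φ hsurj
  have e2 : Sylow 3 G ≃ Fin 4 := Finite.equivFinOfCardEq hn3
  exact ⟨((QuotientGroup.quotientMulEquivOfEq hnc).trans e1).trans e2.permCongrHom⟩

theorem classify (h : BP G z) [Finite G] (hn : ∃ x y : G, x * y ≠ y * x)
    (h58 : ∀ x y : G, orderOf x = 5 → orderOf y ≠ 8)
    (h512 : ∀ x y : G, orderOf x = 5 → orderOf y ≠ 12) (hI : ¬ CaseI G z) :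
    ((Nat.card G = 24 ∧ ¬ 5 ∣ Nat.card G ∨ Nat.card G = 120) ∧
      (∀ x : G, orderOf x ≠ 8) ∧ (∀ x : G, orderOf x ≠ 12)) ∨
    (Nat.card G = 48 ∧
      Nonempty ((G ⧸ Subgroup.normalClosure ({z} : Set G)) ≃* Equiv.Perm (Fin 4))) := by
  have f2 : Fact (Nat.Prime 2) := ⟨by norm_num⟩
  have f5 : Fact (Nat.Prime 5) := ⟨by norm_num⟩
  let P : Sylow 2 G := default
  have hnc : ∀ Q : Sylow 2 G, ¬ IsCyclic Q := fun Q hQ => hI (h.caseI_of_cyclic hn Q hQ)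
  have hBP := h.sub P (h.z_mem_sylow P)
  have hPc := hBP.card_two_group' P.isPGroup'
  have hP8 : ∀ Q : Sylow 2 G, Nat.card Q ≠ 2 ∧ Nat.card Q ≠ 4 := by
    intro Q
    constructor
    · intro e
      exact hnc Q (isCyclic_of_prime_card (p := 2) e)
    · intro e
      apply hnc Q
      apply h.cyc
      intro x hx y hy
      letI := IsPGroup.commGroupOfCardEqPrimeSq (p := 2) (G := Q) (by rw [e]; norm_num)
      exact congrArg Subtype.val (mul_comm (⟨x, hx⟩ : Q) ⟨y, hy⟩)
  have hPc' : Nat.card P = 8 ∨ Nat.card P = 16 := by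
    have := hP8 P
    have e : Nat.card (P : Subgroup G) = Nat.card P := rfl
    rw [e] at hPc
    simp only [Finset.mem_insert, Finset.mem_singleton] at hPc
    omega
  have hmul := P.card_mul_index
  have h5 : 5 ∣ Nat.card G → (∀ x : G, orderOf x ≠ 8) ∧ (∀ x : G, orderOf x ≠ 12) ∧
      Nat.card P = 8 := by
    intro hd
    obtain ⟨u, hu⟩ := exists_prime_orderOf_dvd_card' 5 hd
    have h8 : ∀ x : G, orderOf x ≠ 8 := fun x => h58 u x hu
    refine ⟨h8, fun x => h512 u x hu, ?_⟩
    have := hBP.card_two_group P.isPGroup' ⟨hPc, fun x => by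
      rw [← Subgroup.orderOf_coe]; exact h8 x⟩
    simp only [Finset.mem_insert, Finset.mem_singleton] at this
    have e : Nat.card (P : Subgroup G) = Nat.card P := rfl
    rw [e] at this
    omega
  rcases h.index_mem P with e | e | e | e
  · exfalso
    apply hI
    refine h.caseI_of_two_group ?_ hn
    have : (P : Subgroup G) = ⊤ := Subgroup.index_eq_one.mp e
    rw [e, mul_one] at hmul
    rcases hPc' with e8 | e8
    · exact IsPGroup.of_card (n := 3) (by rw [← hmul, e8]; norm_num)
    · exact IsPGroup.of_card (n := 4) (by rw [← hmul, e8]; norm_num)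
  · rw [e] at hmul
    rcases hPc' with e8 | e8
    · left
      have hc : Nat.card G = 24 := by rw [← hmul, e8]
      refine ⟨Or.inl ⟨hc, by rw [hc]; norm_num⟩, ?_, ?_⟩
      · intro x hx
        have hpx : IsPGroup 2 (Subgroup.zpowers x) := IsPGroup.of_card (n := 3) (by
          rw [Nat.card_zpowers, hx]; norm_num)
        obtain ⟨Q, hQ⟩ := hpx.exists_le_sylow
        have hQc : Nat.card Q = 8 := by rw [← e8]; exact Nat.card_congr (Q.equiv P).toEquiv
        have : Subgroup.zpowers x = Q := by
          apply Subgroup.eq_of_le_of_card_ge hQ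
          rw [Nat.card_zpowers, hx]; exact hQc.le
        apply hnc Q
        have h1 : IsCyclic (Subgroup.zpowers x) := inferInstance
        rw [this] at h1
        exact h1
      · intro x hx
        have hi := (Subgroup.zpowers x).card_mul_index
        rw [Nat.card_zpowers, hx, hc] at hi
        have hi2 : (Subgroup.zpowers x).index = 2 := by omega
        have := Subgroup.normal_of_index_eq_two hi2
        apply hI
        refine h.caseI_of_normal (Subgroup.zpowers x) ?_ x (Subgroup.mem_zpowers x) ?_ ?_
        · intro a ha b hb
          obtain ⟨i, rfl⟩ := Subgroup.mem_zpowers_iff.mp ha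
          obtain ⟨j, rfl⟩ := Subgroup.mem_zpowers_iff.mp hb
          rw [← zpow_add, add_comm, zpow_add]
        · rintro rfl; simp at hx
        · rintro rfl; rw [h.orderOf_z] at hx; norm_num at hx
    · right
      have hc : Nat.card G = 48 := by rw [← hmul, e8]
      exact ⟨hc, h.case48 hI hc⟩
  · exfalso
    rw [e] at hmul
    have hd : 5 ∣ Nat.card G := ⟨Nat.card P, by rw [← hmul, mul_comm]⟩
    obtain ⟨-, -, e8⟩ := h5 hd
    rw [e8] at hmul
    let Q : Sylow 5 G := default
    have hQc : Nat.card Q = 5 := by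
      have h1 := Q.dvd_card_of_dvd_card hd
      rcases h.card_odd_sylow Q 5 (by norm_num) Q.isPGroup' with e | ⟨e, -⟩
      · have e' : Nat.card Q = 1 := e
        rw [e'] at h1; norm_num at h1
      · exact e
    have h1 := card_sylow_modEq_one 5 G
    have h2 := Q.card_dvd_index
    have h3 := Q.card_mul_index
    rw [hQc, ← hmul] at h3
    have h3' : Q.index = 8 := by omega
    rw [h3'] at h2
    have h8 := Nat.le_of_dvd (by norm_num) h2
    have h1' : Nat.card (Sylow 5 G) % 5 = 1 % 5 := h1
    have hone : Nat.card (Sylow 5 G) = 1 := by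
      interval_cases Nat.card (Sylow 5 G) <;> simp_all
    have := normal_sylow_of_card 5 Q hone
    apply hI
    refine h.caseI_of_normal_pgroup Q 5 (by norm_num) Q.isPGroup' ?_
    intro hb
    have e : Nat.card (Q : Subgroup G) = 5 := hQc
    rw [hb] at e
    simp at e
  · left
    rw [e] at hmul
    have hd : 5 ∣ Nat.card G := ⟨3 * Nat.card P, by rw [← hmul]; ring⟩
    obtain ⟨a1, a2, e8⟩ := h5 hd
    exact ⟨Or.inr (by rw [← hmul, e8]), a1, a2⟩

/-- existence of a quaternion subgroup -/
theorem exists_Q8 (h : BP G z) [Finite G] (h8 : ∀ x : G, orderOf x ≠ 8) (hd : 8 ∣ Nat.card G) :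
    ∃ x y : G, x * x = z ∧ y * y = z ∧ (x * y) * (x * y) = z := by
  have f2 : Fact (Nat.Prime 2) := ⟨by norm_num⟩
  obtain ⟨H, hH⟩ := Sylow.exists_subgroup_card_pow_prime (G := G) 2 (n := 3) (by simpa using hd)
  have hp : IsPGroup 2 H := IsPGroup.of_card hH
  have hnc : ¬ ∀ x ∈ H, ∀ y ∈ H, x * y = y * x := by
    intro hc
    obtain ⟨a, -, ha, -⟩ := h.card_mem H hc
    exact h8 a (by rw [ha, hH]; norm_num)
  push Not at hnc
  obtain ⟨x, hx, y, hy, hxy⟩ := hnc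
  have key : ∀ w ∈ H, w ≠ 1 → w ≠ z → w * w = z := by
    intro w hw w1 w2
    have hd : orderOf w ∣ 2 ^ 3 := by rw [← hH]; exact Subgroup.orderOf_dvd_natCard H hw
    obtain ⟨j, hj, hj'⟩ := (Nat.dvd_prime_pow Nat.prime_two).mp hd
    have h4 : w ^ 4 = 1 := by
      have : orderOf w ∣ 4 := by
        interval_cases j
        · rw [hj']; norm_num
        · rw [hj']; norm_num
        · rw [hj']; norm_num
        · exact absurd hj' (h8 w)
      exact orderOf_dvd_iff_pow_eq_one.mp this
    rcases h.inv (w * w) (by rw [← h4]; simp [pow_succ, mul_assoc]) with e | e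
    · rcases h.inv w e with e | e
      · exact absurd e w1
      · exact absurd e w2
    · exact e
  have cz := h.z_comm
  refine ⟨x, y, key x hx ?_ ?_, key y hy ?_ ?_, key _ (H.mul_mem hx hy) ?_ ?_⟩
  · rintro rfl; simp at hxy
  · rintro rfl; exact hxy (cz y).symm
  · rintro rfl; simp at hxy
  · rintro rfl; exact hxy (cz x)
  · intro e
    apply hxy
    rw [e, ← mul_eq_one_iff_eq_inv.mpr (eq_inv_of_mul_eq_one_right e)]
  · intro e
    apply hxy
    have : y = x⁻¹ * z := by rw [← e]; group
    rw [this, mul_assoc, ← cz x]; group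

end BP

open scoped Quaternion

namespace QA
variable {K : Type*} [Field K] {a c : K}

/-- reduced trace -/
def tr (x : ℍ[K,a,0,c]) : K := 2 * x.re
/-- reduced norm -/
def nr (x : ℍ[K,a,0,c]) : K := x.re ^ 2 - a * x.imI ^ 2 - c * x.imJ ^ 2 + a * c * x.imK ^ 2
/-- scalar elements -/
def Cn (x : ℍ[K,a,0,c]) : Prop := x.imI = 0 ∧ x.imJ = 0 ∧ x.imK = 0
/-- conjugation -/
def cnj (x : ℍ[K,a,0,c]) : ℍ[K,a,0,c] := ⟨x.re, -x.imI, -x.imJ, -x.imK⟩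

theorem nr_mul (x y : ℍ[K,a,0,c]) : nr (x * y) = nr x * nr y := by
  simp [nr]; ring
theorem nr_one : nr (1 : ℍ[K,a,0,c]) = 1 := by simp [nr]
theorem tr_one : tr (1 : ℍ[K,a,0,c]) = 2 := by simp [tr]
theorem nr_pow (x : ℍ[K,a,0,c]) (n : ℕ) : nr (x ^ n) = nr x ^ n := by
  induction n with
  | zero => simp [nr_one]
  | succ n ih => rw [pow_succ, nr_mul, ih, pow_succ]
theorem nr_smul (r : K) (x : ℍ[K,a,0,c]) : nr (r • x) = r ^ 2 * nr x := by
  simp [nr]; ring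
theorem tr_smul (r : K) (x : ℍ[K,a,0,c]) : tr (r • x) = r * tr x := by
  simp [tr]; ring
theorem tr_add (x y : ℍ[K,a,0,c]) : tr (x + y) = tr x + tr y := by
  simp [tr]; ring
theorem tr_sub (x y : ℍ[K,a,0,c]) : tr (x - y) = tr x - tr y := by
  simp [tr]; ring
theorem tr_neg (x : ℍ[K,a,0,c]) : tr (-x) = - tr x := by
  simp [tr]
theorem nr_neg (x : ℍ[K,a,0,c]) : nr (-x) = nr x := by
  simp [nr]
theorem tr_comm (x y : ℍ[K,a,0,c]) : tr (x * y) = tr (y * x) := by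
  simp only [tr, QuaternionAlgebra.re_mul]; ring
theorem mul_cnj (x : ℍ[K,a,0,c]) : x * cnj x = nr x • 1 := by
  ext <;> simp [nr, cnj] <;> ring
theorem cnj_mul (x : ℍ[K,a,0,c]) : cnj x * x = nr x • 1 := by
  ext <;> simp [nr, cnj] <;> ring
theorem add_cnj (x : ℍ[K,a,0,c]) : x + cnj x = tr x • 1 := by
  ext <;> simp [tr, cnj] ; ring
theorem quad (x : ℍ[K,a,0,c]) : x * x = tr x • x - nr x • 1 := by
  ext <;> simp [nr, tr] <;> ring
theorem tr_mul_add (x y : ℍ[K,a,0,c]) : tr (x * y) + tr (x * cnj y) = tr x * tr y := by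
  simp [tr, cnj]; ring
theorem nr_one_sub_smul (r : K) (x : ℍ[K,a,0,c]) : nr (1 - r • x) = 1 - r * tr x + r ^ 2 * nr x := by
  simp [nr, tr]; ring
theorem Cn_smul_one (r : K) : Cn (r • (1 : ℍ[K,a,0,c])) := by simp [Cn]
theorem Cn.eq {x : ℍ[K,a,0,c]} (h : Cn x) : x = x.re • 1 := by
  obtain ⟨h1, h2, h3⟩ := h
  ext <;> simp [h1, h2, h3]
theorem Cn.comm {x : ℍ[K,a,0,c]} (h : Cn x) (y : ℍ[K,a,0,c]) : x * y = y * x := by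
  rw [h.eq]; simp
theorem indep {x : ℍ[K,a,0,c]} (h : ¬ Cn x) {p q : K} (e : p • x = q • 1) : p = 0 ∧ q = 0 := by
  have hp : p = 0 := by
    by_contra hp
    apply h
    have e1 := congrArg QuaternionAlgebra.imI e
    have e2 := congrArg QuaternionAlgebra.imJ e
    have e3 := congrArg QuaternionAlgebra.imK e
    simp [hp] at e1 e2 e3
    exact ⟨e1, e2, e3⟩
  subst hp
  refine ⟨rfl, ?_⟩
  have e1 := congrArg QuaternionAlgebra.re e
  simpa using e1.symm

variable [CharZero K]

theorem anti (x y : ℍ[K,a,0,c]) (hx : tr x = 0) (hy : tr y = 0) (hxy : tr (x * y) = 0) :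
    x * y = - (y * x) := by
  simp only [tr, mul_eq_zero, OfNat.ofNat_ne_zero, false_or] at hx hy hxy
  simp at hxy
  rw [hx, hy] at hxy
  ext
  · simp [hx, hy]; linear_combination 2 * hxy
  · simp [hx, hy]; ring
  · simp [hx, hy]; ring
  · simp [hx, hy]; ring

/-- elements commuting with a noncentral `x` -/
theorem comm_form (ha : a ≠ 0) (hc : c ≠ 0) {x y : ℍ[K,a,0,c]} (hx : ¬ Cn x) (h : x * y = y * x) :
    ∃ p q : K, y = p • x + q • 1 := by
  have e1 := congrArg QuaternionAlgebra.imI h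
  have e2 := congrArg QuaternionAlgebra.imJ h
  have e3 := congrArg QuaternionAlgebra.imK h
  simp at e1 e2 e3
  have f1 : x.imJ * y.imK = x.imK * y.imJ := by
    have : (2 * c) * (x.imJ * y.imK) = (2 * c) * (x.imK * y.imJ) := by linear_combination - e1
    exact mul_left_cancel₀ (by simp [hc]) this
  have f2 : x.imI * y.imK = x.imK * y.imI := by
    have : (2 * a) * (x.imI * y.imK) = (2 * a) * (x.imK * y.imI) := by linear_combination e2
    exact mul_left_cancel₀ (by simp [ha]) this
  have f3 : x.imI * y.imJ = x.imJ * y.imI := by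
    have : (2 : K) * (x.imI * y.imJ) = 2 * (x.imJ * y.imI) := by linear_combination e3
    exact mul_left_cancel₀ (by simp) this
  by_cases h1 : x.imI = 0
  · by_cases h2 : x.imJ = 0
    · by_cases h3 : x.imK = 0
      · exact absurd ⟨h1, h2, h3⟩ hx
      · refine ⟨y.imK / x.imK, y.re - y.imK / x.imK * x.re, ?_⟩
        ext <;> simp <;> field_simp
        · linear_combination -f2
        · linear_combination -f1
    · refine ⟨y.imJ / x.imJ, y.re - y.imJ / x.imJ * x.re, ?_⟩
      ext <;> simp <;> field_simp
      · linear_combination -f3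
      · linear_combination f1
  · refine ⟨y.imI / x.imI, y.re - y.imI / x.imI * x.re, ?_⟩
    ext <;> simp <;> field_simp
    · linear_combination f3
    · linear_combination f2

theorem comm_trans (ha : a ≠ 0) (hc : c ≠ 0) {x y w : ℍ[K,a,0,c]} (hx : ¬ Cn x) (h : x * y = y * x)
    (h' : x * w = w * x) : y * w = w * y := by
  obtain ⟨p, q, rfl⟩ := comm_form ha hc hx h
  simp [add_mul, mul_add, h']

end QA

open scoped Quaternion

namespace QA
set_option linter.unusedSectionVars false
variable {K : Type*} [Field K] [CharZero K] {a c : K}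

/-- standing hypotheses -/
structure HQ (K : Type*) [Field K] (a c : K) : Prop where
  ha : a ≠ 0
  hc : c ≠ 0
  div : ∀ x : ℍ[K,a,0,c], nr x = 0 → x = 0
  sq : ∀ d e : ℤ, (∃ u : K, u ^ 2 = d) → (∃ v : K, v ^ 2 = e) →
    IsSquare d ∨ IsSquare e ∨ IsSquare (d * e)
  ordQ : ∀ (x : ℍ[K,a,0,c]) (n : ℕ), 0 < n → x ^ n = 1 →
    orderOf x ∈ ({1, 2, 3, 4, 5, 6, 8, 10, 12} : Finset ℕ)
  ordK : ∀ (x : K) (n : ℕ), 0 < n → x ^ n = 1 → orderOf x ∈ ({1, 2, 3, 4, 6} : Finset ℕ)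

theorem HQ.nzd (h : HQ K a c) {x y : ℍ[K,a,0,c]} (e : x * y = 0) : x = 0 ∨ y = 0 := by
  have : nr x * nr y = 0 := by rw [← nr_mul, e]; simp [nr]
  rcases mul_eq_zero.mp this with e | e
  · exact Or.inl (h.div _ e)
  · exact Or.inr (h.div _ e)

theorem HQ.sq_eq (h : HQ K a c) {x : ℍ[K,a,0,c]} {r : K} (e : x * x = (r ^ 2) • 1) : Cn x := by
  have : (x - r • 1) * (x + r • 1) = 0 := by
    simp only [sub_mul, mul_add, e, smul_mul_assoc, mul_smul_comm, one_mul, mul_one]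
    module
  rcases h.nzd this with e | e
  · rw [sub_eq_zero] at e; rw [e]; exact Cn_smul_one _
  · rw [add_eq_zero_iff_eq_neg, ← neg_smul] at e; rw [e]; exact Cn_smul_one _

theorem quad_rel {x : ℍ[K,a,0,c]} (hx : ¬ Cn x) {p q : K} (e : x * x = p • x - q • 1) :
    tr x = p ∧ nr x = q := by
  rw [quad] at e
  have : (tr x - p) • x = (nr x - q) • 1 := by
    rw [sub_smul, sub_smul, sub_eq_sub_iff_add_eq_add]
    rw [sub_eq_sub_iff_add_eq_add] at e
    rw [e]; abel
  obtain ⟨h1, h2⟩ := indep hx this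
  exact ⟨sub_eq_zero.mp h1, sub_eq_zero.mp h2⟩

theorem quart (x : ℍ[K,a,0,c]) : x ^ 4 = (tr x ^ 3 - 2 * tr x * nr x) • x
    - (tr x ^ 2 * nr x - nr x ^ 2) • 1 := by
  have : x ^ 4 = (x * x) * (x * x) := by noncomm_ring
  rw [this, quad x, sub_mul, mul_sub, mul_sub]
  simp only [smul_mul_assoc, mul_smul_comm, one_mul, mul_one, smul_smul, quad x]
  module

theorem cube (x : ℍ[K,a,0,c]) : x ^ 3 = (tr x ^ 2 - nr x) • x
    - (tr x * nr x) • 1 := by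
  have : x ^ 3 = (x * x) * x := by noncomm_ring
  rw [this, quad, sub_mul]
  simp only [smul_mul_assoc, one_mul, smul_smul, quad x]
  module

set_option maxHeartbeats 1000000 in
/-- possible types of noncentral torsion elements -/
theorem HQ.types (h : HQ K a c) {x : ℍ[K,a,0,c]} (hx : ¬ Cn x) {n : ℕ} (hn : 0 < n) (e : x ^ n = 1) :
    (nr x = 1 ∧ ((orderOf x = 4 ∧ tr x = 0) ∨ (orderOf x = 6 ∧ tr x = 1) ∨ (orderOf x = 3 ∧ tr x = -1) ∨
      (orderOf x = 8 ∧ tr x ^ 2 = 2) ∨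
      (orderOf x = 12 ∧ tr x ^ 2 = 3) ∨ (orderOf x = 5 ∧ tr x ^ 2 + tr x = 1) ∨
      (orderOf x = 10 ∧ tr x ^ 2 - tr x = 1))) ∨
    (nr x = -1 ∧ (tr x ^ 2 = -2 ∨ tr x ^ 2 = -1)) ∨
    (tr x = 0 ∧ nr x ^ 2 = -1) ∨ (tr x = 0 ∧ nr x ^ 2 + nr x + 1 = 0) := by
  have ho := h.ordQ x n hn e
  have hp := pow_orderOf_eq_one x
  have hmin : ∀ m, 0 < m → m < orderOf x → x ^ m ≠ 1 := fun m h1 h2 h3 =>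
    absurd (orderOf_le_of_pow_eq_one h1 h3) (by omega)
  have half : ∀ m, 0 < m → orderOf x = 2 * m → x ^ m = -1 := by
    intro m hm hm2
    have : (x ^ m - 1) * (x ^ m + 1) = 0 := by
      have : (x ^ m - 1) * (x ^ m + 1) = x ^ (2 * m) - 1 := by
        rw [two_mul, pow_add]; noncomm_ring
      rw [this, ← hm2, hp, sub_self]
    rcases h.nzd this with e | e
    · exact absurd (sub_eq_zero.mp e) (hmin m hm (by omega))
    · exact eq_neg_of_add_eq_zero_left e
  have five : ∀ y : ℍ[K,a,0,c], ¬ Cn y → y ^ 5 = 1 → nr y = 1 ∧ tr y ^ 2 + tr y = 1 := by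
    intro y hy y5
    have y1 : y ≠ 1 := by rintro rfl; apply hy; simp [Cn]
    have hN : nr y = 1 := by
      have h5 : nr y ^ 5 = 1 := by rw [← nr_pow, y5, nr_one]
      have h1 := h.ordK (nr y) 5 (by norm_num) h5
      have h2 := orderOf_dvd_of_pow_eq_one h5
      rw [← orderOf_eq_one_iff]
      generalize orderOf (nr y) = k at *
      simp only [Finset.mem_insert, Finset.mem_singleton] at h1
      rcases h1 with rfl | rfl | rfl | rfl | rfl <;> revert h2 <;> decide
    refine ⟨hN, ?_⟩
    have : (y - 1) * (y ^ 4 + y ^ 3 + y * y + y + 1) = 0 := by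
      have : (y - 1) * (y ^ 4 + y ^ 3 + y * y + y + 1) = y ^ 5 - 1 := by noncomm_ring
      rw [this, y5, sub_self]
    rcases h.nzd this with e | e
    · exact absurd (sub_eq_zero.mp e) y1
    rw [quart, cube, quad, hN] at e
    have e' : (tr y ^ 3 - 2 * tr y + tr y ^ 2 - 1 + tr y + 1) • y = (tr y ^ 2 - 1 + tr y + 1 - 1) • 1 := by
      rw [← sub_eq_zero, ← e]; module
    have := (indep hy e').2
    linear_combination this
  have hx0 : x ≠ 1 := by rintro rfl; apply hx; simp [Cn]
  have hx1 : x ≠ -1 := by rintro rfl; apply hx; simp [Cn]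
  simp only [Finset.mem_insert, Finset.mem_singleton] at ho
  rcases ho with ho | ho | ho | ho | ho | ho | ho | ho | ho
  · exact absurd (orderOf_eq_one_iff.mp ho) hx0
  · exact absurd (by simpa using half 1 (by norm_num) ho) hx1
  · have : (x - 1) * (x * x + x + 1) = 0 := by
      have : (x - 1) * (x * x + x + 1) = x ^ 3 - 1 := by noncomm_ring
      rw [this, ← ho, hp, sub_self]
    rcases h.nzd this with e | e
    · exact absurd (sub_eq_zero.mp e) hx0
    obtain ⟨h1, h2⟩ := quad_rel hx (p := -1) (q := 1) (by
      rw [← sub_eq_zero, ← e]; module)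
    exact Or.inl ⟨h2, by simp only [ho, h1]; simp⟩
  · have := half 2 (by norm_num) ho
    obtain ⟨h1, h2⟩ := quad_rel hx (p := 0) (q := 1) (by
      rw [← pow_two, this]; module)
    exact Or.inl ⟨h2, by simp only [ho, h1]; simp⟩
  · have := five x hx (by rw [← ho, hp])
    exact Or.inl ⟨this.1, by simp only [ho, this.2]; simp⟩
  · have h3 := half 3 (by norm_num) ho
    have : (x + 1) * (x * x - x + 1) = 0 := by
      have : (x + 1) * (x * x - x + 1) = x ^ 3 + 1 := by noncomm_ring
      rw [this, h3]; simp
    rcases h.nzd this with e | e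
    · exact absurd (eq_neg_of_add_eq_zero_left e) hx1
    obtain ⟨h1, h2⟩ := quad_rel hx (p := 1) (q := 1) (by
      rw [← sub_eq_zero, ← e]; module)
    exact Or.inl ⟨h2, by simp only [ho, h1]; simp⟩
  · have h4 := half 4 (by norm_num) ho
    rw [quart] at h4
    have e' : (tr x ^ 3 - 2 * tr x * nr x) • x = (tr x ^ 2 * nr x - nr x ^ 2 - 1) • 1 := by
      rw [sub_eq_iff_eq_add] at h4; rw [h4]; module
    obtain ⟨h1, h2⟩ := indep hx e'
    have : tr x * (tr x ^ 2 - 2 * nr x) = 0 := by linear_combination h1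
    rcases mul_eq_zero.mp this with t0 | t0
    · right; right; left; exact ⟨t0, by rw [t0] at h2; linear_combination -h2⟩
    · have hN : (nr x - 1) * (nr x + 1) = 0 := by linear_combination h2 - nr x * t0
      rcases mul_eq_zero.mp hN with e | e
      · left
        have e1 : nr x = 1 := by linear_combination e
        rw [e1] at t0
        have : tr x ^ 2 = 2 := by linear_combination t0
        exact ⟨e1, by simp only [ho, this]; simp⟩
      · right; left
        have e1 : nr x = -1 := by linear_combination e
        rw [e1] at t0
        exact ⟨e1, Or.inl (by linear_combination t0)⟩
  · have h5 := half 5 (by norm_num) ho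
    have := five (-x) (by simpa [Cn] using hx) (by
      have : (-x) ^ 5 = - x ^ 5 := by noncomm_ring
      rw [this, h5, neg_neg])
    rw [nr_neg, tr_neg] at this
    obtain ⟨h1, h2⟩ := this
    have : tr x ^ 2 - tr x = 1 := by linear_combination h2
    exact Or.inl ⟨h1, by simp only [ho, this]; simp⟩
  · have h6 := half 6 (by norm_num) ho
    have h2 : x * x ≠ -1 := by
      intro h2
      apply hmin 4 (by norm_num) (by omega)
      have : x ^ 4 = (x * x) * (x * x) := by noncomm_ring
      rw [this, h2]; simp
    have : (x * x + 1) * (x ^ 4 - x * x + 1) = 0 := by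
      have : (x * x + 1) * (x ^ 4 - x * x + 1) = x ^ 6 + 1 := by noncomm_ring
      rw [this, h6]; simp
    rcases h.nzd this with e | e
    · exact absurd (eq_neg_of_add_eq_zero_left e) h2
    rw [quart, quad] at e
    have e' : (tr x ^ 3 - 2 * tr x * nr x - tr x) • x = (tr x ^ 2 * nr x - nr x ^ 2 - nr x - 1) • 1 := by
      rw [← sub_eq_zero, ← e]; module
    obtain ⟨h1, h2⟩ := indep hx e'
    have : tr x * (tr x ^ 2 - 2 * nr x - 1) = 0 := by linear_combination h1
    rcases mul_eq_zero.mp this with t0 | t0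
    · right; right; right; exact ⟨t0, by rw [t0] at h2; linear_combination -h2⟩
    · have hN : (nr x - 1) * (nr x + 1) = 0 := by linear_combination h2 - nr x * t0
      rcases mul_eq_zero.mp hN with e | e
      · left
        have e1 : nr x = 1 := by linear_combination e
        rw [e1] at t0
        have : tr x ^ 2 = 3 := by linear_combination t0
        exact ⟨e1, by simp only [ho, this]; simp⟩
      · right; left
        have e1 : nr x = -1 := by linear_combination e
        rw [e1] at t0
        exact ⟨e1, Or.inr (by linear_combination t0)⟩

end QA

open scoped Quaternion

namespace QA
set_option linter.unusedSectionVars false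
variable {K : Type*} [Field K] [CharZero K] {a c : K}

/-- a set of torsion elements closed under products and containing torsion scalars -/
structure TS (S : Submonoid ℍ[K,a,0,c]) : Prop where
  tor : ∀ x ∈ S, ∃ n, 0 < n ∧ x ^ n = 1
  cen : ∀ r : K, r ^ 12 = 1 → r • (1 : ℍ[K,a,0,c]) ∈ S

theorem sq1 {t : K} (h : t ^ 2 = 1) : t = 1 ∨ t = -1 :=
  mul_self_eq_one_iff.mp (by rw [← pow_two, h])

theorem cnj_mem {S : Submonoid ℍ[K,a,0,c]} (hS : TS S) {x : ℍ[K,a,0,c]} (hx : x ∈ S) (hn : nr x = 1) :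
    cnj x ∈ S := by
  obtain ⟨n, hn0, e⟩ := hS.tor x hx
  obtain ⟨m, rfl⟩ := Nat.exists_eq_succ_of_ne_zero hn0.ne'
  have : cnj x = x ^ m := by
    have : x ^ m * (x * cnj x) = cnj x := by
      rw [← mul_assoc, ← pow_succ, e, one_mul]
    rw [← this, mul_cnj, hn]; simp
  rw [this]; exact pow_mem hx m

theorem smul_mem {S : Submonoid ℍ[K,a,0,c]} (hS : TS S) {x : ℍ[K,a,0,c]} (hx : x ∈ S) {r : K}
    (hr : r ^ 12 = 1) : r • x ∈ S := by
  have := S.mul_mem (hS.cen r hr) hx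
  simpa using this

theorem Cn_mul_left {x y : ℍ[K,a,0,c]} (h : Cn (x * y)) : nr x ≠ 0 → x * y = y * x := by
  intro hx
  have h1 := h.comm x
  -- x y x = x x y
  have h2 : cnj x * (x * y * x) = cnj x * (x * (x * y)) := by rw [h1]
  rw [← mul_assoc, ← mul_assoc, ← mul_assoc, cnj_mul] at h2
  simp only [smul_mul_assoc, one_mul] at h2
  exact (smul_right_injective _ hx h2).symm

theorem cancel_comm {x y : ℍ[K,a,0,c]} (hx : nr x ≠ 0) (h : x * (x * y) = x * y * x) :
    x * y = y * x := by
  have h2 : cnj x * x * (x * y) = cnj x * x * (y * x) := by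
    have := congrArg (cnj x * ·) h
    simpa only [mul_assoc] using this
  rw [cnj_mul] at h2
  simp only [smul_mul_assoc, one_mul] at h2
  exact smul_right_injective _ hx h2

theorem nr_ne {S : Submonoid ℍ[K,a,0,c]} (hS : TS S) {x : ℍ[K,a,0,c]} (hx : x ∈ S) : nr x ≠ 0 := by
  obtain ⟨n, hn0, e⟩ := hS.tor x hx
  intro h0
  have := nr_pow x n
  rw [e, h0, nr_one, zero_pow hn0.ne'] at this
  exact one_ne_zero this

theorem HQ.nsq (h : HQ K a c) (d e : ℤ) (h1 : ¬ IsSquare d) (h2 : ¬ IsSquare e) (h3 : ¬ IsSquare (d * e))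
    {u v : K} (hu : u ^ 2 = d) (hv : v ^ 2 = e) : False := by
  rcases h.sq d e ⟨u, hu⟩ ⟨v, hv⟩ with r | r | r
  exacts [h1 r, h2 r, h3 r]

theorem nc_left {x y : ℍ[K,a,0,c]} (h : x * y ≠ y * x) : ¬ Cn x := fun hx => h (hx.comm y)
theorem nc_right {x y : ℍ[K,a,0,c]} (h : x * y ≠ y * x) : ¬ Cn y := fun hx => h (hx.comm x).symm

theorem HQ.no_omega (h : HQ K a c) {S : Submonoid ℍ[K,a,0,c]} (hS : TS S) {x y : ℍ[K,a,0,c]}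
    (hx : x ∈ S) (hy : y ∈ S) (hxy : x * y ≠ y * x) (w : K) (hw : w ^ 2 + w + 1 = 0) : False := by
  have hw3 : w ^ 3 = 1 := by linear_combination (w - 1) * hw
  have h3 : (2 * w + 1) ^ 2 = ((-3 : ℤ) : K) := by push_cast; linear_combination 4 * hw
  have key : ∀ g ∈ S, ¬ Cn g → tr g = 0 ∧ (nr g = 1 ∨ nr g ^ 2 + nr g + 1 = 0) := by
    intro g hg hc
    obtain ⟨n, hn, e⟩ := hS.tor g hg
    have one : ∀ t : K, t ^ 2 = 1 → tr g = t → nr g = 1 → False := by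
      intro t ht ht2 hn
      apply hc
      have hq := quad g
      rw [ht2, hn] at hq
      have : Cn ((2 : K) • g - t • 1) := h.sq_eq (r := 2 * w + 1) (by
        simp only [two_smul, sub_mul, mul_sub, add_mul, mul_add, smul_mul_assoc, mul_smul_comm, one_mul,
          mul_one, hq]
        have e1 : (2 * w + 1) ^ 2 = t ^ 2 - 4 := by rw [h3, ht]; norm_num
        rw [e1]; module)
      simpa [Cn] using this
    rcases h.types hc hn e with ⟨h1, h2⟩ | ⟨h1, h2⟩ | ⟨h1, h2⟩ | ⟨h1, h2⟩
    · rcases h2 with ⟨-, h2⟩ | ⟨-, h2⟩ | ⟨-, h2⟩ | ⟨-, h2⟩ | ⟨-, h2⟩ | ⟨-, h2⟩ | ⟨-, h2⟩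
      · exact ⟨h2, Or.inl h1⟩
      · exact (one 1 (by norm_num) h2 h1).elim
      · exact (one (-1) (by norm_num) h2 h1).elim
      · exact (h.nsq (-3) 2 (by norm_num) (by norm_num) (by norm_num) h3 (by exact_mod_cast h2)).elim
      · exact (h.nsq (-3) 3 (by norm_num) (by norm_num) (by norm_num) h3 (by exact_mod_cast h2)).elim
      · exact (h.nsq (-3) 5 (by norm_num) (by norm_num) (by norm_num) h3 (v := 2 * tr g + 1)
          (by push_cast; linear_combination 4 * h2)).elim
      · exact (h.nsq (-3) 5 (by norm_num) (by norm_num) (by norm_num) h3 (v := 2 * tr g - 1)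
          (by push_cast; linear_combination 4 * h2)).elim
    · rcases h2 with h2 | h2
      · exact (h.nsq (-3) (-2) (by norm_num) (by norm_num) (by norm_num) h3 (by exact_mod_cast h2)).elim
      · exact (h.nsq (-3) (-1) (by norm_num) (by norm_num) (by norm_num) h3 (by exact_mod_cast h2)).elim
    · exact (h.nsq (-3) (-1) (by norm_num) (by norm_num) (by norm_num) h3 (by exact_mod_cast h2)).elim
    · exact ⟨h1, Or.inr h2⟩
  have norm : ∀ g ∈ S, ¬ Cn g → ∃ r : K, r ≠ 0 ∧ r • g ∈ S ∧ nr (r • g) = 1 := by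
    intro g hg hc
    rcases (key g hg hc).2 with e | e
    · exact ⟨1, one_ne_zero, by simpa using hg, by simpa using e⟩
    · have e3 : nr g ^ 3 = 1 := by linear_combination (nr g - 1) * e
      refine ⟨nr g, nr_ne hS hg, smul_mem hS hg (by
        have : nr g ^ 12 = (nr g ^ 3) ^ 4 := by ring
        rw [this, e3, one_pow]), ?_⟩
      rw [nr_smul]; linear_combination e3
  obtain ⟨r, hr, hrS, hrn⟩ := norm x hx (nc_left hxy)
  obtain ⟨s, hs, hsS, hsn⟩ := norm y hy (nc_right hxy)
  have hne : (r • x) * (s • y) ≠ (s • y) * (r • x) := by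
    intro e
    apply hxy
    simp only [smul_mul_assoc, mul_smul_comm, smul_smul, mul_comm s r] at e
    exact smul_right_injective _ (mul_ne_zero hr hs) e
  generalize r • x = x at *
  generalize s • y = y at *
  have tx := (key x hrS (nc_left hne)).1
  have ty := (key y hsS (nc_right hne)).1
  have hc : ¬ Cn (x * y) := fun hc => hne (Cn_mul_left hc (nr_ne hS hrS))
  have txy := (key (x * y) (S.mul_mem hrS hsS) hc).1
  have ha := anti x y tx ty txy
  have qx := quad x
  have qy := quad y
  rw [tx, hrn] at qx
  rw [ty, hsn] at qy
  have hu : Cn (w • x + w ^ 2 • y) := h.sq_eq (r := 1) (by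
    simp only [add_mul, mul_add, smul_mul_assoc, mul_smul_comm, qx, qy, ha]
    have e1 : (1 : K) ^ 2 = - (w ^ 2) - w ^ 4 := by linear_combination hw + w * hw3
    rw [e1]
    module)
  have hu2 := hu.comm x
  simp only [add_mul, mul_add, smul_mul_assoc, mul_smul_comm, add_right_inj] at hu2
  have w0 : w ^ 2 ≠ 0 := by
    intro e
    have : w = 0 := by simpa using e
    rw [this] at hw; norm_num at hw
  exact hne (smul_right_injective _ w0 hu2).symm

theorem HQ.no_i (h : HQ K a c) {S : Submonoid ℍ[K,a,0,c]} (hS : TS S) {x y : ℍ[K,a,0,c]}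
    (hx : x ∈ S) (hy : y ∈ S) (hxy : x * y ≠ y * x) (i : K) (hi : i ^ 2 = -1) : False := by
  have h3 : i ^ 2 = ((-1 : ℤ) : K) := by push_cast; exact hi
  have key : ∀ g ∈ S, ¬ Cn g → (tr g ^ 2 = nr g ∧ nr g ^ 2 = 1) ∨ (tr g = 0 ∧ nr g ^ 2 = -1) := by
    intro g hg hc
    obtain ⟨n, hn, e⟩ := hS.tor g hg
    rcases h.types hc hn e with ⟨h1, h2⟩ | ⟨h1, h2⟩ | ⟨h1, h2⟩ | ⟨h1, h2⟩
    · rcases h2 with ⟨-, h2⟩ | ⟨-, h2⟩ | ⟨-, h2⟩ | ⟨-, h2⟩ | ⟨-, h2⟩ | ⟨-, h2⟩ | ⟨-, h2⟩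
      · refine (hc (h.sq_eq (r := i) ?_)).elim
        rw [quad, h1, h2, hi]; module
      · left; rw [h1, h2]; norm_num
      · left; rw [h1, h2]; norm_num
      · exact (h.nsq (-1) 2 (by norm_num) (by norm_num) (by norm_num) h3 (by exact_mod_cast h2)).elim
      · exact (h.nsq (-1) 3 (by norm_num) (by norm_num) (by norm_num) h3 (by exact_mod_cast h2)).elim
      · exact (h.nsq (-1) 5 (by norm_num) (by norm_num) (by norm_num) h3 (v := 2 * tr g + 1)
          (by push_cast; linear_combination 4 * h2)).elim
      · exact (h.nsq (-1) 5 (by norm_num) (by norm_num) (by norm_num) h3 (v := 2 * tr g - 1)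
          (by push_cast; linear_combination 4 * h2)).elim
    · rcases h2 with h2 | h2
      · exact (h.nsq (-1) (-2) (by norm_num) (by norm_num) (by norm_num) h3 (by exact_mod_cast h2)).elim
      · left; rw [h1, h2]; norm_num
    · exact Or.inr ⟨h1, h2⟩
    · exact (h.nsq (-1) (-3) (by norm_num) (by norm_num) (by norm_num) h3 (v := 2 * nr g + 1)
          (by push_cast; linear_combination 4 * h2)).elim
  have i0 : i ≠ 0 := by rintro rfl; norm_num at hi
  have norm : ∀ g ∈ S, nr g ^ 2 = 1 → ∃ r : K, r ≠ 0 ∧ r • g ∈ S ∧ nr (r • g) = 1 := by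
    intro g hg h1
    rcases sq1 h1 with e | e
    · exact ⟨1, one_ne_zero, by simpa using hg, by simpa using e⟩
    · refine ⟨i, i0, smul_mem hS hg (by
        have : i ^ 12 = (i ^ 2) ^ 6 := by ring
        rw [this, hi]; norm_num), ?_⟩
      rw [nr_smul, hi, e]; norm_num
  -- no two noncommuting elements of norm one
  have A : ∀ x ∈ S, ∀ y ∈ S, nr x = 1 → nr y = 1 → x * y = y * x := by
    intro x hx y hy nx ny
    by_contra hne
    have T : ∀ g ∈ S, ¬ Cn g → nr g = 1 → tr g = 1 ∨ tr g = -1 := by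
      intro g hg hc h1
      rcases key g hg hc with ⟨e, -⟩ | ⟨-, e⟩
      · rw [h1] at e; exact sq1 e
      · rw [h1] at e; norm_num at e
    have hc1 : ¬ Cn (x * y) := fun hc => hne (Cn_mul_left hc (nr_ne hS hx))
    have hcy := cnj_mem hS hy ny
    have hc2 : ¬ Cn (x * cnj y) := fun hc => by
      have := Cn_mul_left hc (nr_ne hS hx)
      have e : cnj y = tr y • 1 - y := by rw [← add_cnj y]; abel
      rw [e] at this
      simp [mul_sub, sub_mul] at this
      exact hne this
    have ny' : nr (cnj y) = 1 := by simpa [nr, cnj] using ny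
    have t1 := T x hx (nc_left hne) nx
    have t2 := T y hy (nc_right hne) ny
    have t3 := T _ (S.mul_mem hx hy) hc1 (by rw [nr_mul, nx, ny, mul_one])
    have t4 := T _ (S.mul_mem hx hcy) hc2 (by rw [nr_mul, nx, ny', mul_one])
    have := tr_mul_add x y
    rcases t1 with t1 | t1 <;> rcases t2 with t2 | t2 <;> rcases t3 with t3 | t3 <;>
      rcases t4 with t4 | t4 <;> rw [t1, t2, t3, t4] at this <;> norm_num at this
  -- general elements with square norm one
  have A' : ∀ x ∈ S, ∀ y ∈ S, nr x ^ 2 = 1 → nr y ^ 2 = 1 → x * y = y * x := by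
    intro x hx y hy nx ny
    obtain ⟨r, hr, hrS, hrn⟩ := norm x hx nx
    obtain ⟨s, hs, hsS, hsn⟩ := norm y hy ny
    have e := A _ hrS _ hsS hrn hsn
    simp only [smul_mul_assoc, mul_smul_comm, smul_smul, mul_comm s r] at e
    exact smul_right_injective _ (mul_ne_zero hr hs) e
  -- the mixed case
  have B : ∀ x ∈ S, ∀ y ∈ S, nr x ^ 2 = -1 → nr y = 1 → x * y = y * x := by
    intro x hx y hy nx ny
    by_contra hne
    have tx : tr x = 0 := by
      rcases key x hx (nc_left hne) with ⟨-, e⟩ | ⟨e, -⟩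
      · rw [nx] at e; norm_num at e
      · exact e
    have hc1 : ¬ Cn (x * y) := fun hc => hne (Cn_mul_left hc (nr_ne hS hx))
    have txy : tr (x * y) = 0 := by
      rcases key _ (S.mul_mem hx hy) hc1 with ⟨-, e⟩ | ⟨e, -⟩
      · rw [nr_mul, ny, mul_one, nx] at e; norm_num at e
      · exact e
    have ty : tr y ^ 2 = 1 := by
      rcases key y hy (nc_right hne) with ⟨e, -⟩ | ⟨-, e⟩
      · rw [e, ny]
      · rw [ny] at e; norm_num at e
    set t := tr y with ht
    have nal : nr (1 - (t * i) • y) = -i := by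
      rw [nr_one_sub_smul, ← ht, ny]; linear_combination (-i + i ^ 2) * ty + hi
    have tal : tr ((1 - (t * i) • y) * x) = 0 := by
      rw [sub_mul, one_mul, tr_sub, tx, smul_mul_assoc, tr_smul, tr_comm, txy]; ring
    have nal2 : nr ((1 - (t * i) • y) * x) ^ 2 = 1 := by
      rw [nr_mul, nal]; linear_combination i ^ 2 * nx - hi
    have hC : Cn ((1 - (t * i) • y) * x) := by
      rcases sq1 nal2 with e | e
      · apply h.sq_eq (r := i); rw [quad, tal, e, hi]; module
      · apply h.sq_eq (r := 1); rw [quad, tal, e]; module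
    have := Cn_mul_left hC (by rw [nal]; simpa using i0)
    simp only [sub_mul, mul_sub, one_mul, mul_one, smul_mul_assoc, mul_smul_comm, sub_right_inj] at this
    have t0 : t ≠ 0 := by intro e; rw [e] at ty; norm_num at ty
    exact hne (smul_right_injective _ (mul_ne_zero t0 i0) this).symm
  have B' : ∀ x ∈ S, ∀ y ∈ S, nr x ^ 2 = -1 → nr y ^ 2 = 1 → x * y = y * x := by
    intro x hx y hy nx ny
    obtain ⟨s, hs, hsS, hsn⟩ := norm y hy ny
    have e := B x hx _ hsS nx hsn
    simp only [smul_mul_assoc, mul_smul_comm] at e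
    exact smul_right_injective _ hs e
  have nrs : ∀ g ∈ S, ¬ Cn g → nr g ^ 2 = 1 ∨ nr g ^ 2 = -1 := by
    intro g hg hc
    rcases key g hg hc with ⟨-, e⟩ | ⟨-, e⟩ <;> simp [e]
  rcases nrs x hx (nc_left hxy) with e1 | e1 <;> rcases nrs y hy (nc_right hxy) with e2 | e2
  · exact hxy (A' x hx y hy e1 e2)
  · exact hxy (B' y hy x hx e2 e1).symm
  · exact hxy (B' x hx y hy e1 e2)
  · have h1 := B' x hx (x * y) (S.mul_mem hx hy) e1 (by rw [nr_mul, mul_pow, e1, e2]; norm_num)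
    exact hxy (cancel_comm (nr_ne hS hx) h1)

end QA

open scoped Quaternion

namespace QA
set_option linter.unusedSectionVars false
variable {K : Type*} [Field K] [CharZero K] {a c : K}

/-- in the noncommutative case all norms are one -/
theorem HQ.norm_one (h : HQ K a c) {S : Submonoid ℍ[K,a,0,c]} (hS : TS S) {x y : ℍ[K,a,0,c]}
    (hx : x ∈ S) (hy : y ∈ S) (hxy : x * y ≠ y * x) : ∀ g ∈ S, nr g = 1 := by
  have nw : ∀ w : K, w ^ 2 + w + 1 ≠ 0 := fun w hw => h.no_omega hS hx hy hxy w hw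
  have ni : ∀ w : K, w ^ 2 ≠ -1 := fun w hw => h.no_i hS hx hy hxy w hw
  have tK : ∀ (r : K) (n : ℕ), 0 < n → r ^ n = 1 → r = 1 ∨ r = -1 := by
    intro r n hn hr
    have ho := h.ordK r n hn hr
    have h12 : r ^ 12 = 1 := by
      rw [← orderOf_dvd_iff_pow_eq_one]
      revert ho
      generalize orderOf r = k
      intro ho
      simp only [Finset.mem_insert, Finset.mem_singleton] at ho
      rcases ho with rfl | rfl | rfl | rfl | rfl <;> decide
    have : (r - 1) * ((r + 1) * ((r ^ 2 + r + 1) * (((-r) ^ 2 + (-r) + 1) * ((r ^ 2 + 1) *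
        ((- r ^ 2) ^ 2 + (- r ^ 2) + 1))))) = 0 := by
      linear_combination h12
    rcases mul_eq_zero.mp this with e | e
    · left; linear_combination e
    rcases mul_eq_zero.mp e with e | e
    · right; linear_combination e
    rcases mul_eq_zero.mp e with e | e
    · exact absurd e (nw _)
    rcases mul_eq_zero.mp e with e | e
    · exact absurd e (nw _)
    rcases mul_eq_zero.mp e with e | e
    · exact absurd (by linear_combination e) (ni r)
    · exact absurd e (nw _)
  have cen1 : ∀ g ∈ S, Cn g → nr g = 1 ∧ (tr g = 2 ∨ tr g = -2) := by
    intro g hg hc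
    obtain ⟨n, hn, e⟩ := hS.tor g hg
    have h1 := hc.eq
    have h2 : g.re ^ n = 1 := by
      rw [h1, smul_pow, one_pow] at e
      have := congrArg QuaternionAlgebra.re e
      simpa using this
    obtain ⟨c1, c2, c3⟩ := hc
    rcases tK _ n hn h2 with e | e <;> simp [nr, tr, c1, c2, c3, e]
  have nrg : ∀ g ∈ S, nr g = 1 ∨ nr g = -1 := by
    intro g hg
    obtain ⟨n, hn, e⟩ := hS.tor g hg
    exact tK _ n hn (by rw [← nr_pow, e, nr_one])
  have neg : ∀ g ∈ S, nr g = -1 → ¬ Cn g ∧ tr g ^ 2 = -2 := by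
    intro g hg hn
    have hc : ¬ Cn g := fun hc => by
      have := (cen1 g hg hc).1
      rw [hn] at this; norm_num at this
    refine ⟨hc, ?_⟩
    obtain ⟨n, hn', e⟩ := hS.tor g hg
    rcases h.types hc hn' e with ⟨h1, h2⟩ | ⟨h1, h2⟩ | ⟨h1, h2⟩ | ⟨h1, h2⟩
    · rw [hn] at h1; norm_num at h1
    · rcases h2 with h2 | h2
      · exact h2
      · exact absurd h2 (ni _)
    · exact absurd h2 (ni _)
    · exact absurd h2 (nw _)
  intro g hg
  rcases nrg g hg with e | e
  · exact e
  exfalso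
  obtain ⟨gc, tg⟩ := neg g hg e
  have m2 : tr g ^ 2 = ((-2 : ℤ) : K) := by push_cast; exact tg
  have t0 : tr g ≠ 0 := by intro e; rw [e] at tg; norm_num at tg
  have pos : ∀ p ∈ S, ¬ Cn p → nr p = 1 → tr p = 0 := by
    intro p hp hc np
    have h1 : tr p = 0 ∨ tr p = 1 ∨ tr p = -1 := by
      obtain ⟨n, hn', e⟩ := hS.tor p hp
      rcases h.types hc hn' e with ⟨h1, h2⟩ | ⟨h1, h2⟩ | ⟨h1, h2⟩ | ⟨h1, h2⟩
      · rcases h2 with ⟨-, h2⟩ | ⟨-, h2⟩ | ⟨-, h2⟩ | ⟨-, h2⟩ | ⟨-, h2⟩ | ⟨-, h2⟩ | ⟨-, h2⟩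
        · exact Or.inl h2
        · exact Or.inr (Or.inl h2)
        · exact Or.inr (Or.inr h2)
        · refine (ni (tr p / tr g) ?_).elim
          rw [div_pow, h2, tg]; norm_num
        · exact (h.nsq (-2) 3 (by norm_num) (by norm_num) (by norm_num) m2 (by exact_mod_cast h2)).elim
        · exact (h.nsq (-2) 5 (by norm_num) (by norm_num) (by norm_num) m2 (v := 2 * tr p + 1)
            (by push_cast; linear_combination 4 * h2)).elim
        · exact (h.nsq (-2) 5 (by norm_num) (by norm_num) (by norm_num) m2 (v := 2 * tr p - 1)
            (by push_cast; linear_combination 4 * h2)).elim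
      · rw [np] at h1; norm_num at h1
      · exact absurd h2 (ni _)
      · exact absurd h2 (nw _)
    have np' : nr (cnj p) = 1 := by simpa [nr, cnj] using np
    have t1 := (neg (g * p) (S.mul_mem hg hp) (by rw [nr_mul, e, np]; ring)).2
    have t2 := (neg (g * cnj p) (S.mul_mem hg (cnj_mem hS hp np)) (by rw [nr_mul, e, np']; ring)).2
    have f1 : tr (g * p) = tr g ∨ tr (g * p) = - tr g := sq_eq_sq_iff_eq_or_eq_neg.mp (by rw [t1, tg])
    have f2 : tr (g * cnj p) = tr g ∨ tr (g * cnj p) = - tr g :=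
      sq_eq_sq_iff_eq_or_eq_neg.mp (by rw [t2, tg])
    have hs := tr_mul_add g p
    have : (tr p - 2) * (tr p * (tr p + 2)) = 0 := by
      rcases f1 with f1 | f1 <;> rcases f2 with f2 | f2 <;> rw [f1, f2] at hs
      · have : tr p = 2 := mul_left_cancel₀ t0 (by linear_combination -hs)
        rw [this]; ring
      · have : tr p = 0 := mul_left_cancel₀ t0 (by linear_combination -hs)
        rw [this]; ring
      · have : tr p = 0 := mul_left_cancel₀ t0 (by linear_combination -hs)
        rw [this]; ring
      · have : tr p = -2 := mul_left_cancel₀ t0 (by linear_combination -hs)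
        rw [this]; ring
    rcases h1 with h1 | h1 | h1
    · exact h1
    · rw [h1] at this; norm_num at this
    · rw [h1] at this; norm_num at this
  have ab : ∀ p ∈ S, ∀ q ∈ S, nr p = 1 → nr q = 1 → p * q = q * p := by
    intro p hp q hq np nq
    by_contra hne
    have tp := pos p hp (nc_left hne) np
    have tq := pos q hq (nc_right hne) nq
    have hc : ¬ Cn (p * q) := fun hc => hne (Cn_mul_left hc (nr_ne hS hp))
    have tpq := pos (p * q) (S.mul_mem hp hq) hc (by rw [nr_mul, np, nq, mul_one])
    have ha := anti p q tp tq tpq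
    have qp := quad p
    have qq := quad q
    rw [tp, np] at qp
    rw [tq, nq] at qq
    have hu : Cn (p + tr g • q) := h.sq_eq (r := 1) (by
      simp only [add_mul, mul_add, smul_mul_assoc, mul_smul_comm, qp, qq, ha]
      have e1 : (1 : K) ^ 2 = - (tr g ^ 2) - 1 := by rw [tg]; norm_num
      rw [e1]
      module)
    have hu2 := hu.comm p
    simp only [add_mul, mul_add, smul_mul_assoc, mul_smul_comm, add_right_inj] at hu2
    exact hne (smul_right_injective _ t0 hu2).symm
  -- every element commutes with g
  have sqc : ∀ p ∈ S, nr p = 1 → g * p = p * g := by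
    intro p hp np
    have h1 := ab (g * g) (S.mul_mem hg hg) p hp (by rw [nr_mul, e]; norm_num) np
    rw [quad g] at h1
    simp only [sub_mul, mul_sub, smul_mul_assoc, mul_smul_comm, one_mul, mul_one, sub_left_inj] at h1
    exact smul_right_injective _ t0 h1
  have allc : ∀ p ∈ S, g * p = p * g := by
    intro p hp
    rcases nrg p hp with np | np
    · exact sqc p hp np
    · exact cancel_comm (nr_ne hS hg) (sqc (g * p) (S.mul_mem hg hp) (by rw [nr_mul, e, np]; norm_num))
  exact hxy (comm_trans h.ha h.hc gc (allc x hx) (allc y hy))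

end QA

open scoped Quaternion

namespace QA
set_option linter.unusedSectionVars false
variable {K : Type*} [Field K] [CharZero K] {a c : K}

/-- the torsion submonoid attached to a finite group -/
def tsub {G : Type} [Group G] (f : G →* ℍ[K,a,0,c]) : Submonoid ℍ[K,a,0,c] where
  carrier := {x | ∃ (r : K) (g : G), r ^ 12 = 1 ∧ x = r • f g}
  one_mem' := ⟨1, 1, by simp, by simp⟩
  mul_mem' := by
    rintro _ _ ⟨r, g, hr, rfl⟩ ⟨s, k, hs, rfl⟩
    exact ⟨r * s, g * k, by rw [mul_pow, hr, hs, one_mul], by simp [smul_smul, mul_comm]⟩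

theorem ts {G : Type} [Group G] [Finite G] (f : G →* ℍ[K,a,0,c]) : TS (tsub f) where
  tor := by
    rintro _ ⟨r, g, hr, rfl⟩
    refine ⟨12 * Nat.card G, mul_pos (by norm_num) Nat.card_pos, ?_⟩
    rw [smul_pow, pow_mul, hr, one_pow, one_smul, mul_comm, pow_mul, ← map_pow, pow_card_eq_one', map_one,
      one_pow]
  cen := fun r hr => ⟨r, 1, hr, by simp⟩

theorem HQ.nr_f (h : HQ K a c) {G : Type} [Group G] [Finite G] (f : G →* ℍ[K,a,0,c])
    (hf : Function.Injective f) (hn : ∃ x y : G, x * y ≠ y * x) (g : G) : nr (f g) = 1 := by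
  obtain ⟨x, y, hxy⟩ := hn
  have hm : ∀ g, f g ∈ tsub f := fun g => ⟨1, g, by simp, by simp⟩
  refine h.norm_one (ts f) (hm x) (hm y) ?_ (f g) (hm g)
  rw [← map_mul, ← map_mul]
  exact fun e => hxy (hf e)

theorem Cn_norm {x : ℍ[K,a,0,c]} (hx : Cn x) (hn : nr x = 1) : x = 1 ∨ x = -1 := by
  have h1 := hx.eq
  obtain ⟨c1, c2, c3⟩ := hx
  have : x.re ^ 2 = 1 := by simpa [nr, c1, c2, c3] using hn
  rcases sq1 this with e | e
  · left; rw [h1, e]; simp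
  · right; rw [h1, e]; simp

theorem HQ.bp (h : HQ K a c) {G : Type} [Group G] [Finite G] (f : G →* ℍ[K,a,0,c])
    (hf : Function.Injective f) (hn : ∃ x y : G, x * y ≠ y * x) (z : G) (hz : f z = -1)
    (cyc : ∀ H : Subgroup G, (∀ x ∈ H, ∀ y ∈ H, x * y = y * x) → IsCyclic H) : BP G z := by
  have nf := h.nr_f f hf hn
  have nC : ∀ g, g ≠ 1 → g ≠ z → ¬ Cn (f g) := by
    intro g h1 h2 hC
    rcases Cn_norm hC (nf g) with e | e
    · exact h1 (hf (by rw [e, map_one]))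
    · exact h2 (hf (by rw [e, hz]))
  have cm : ∀ {x y : G}, x * y = y * x ↔ f x * f y = f y * f x := by
    intro x y
    rw [← map_mul, ← map_mul]; exact hf.eq_iff.symm
  refine ⟨?_, ?_, ?_, ?_, ?_, ?_, cyc⟩
  · rintro rfl
    rw [map_one] at hz
    have := congrArg QuaternionAlgebra.re hz
    simp at this
    norm_num [eq_neg_iff_add_eq_zero] at this
  · apply hf; rw [map_mul, hz, map_one]; simp
  · intro g hg
    by_contra hcon
    push Not at hcon
    apply nC g hcon.1 hcon.2
    apply h.sq_eq (r := 1)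
    rw [← map_mul, hg]; simp
  · intro g x y h1 h2 hx hy
    exact cm.mpr (comm_trans h.ha h.hc (nC g h1 h2) (cm.mp hx) (cm.mp hy))
  · intro g
    rw [← orderOf_injective f hf]
    exact h.ordQ _ (Nat.card G) Nat.card_pos (by rw [← map_pow, pow_card_eq_one', map_one])
  · intro g x h1 h2 hc
    have hc' := cm.mp hc
    set y := x * g * x⁻¹ with hy
    have ty : tr (f y) = tr (f g) := by
      rw [hy, map_mul, tr_comm, ← map_mul]; congr 2; group
    have ig : f g⁻¹ = cnj (f g) := by
      have : f g⁻¹ * (f g * cnj (f g)) = cnj (f g) := by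
        rw [← mul_assoc, ← map_mul]; simp
      rw [← this, mul_cnj, nf]; simp
    have : (f y - f g) * (f y - f g⁻¹) = 0 := by
      have q1 := quad (f y)
      rw [nf, ty] at q1
      have e1 : cnj (f g) = tr (f g) • 1 - f g := by rw [← add_cnj]; abel
      have q2 := quad (f g)
      rw [nf] at q2
      rw [ig, e1]
      simp only [sub_mul, mul_sub, q1, q2, hc', smul_mul_assoc, mul_smul_comm, mul_one]
      module
    rcases h.nzd this with e | e
    · left; exact hf (sub_eq_zero.mp e)
    · right; exact hf (sub_eq_zero.mp e)

/-- order and trace -/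
theorem HQ.tr_types (h : HQ K a c) {G : Type} [Group G] [Finite G] (f : G →* ℍ[K,a,0,c])
    (hf : Function.Injective f) (hn : ∃ x y : G, x * y ≠ y * x) (g : G) :
    (orderOf g = 1 ∧ tr (f g) = 2) ∨ (orderOf g = 2 ∧ tr (f g) = -2) ∨
    (orderOf g = 4 ∧ tr (f g) = 0) ∨ (orderOf g = 6 ∧ tr (f g) = 1) ∨ (orderOf g = 3 ∧ tr (f g) = -1) ∨
      (orderOf g = 8 ∧ tr (f g) ^ 2 = 2) ∨
      (orderOf g = 12 ∧ tr (f g) ^ 2 = 3) ∨ (orderOf g = 5 ∧ tr (f g) ^ 2 + tr (f g) = 1) ∨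
      (orderOf g = 10 ∧ tr (f g) ^ 2 - tr (f g) = 1) := by
  have nf := h.nr_f f hf hn
  by_cases hc : Cn (f g)
  · rcases Cn_norm hc (nf g) with e | e
    · left
      have : g = 1 := hf (by rw [e, map_one])
      rw [e, this]
      exact ⟨orderOf_one, tr_one⟩
    · right; left
      rw [e]
      refine ⟨?_, by rw [tr_neg, tr_one]⟩
      rw [← orderOf_injective f hf, e]
      refine orderOf_eq_prime (by simp) ?_
      intro h1
      have := congrArg QuaternionAlgebra.re h1
      simp at this
      norm_num [neg_eq_iff_add_eq_zero] at this
  · right; right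
    rcases h.types hc (n := Nat.card G) Nat.card_pos (by rw [← map_pow, pow_card_eq_one', map_one]) with
      ⟨h1, h2⟩ | ⟨h1, h2⟩ | ⟨h1, h2⟩ | ⟨h1, h2⟩
    · rwa [orderOf_injective f hf] at h2
    · rw [nf] at h1; norm_num [eq_neg_iff_add_eq_zero] at h1
    · rw [nf] at h2; norm_num [eq_neg_iff_add_eq_zero] at h2
    · rw [nf] at h2; norm_num at h2

theorem HQ.no58 (h : HQ K a c) {G : Type} [Group G] [Finite G] (f : G →* ℍ[K,a,0,c])
    (hf : Function.Injective f) (hn : ∃ x y : G, x * y ≠ y * x) (x y : G) (hx : orderOf x = 5) :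
    orderOf y ≠ 8 ∧ orderOf y ≠ 12 := by
  have t5 : tr (f x) ^ 2 + tr (f x) = 1 := by
    rcases h.tr_types f hf hn x with e | e | e | e | e | e | e | e | e <;> first | exact e.2 | (exfalso; omega)
  have m5 : (2 * tr (f x) + 1) ^ 2 = ((5 : ℤ) : K) := by push_cast; linear_combination 4 * t5
  constructor
  · intro hy
    have : tr (f y) ^ 2 = 2 := by
      rcases h.tr_types f hf hn y with e | e | e | e | e | e | e | e | e <;> first | exact e.2 | (exfalso; omega)
    exact h.nsq 5 2 (by norm_num) (by norm_num) (by norm_num) m5 (by exact_mod_cast this)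
  · intro hy
    have : tr (f y) ^ 2 = 3 := by
      rcases h.tr_types f hf hn y with e | e | e | e | e | e | e | e | e <;> first | exact e.2 | (exfalso; omega)
    exact h.nsq 5 3 (by norm_num) (by norm_num) (by norm_num) m5 (by exact_mod_cast this)

end QA

open scoped Quaternion

namespace QA
set_option linter.unusedSectionVars false
variable {K : Type*} [Field K] [CharZero K] {a c : K}

theorem toSL (p : ℕ) [Fact p.Prime] (hp2 : p ≠ 2) (u v : ZMod p) (huv : u ^ 2 + v ^ 2 = -1)
    {G : Type} [Group G] (f : G →* ℍ[K,-1,0,-1]) (hn : ∀ g, nr (f g) = 1)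
    (h w : G) (hh : f h = ⟨0, 1, 0, 0⟩) (hw : f w = ⟨0, 0, 1, 0⟩)
    {R : Type} [CommRing R] (ι : R →+* K) (hι : Function.Injective ι) (θ : R →+* ZMod p)
    (t : G → R) (ht : ∀ g, ι (t g) = tr (f g)) :
    ∃ F : G →* Matrix.SpecialLinearGroup (Fin 2) (ZMod p), ∀ g, F g = 1 → θ (t g) = 2 := by
  have two : (2 : ZMod p) ≠ 0 := by
    intro e
    have : ((2 : ℕ) : ZMod p) = 0 := by exact_mod_cast e
    rw [ZMod.natCast_eq_zero_iff] at this
    exact hp2 ((Nat.prime_dvd_prime_iff_eq Fact.out Nat.prime_two).mp this)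
  obtain ⟨A, hA⟩ : ∃ A : G → R, ∀ g, ι (A g) = 2 * (f g).re := ⟨t, fun g => by rw [ht, tr]⟩
  obtain ⟨B, hB⟩ : ∃ A : G → R, ∀ g, ι (A g) = 2 * (f g).imI :=
    ⟨fun g => - t (h * g), fun g => by rw [map_neg, ht, tr, map_mul, hh]; simp⟩
  obtain ⟨C, hC⟩ : ∃ A : G → R, ∀ g, ι (A g) = 2 * (f g).imJ :=
    ⟨fun g => - t (w * g), fun g => by rw [map_neg, ht, tr, map_mul, hw]; simp⟩
  obtain ⟨D, hD⟩ : ∃ A : G → R, ∀ g, ι (A g) = 2 * (f g).imK :=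
    ⟨fun g => - t (h * w * g), fun g => by rw [map_neg, ht, tr, map_mul, map_mul, hw, hh]; simp⟩
  have hAt : ∀ g, A g = t g := fun g => hι (by rw [hA, ht, tr])
  have m1 : ∀ x y, 2 * A (x * y) = A x * A y - B x * B y - C x * C y - D x * D y := by
    intro x y
    apply hι
    simp only [map_mul, map_sub, hA, hB, hC, hD, map_ofNat]
    simp; ring
  have m2 : ∀ x y, 2 * B (x * y) = A x * B y + B x * A y + C x * D y - D x * C y := by
    intro x y
    apply hι
    simp only [map_mul, map_sub, map_add, hA, hB, hC, hD, map_ofNat]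
    simp; ring
  have m3 : ∀ x y, 2 * C (x * y) = A x * C y - B x * D y + C x * A y + D x * B y := by
    intro x y
    apply hι
    simp only [map_mul, map_sub, map_add, hA, hB, hC, hD, map_ofNat]
    simp; ring
  have m4 : ∀ x y, 2 * D (x * y) = A x * D y + B x * C y - C x * B y + D x * A y := by
    intro x y
    apply hι
    simp only [map_mul, map_sub, map_add, hA, hB, hC, hD, map_ofNat]
    simp; ring
  have m5 : ∀ x, A x ^ 2 + B x ^ 2 + C x ^ 2 + D x ^ 2 = 4 := by
    intro x
    apply hι
    have := hn x
    simp only [map_pow, map_add, hA, hB, hC, hD, map_ofNat]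
    simp only [nr] at this
    linear_combination 4 * this
  have a1 : A 1 = 2 := hι (by rw [hA, map_ofNat]; simp)
  have b1 : B 1 = 0 := hι (by rw [hB]; simp)
  have c1 : C 1 = 0 := hι (by rw [hC]; simp)
  have d1 : D 1 = 0 := hι (by rw [hD]; simp)
  have θm1 := fun x y => congrArg θ (m1 x y)
  have θm2 := fun x y => congrArg θ (m2 x y)
  have θm3 := fun x y => congrArg θ (m3 x y)
  have θm4 := fun x y => congrArg θ (m4 x y)
  have θm5 := fun x => congrArg θ (m5 x)
  simp only [map_mul, map_sub, map_add, map_pow, map_ofNat] at θm1 θm2 θm3 θm4 θm5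
  let k : ZMod p := 2⁻¹
  have hk : k * 2 = 1 := inv_mul_cancel₀ two
  have hk' : 2 * k = 1 := mul_inv_cancel₀ two
  let M : G → Matrix (Fin 2) (Fin 2) (ZMod p) := fun g =>
    !![k * (θ (A g) + u * θ (C g) - v * θ (D g)), k * (- θ (B g) + v * θ (C g) + u * θ (D g));
       k * (θ (B g) + v * θ (C g) + u * θ (D g)), k * (θ (A g) - u * θ (C g) + v * θ (D g))]
  have Mdet : ∀ g, (M g).det = 1 := by
    intro g
    rw [Matrix.det_fin_two_of]
    linear_combination k ^ 2 * θm5 g - k ^ 2 * (θ (C g) ^ 2 + θ (D g) ^ 2) * huv + (2 * k + 1) * hk'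
  have M1 : M 1 = 1 := by
    simp only [M, a1, b1, c1, d1, map_zero, map_ofNat]
    rw [Matrix.one_fin_two]
    simp [hk]
  have Mmul : ∀ x y, M (x * y) = M x * M y := by
    intro x y
    simp only [M]
    rw [Matrix.mul_fin_two]
    have e : ∀ X : ZMod p, k * X = k ^ 2 * (2 * X) := by
      intro X; linear_combination - k * X * hk
    congr 1
    funext i j
    fin_cases i <;> fin_cases j <;> simp
    · rw [e]
      linear_combination k ^ 2 * (θm1 x y + u * θm3 x y - v * θm4 x y)
        - k ^ 2 * (θ (C x) * θ (C y) + θ (D x) * θ (D y)) * huv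
    · rw [e]
      linear_combination k ^ 2 * (- θm2 x y + v * θm3 x y + u * θm4 x y)
        - k ^ 2 * (θ (C x) * θ (D y) - θ (D x) * θ (C y)) * huv
    · rw [e]
      linear_combination k ^ 2 * (θm2 x y + v * θm3 x y + u * θm4 x y)
        + k ^ 2 * (θ (C x) * θ (D y) - θ (D x) * θ (C y)) * huv
    · rw [e]
      linear_combination k ^ 2 * (θm1 x y - u * θm3 x y + v * θm4 x y)
        - k ^ 2 * (θ (C x) * θ (C y) + θ (D x) * θ (D y)) * huv
  refine ⟨{ toFun := fun g => ⟨M g, Mdet g⟩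
            map_one' := Subtype.ext M1
            map_mul' := fun x y => Subtype.ext (Mmul x y) }, ?_⟩
  intro g hg
  have hM : M g = 1 := congrArg Subtype.val hg
  have e0 := congrFun (congrFun hM 0) 0
  have e1 := congrFun (congrFun hM 1) 1
  simp [M] at e0 e1
  rw [← hAt]
  linear_combination e0 + e1 - θ (A g) * hk

end QA

theorem cardSL (p : ℕ) [NeZero p] : Fintype.card (Matrix.SpecialLinearGroup (Fin 2) (ZMod p)) =
   Fintype.card {x : (ZMod p × ZMod p) × (ZMod p × ZMod p) // x.1.1 * x.2.2 - x.1.2 * x.2.1 = 1} := by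
  apply Fintype.card_congr
  exact {
    toFun := fun M => ⟨((M.1 0 0, M.1 0 1), (M.1 1 0, M.1 1 1)), by
      have := M.2; rw [Matrix.det_fin_two] at this; exact this⟩
    invFun := fun x => ⟨!![x.1.1.1, x.1.1.2; x.1.2.1, x.1.2.2], by
      rw [Matrix.det_fin_two_of]; exact x.2⟩
    left_inv := fun M => by
      ext i j; fin_cases i <;> fin_cases j <;> rfl
    right_inv := fun x => by rfl }
theorem cardSL3 : Nat.card (Matrix.SpecialLinearGroup (Fin 2) (ZMod 3)) = 24 := by
  rw [Nat.card_eq_fintype_card, cardSL]; decide +kernel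
theorem cardSL5 : Nat.card (Matrix.SpecialLinearGroup (Fin 2) (ZMod 5)) = 120 := by
  rw [Nat.card_eq_fintype_card, cardSL]; decide +kernel

open scoped Quaternion

namespace QA
set_option linter.unusedSectionVars false
variable {K : Type*} [Field K] [CharZero K] {a c : K}

theorem iso_of_hom {G : Type} [Group G] [Finite G] {z : G} (hb : BP G z) (hI : ¬ CaseI G z) (p : ℕ)
    [Fact p.Prime] (hp : p ≠ 2) (F : G →* Matrix.SpecialLinearGroup (Fin 2) (ZMod p))
    (hF : ∀ g, F g = 1 → orderOf g = 1 ∨ orderOf g = p)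
    (hc : Nat.card G = Nat.card (Matrix.SpecialLinearGroup (Fin 2) (ZMod p))) :
    Nonempty (G ≃* Matrix.SpecialLinearGroup (Fin 2) (ZMod p)) := by
  have hk : F.ker = ⊥ := by
    by_contra hne
    apply hI
    refine hb.caseI_of_normal_pgroup F.ker p hp ?_ hne
    rintro ⟨g, hg⟩
    refine ⟨1, ?_⟩
    apply Subtype.ext
    have : g ^ p = 1 := by
      rcases hF g (MonoidHom.mem_ker.mp hg) with e | e
      · rw [orderOf_eq_one_iff.mp e, one_pow]
      · rw [← e, pow_orderOf_eq_one]
    simpa using this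
  have hinj : Function.Injective F := (MonoidHom.ker_eq_bot_iff F).mp hk
  have : Fintype G := Fintype.ofFinite G
  have hbij : Function.Bijective F := (Fintype.bijective_iff_injective_and_card F).mpr
    ⟨hinj, by rw [← Nat.card_eq_fintype_card, ← Nat.card_eq_fintype_card, hc]⟩
  exact ⟨MulEquiv.ofBijective F hbij⟩

instance fact_prime_five_inst : Fact (Nat.Prime 5) := ⟨by norm_num⟩

theorem HQ.iso3 (h : HQ K (-1) (-1)) {G : Type} [Group G] [Finite G] (f : G →* ℍ[K,-1,0,-1])
    (hf : Function.Injective f) (hn : ∃ x y : G, x * y ≠ y * x) {z : G} (hb : BP G z)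
    (hI : ¬ CaseI G z) (h8 : ∀ x : G, orderOf x ≠ 8) (h12 : ∀ x : G, orderOf x ≠ 12)
    (hc : Nat.card G = 24) (g w : G) (hg : f g = ⟨0, 1, 0, 0⟩) (hw : f w = ⟨0, 0, 1, 0⟩) :
    Nonempty (G ≃* Matrix.SpecialLinearGroup (Fin 2) (ZMod 3)) := by
  have h5 : ∀ x : G, ¬ 5 ∣ orderOf x := by
    intro x hx
    have := hx.trans (orderOf_dvd_natCard x)
    rw [hc] at this; norm_num at this
  have key : ∀ x : G, ∃ t : ℤ, (t : K) = tr (f x) ∧ ((t : ZMod 3) = 2 → orderOf x = 1 ∨ orderOf x = 3) := by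
    intro x
    have x8 := h8 x
    have x12 := h12 x
    have x5 := h5 x
    rcases h.tr_types f hf hn x with e | e | e | e | e | e | e | e | e
    · exact ⟨2, by rw [e.2]; norm_num, fun _ => Or.inl e.1⟩
    · exact ⟨-2, by rw [e.2]; norm_num, fun h => absurd h (by decide)⟩
    · exact ⟨0, by rw [e.2]; norm_num, fun h => absurd h (by decide)⟩
    · exact ⟨1, by rw [e.2]; norm_num, fun h => absurd h (by decide)⟩
    · exact ⟨-1, by rw [e.2]; norm_num, fun _ => Or.inr e.1⟩
    · exact absurd e.1 x8
    · exact absurd e.1 x12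
    · rw [e.1] at x5; norm_num at x5
    · rw [e.1] at x5; norm_num at x5
  choose t ht ht2 using key
  obtain ⟨F, hF⟩ := toSL 3 (by norm_num) 1 1 (by decide) f (h.nr_f f hf hn) g w hg hw (Int.castRingHom K)
    Int.cast_injective (Int.castRingHom (ZMod 3)) t ht
  exact iso_of_hom hb hI 3 (by norm_num) F (fun x hx => ht2 x (hF x hx)) (by rw [hc, cardSL3])

theorem HQ.iso5 (h : HQ K (-1) (-1)) {G : Type} [Group G] [Finite G] (f : G →* ℍ[K,-1,0,-1])
    (hf : Function.Injective f) (hn : ∃ x y : G, x * y ≠ y * x) {z : G} (hb : BP G z)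
    (hI : ¬ CaseI G z) (h8 : ∀ x : G, orderOf x ≠ 8) (h12 : ∀ x : G, orderOf x ≠ 12)
    (hc : Nat.card G = 120) (g w : G) (hg : f g = ⟨0, 1, 0, 0⟩) (hw : f w = ⟨0, 0, 1, 0⟩) :
    Nonempty (G ≃* Matrix.SpecialLinearGroup (Fin 2) (ZMod 5)) := by
  obtain ⟨x5, hx5⟩ := exists_prime_orderOf_dvd_card' (G := G) 5 (by rw [hc]; norm_num)
  obtain ⟨τ, hτ⟩ : ∃ τ : K, τ ^ 2 + τ = 1 := by
    refine ⟨tr (f x5), ?_⟩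
    rcases h.tr_types f hf hn x5 with e | e | e | e | e | e | e | e | e <;> first | exact e.2 | (exfalso; omega)
  let ι : QuadraticAlgebra ℤ 1 (-1) →ₐ[ℤ] K := QuadraticAlgebra.lift ⟨τ, by
    simp; linear_combination hτ⟩
  let θ : QuadraticAlgebra ℤ 1 (-1) →ₐ[ℤ] ZMod 5 := QuadraticAlgebra.lift ⟨2, by decide⟩
  have hι : ∀ m n : ℤ, ι ⟨m, n⟩ = m + n * τ := by
    intro m n; simp [ι, QuadraticAlgebra.lift]
  have hθ : ∀ m n : ℤ, θ ⟨m, n⟩ = m + n * 2 := by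
    intro m n; simp [θ, QuadraticAlgebra.lift]
  have hinj : Function.Injective ι := by
    rw [injective_iff_map_eq_zero]
    rintro ⟨m, n⟩ e
    rw [hι] at e
    have h5 : (5 * n ^ 2 : ℤ) = (n - 2 * m) ^ 2 := by
      have : ((5 * n ^ 2 : ℤ) : K) = ((n - 2 * m) ^ 2 : ℤ) := by
        push_cast
        linear_combination (4 * (n : K) * n) * (-hτ) + (4 * n * τ - 4 * m + 4 * n) * e
      exact_mod_cast this
    have hn0 : n = 0 := by
      by_contra hn0
      have : IsSquare (5 : ℚ) := ⟨((n - 2 * m : ℤ) : ℚ) / n, by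
        have hnq : (n : ℚ) ≠ 0 := by exact_mod_cast hn0
        field_simp
        exact_mod_cast h5⟩
      revert this
      norm_num
    subst hn0
    have hm : m = 0 := by simpa using e
    subst hm; rfl
  have key : ∀ x : G, ∃ t : QuadraticAlgebra ℤ 1 (-1), ι t = tr (f x) ∧
      (θ t = 2 → orderOf x = 1 ∨ orderOf x = 5) := by
    intro x
    have x8 := h8 x
    have x12 := h12 x
    have fac : ∀ s : K, s ^ 2 + s = 1 → s = τ ∨ s = -1 - τ := by
      intro s hs
      have : (s - τ) * (s - (-1 - τ)) = 0 := by linear_combination hs - hτ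
      rcases mul_eq_zero.mp this with e | e
      · left; linear_combination e
      · right; linear_combination e
    rcases h.tr_types f hf hn x with e | e | e | e | e | e | e | e | e
    · exact ⟨⟨2, 0⟩, by rw [e.2, hι]; norm_num, fun _ => Or.inl e.1⟩
    · exact ⟨⟨-2, 0⟩, by rw [e.2, hι]; norm_num, fun h => absurd h (by rw [hθ]; decide)⟩
    · exact ⟨⟨0, 0⟩, by rw [e.2, hι]; norm_num, fun h => absurd h (by rw [hθ]; decide)⟩
    · exact ⟨⟨1, 0⟩, by rw [e.2, hι]; norm_num, fun h => absurd h (by rw [hθ]; decide)⟩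
    · exact ⟨⟨-1, 0⟩, by rw [e.2, hι]; norm_num, fun h => absurd h (by rw [hθ]; decide)⟩
    · exact absurd e.1 x8
    · exact absurd e.1 x12
    · rcases fac _ e.2 with e2 | e2
      · exact ⟨⟨0, 1⟩, by rw [e2, hι]; norm_num, fun _ => Or.inr e.1⟩
      · exact ⟨⟨-1, -1⟩, by rw [e2, hι]; push_cast; ring, fun _ => Or.inr e.1⟩
    · rcases fac (- tr (f x)) (by linear_combination e.2) with e2 | e2
      · exact ⟨⟨0, -1⟩, by rw [hι]; push_cast; linear_combination e2,
          fun h => absurd h (by rw [hθ]; decide)⟩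
      · exact ⟨⟨1, 1⟩, by rw [hι]; push_cast; linear_combination e2,
          fun h => absurd h (by rw [hθ]; decide)⟩
  choose t ht ht2 using key
  obtain ⟨F, hF⟩ := toSL 5 (by norm_num) 2 0 (by decide) f (h.nr_f f hf hn) g w hg hw (ι : _ →+* K)
    hinj (θ : _ →+* ZMod 5) t ht
  exact iso_of_hom hb hI 5 (by norm_num) F (fun x hx => ht2 x (hF x hx)) (by rw [hc, cardSL5])

end QA

open scoped Quaternion

namespace QA
set_option linter.style.haveILetI false
set_option linter.deprecated false
set_option linter.unusedSectionVars false

theorem dep3 {F V : Type*} [Field F] [AddCommGroup V] [Module F V] [FiniteDimensional F V]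
    (h : Module.finrank F V ≤ 2) (x y z : V) :
    ∃ p q r : F, (p ≠ 0 ∨ q ≠ 0 ∨ r ≠ 0) ∧ p • x + q • y + r • z = 0 := by
  have hl : ¬ LinearIndependent F ![x, y, z] := by
    intro hl
    have := hl.fintype_card_le_finrank
    simp at this; omega
  rw [Fintype.linearIndependent_iff] at hl
  push Not at hl
  obtain ⟨g, hg, i, hi⟩ := hl
  refine ⟨g 0, g 1, g 2, ?_, by simpa [Fin.sum_univ_three] using hg⟩
  fin_cases i
  · exact Or.inl hi
  · exact Or.inr (Or.inl hi)
  · exact Or.inr (Or.inr hi)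

theorem field_sq {K : Type*} [Field K] [Algebra ℚ K] [FiniteDimensional ℚ K]
    (h : Module.finrank ℚ K ≤ 2) (d e : ℤ) (hu : ∃ u : K, u ^ 2 = d) (hv : ∃ v : K, v ^ 2 = e) :
    IsSquare d ∨ IsSquare e ∨ IsSquare (d * e) := by
  obtain ⟨u, hu⟩ := hu
  obtain ⟨v, hv⟩ := hv
  have : CharZero K := algebraRat.charZero K
  have hc : ∀ q : ℚ, algebraMap ℚ K q = (q : K) := fun q => by simp
  by_cases hd : IsSquare d
  · exact Or.inl hd
  have hirr : ∀ p q : ℚ, (p : K) + q * u = 0 → q = 0 := by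
    intro p q hpq
    by_contra hq
    apply hd
    rw [← Rat.isSquare_intCast_iff]
    refine ⟨p / q, ?_⟩
    have hqK : (q : K) ≠ 0 := by exact_mod_cast hq
    have : ((d : ℚ) : K) = ((p / q * (p / q) : ℚ) : K) := by
      push_cast
      rw [← hu]
      have : u = - (p / q : K) := by
        field_simp; linear_combination hpq
      rw [this]; ring
    exact_mod_cast this
  right
  obtain ⟨p, q, r, hne, e0⟩ := dep3 h (1 : K) u v
  simp only [Algebra.smul_def, hc, mul_one] at e0
  have hr : r ≠ 0 := by
    rintro rfl
    have hq := hirr p q (by simpa using e0)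
    subst hq
    have : p = 0 := by simpa using e0
    simp [this] at hne
  have hrK : (r : K) ≠ 0 := by exact_mod_cast hr
  have hv2 : v = ((-p / r : ℚ) : K) + ((-q / r : ℚ) : K) * u := by
    push_cast; field_simp; linear_combination e0
  generalize (-p / r : ℚ) = s at hv2
  generalize (-q / r : ℚ) = t at hv2
  have e1 : ((s ^ 2 + t ^ 2 * d - e : ℚ) : K) + ((2 * s * t : ℚ) : K) * u = 0 := by
    push_cast
    rw [← hv, hv2]; linear_combination (-t ^ 2 : K) * hu
  have hst := hirr _ _ e1
  rw [hst] at e1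
  have e2 : s ^ 2 + t ^ 2 * d - e = 0 := by
    have : ((s ^ 2 + t ^ 2 * d - e : ℚ) : K) = 0 := by simpa using e1
    exact_mod_cast this
  rcases mul_eq_zero.mp hst with h0 | h0
  · have hs : s = 0 := by simpa using h0
    subst hs
    right
    rw [← Rat.isSquare_intCast_iff]
    exact ⟨t * d, by push_cast; linear_combination (-d : ℚ) * e2⟩
  · subst h0
    left
    rw [← Rat.isSquare_intCast_iff]
    exact ⟨s, by linear_combination -e2⟩

theorem phi_le {L : Type*} [Field L] [hA : Algebra ℚ L] [FiniteDimensional ℚ L] (x : L) (h : 0 < orderOf x) :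
    (orderOf x).totient ≤ Module.finrank ℚ L := by
  have : CharZero L := algebraRat.charZero L
  have h1 := Polynomial.cyclotomic_eq_minpoly_rat (IsPrimitiveRoot.orderOf x) h
  rw [← Polynomial.natDegree_cyclotomic (orderOf x) ℚ, h1]
  have hs : hA = DivisionRing.toRatAlgebra := Subsingleton.elim _ _
  subst hs
  exact minpoly.natDegree_le (A := ℚ) x

theorem phi2 (n : ℕ) (h0 : 0 < n) (h : n.totient ≤ 4) : n ∈ ({1, 2, 3, 4, 5, 6, 8, 10, 12} : Finset ℕ) := by
  have hp : ∀ p k : ℕ, p ^ k ∣ n → (p ^ k).totient ≤ 4 := fun p k hd =>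
    (Nat.le_of_dvd (Nat.totient_pos.mpr h0) (Nat.totient_dvd_of_dvd hd)).trans h
  have hd : n ∣ 120 := by
    rw [← Nat.factorization_le_iff_dvd h0.ne' (by norm_num)]
    intro p
    by_contra hlt
    push Not at hlt
    have hp' : p.Prime := by
      by_contra hp'
      rw [Nat.factorization_eq_zero_of_not_prime n hp'] at hlt
      omega
    have h1 := hp p (n.factorization p) (Nat.ordProj_dvd n p)
    have hk : 0 < n.factorization p := by omega
    have hple : p - 1 ≤ 4 := by
      have := (Nat.le_of_dvd (Nat.totient_pos.mpr h0)
        (Nat.totient_dvd_of_dvd ((dvd_pow_self p hk.ne').trans (Nat.ordProj_dvd n p)))).trans h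
      rwa [Nat.totient_prime hp'] at this
    have hp5 : p ≤ 5 := by omega
    have f120 : ∀ q k m : ℕ, q.Prime → 120 = q ^ k * m → ¬ q ∣ m → (120 : ℕ).factorization q = k := by
      intro q k m hq e hm
      have hm0 : m ≠ 0 := by rintro rfl; simp at hm
      rw [e, Nat.factorization_mul (pow_ne_zero _ hq.ne_zero) hm0, hq.factorization_pow]
      simp [Nat.factorization_eq_zero_of_not_dvd hm]
    have hbig : ∀ m, m ≤ n.factorization p → (p ^ m).totient ≤ 4 := fun m hm =>
      hp p m ((pow_dvd_pow p hm).trans (Nat.ordProj_dvd n p))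
    interval_cases p
    · exact absurd hp' (by norm_num)
    · exact absurd hp' (by norm_num)
    · rw [f120 2 3 15 (by norm_num) (by norm_num) (by norm_num)] at hlt
      exact absurd (hbig 4 hlt) (by decide +kernel)
    · rw [f120 3 1 40 (by norm_num) (by norm_num) (by norm_num)] at hlt
      exact absurd (hbig 2 hlt) (by decide +kernel)
    · exact absurd hp' (by norm_num)
    · rw [f120 5 1 24 (by norm_num) (by norm_num) (by norm_num)] at hlt
      exact absurd (hbig 2 hlt) (by decide +kernel)
  have hm : n ∈ Nat.divisors 120 := Nat.mem_divisors.mpr ⟨hd, by norm_num⟩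
  have key : ∀ m ∈ Nat.divisors 120, m.totient ≤ 4 → m ∈ ({1, 2, 3, 4, 5, 6, 8, 10, 12} : Finset ℕ) := by
    decide +kernel
  exact key n hm h

theorem phi1 (n : ℕ) (h0 : 0 < n) (h : n.totient ≤ 2) : n ∈ ({1, 2, 3, 4, 6} : Finset ℕ) := by
  have h1 := phi2 n h0 (by omega)
  have key : ∀ m ∈ ({1, 2, 3, 4, 5, 6, 8, 10, 12} : Finset ℕ), m.totient ≤ 2 →
    m ∈ ({1, 2, 3, 4, 6} : Finset ℕ) := by decide +kernel
  exact key n h1 h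

theorem adj {F D : Type*} [Field F] [DivisionRing D] [Algebra F D] [FiniteDimensional F D]
    (hn : ∃ x y : D, x * y ≠ y * x) (x : D) :
    Module.finrank F (Algebra.adjoin F {x}) * 2 ≤ Module.finrank F D := by
  letI : CommRing (Algebra.adjoin F {x}) := Algebra.adjoinCommRingOfComm F (by simp)
  letI : Field (Algebra.adjoin F {x}) := fieldOfFiniteDimensional F _
  have hfin : FiniteDimensional (Algebra.adjoin F {x}) D := FiniteDimensional.right F _ D
  have ht := Module.finrank_mul_finrank F (Algebra.adjoin F {x}) D
  rw [← ht]
  apply Nat.mul_le_mul_left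
  by_contra hlt
  have hpos : 0 < Module.finrank (Algebra.adjoin F {x}) D := Module.finrank_pos
  have h1 : Module.finrank (Algebra.adjoin F {x}) D = 1 := by omega
  have h2 := (finrank_eq_one_iff_of_nonzero' (1 : D) one_ne_zero).mp h1
  obtain ⟨u, v, huv⟩ := hn
  obtain ⟨p, hp⟩ := h2 u
  obtain ⟨q, hq⟩ := h2 v
  apply huv
  have hp' : (p : D) = u := by rw [← hp]; exact (mul_one (p : D)).symm
  have hq' : (q : D) = v := by rw [← hq]; exact (mul_one (q : D)).symm
  rw [← hp', ← hq']
  exact congrArg Subtype.val (mul_comm p q)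

theorem ordD {D : Type*} [DivisionRing D] [Algebra ℚ D] [FiniteDimensional ℚ D]
    (hD : Module.finrank ℚ D ≤ 8)
    (hn : ∃ x y : D, x * y ≠ y * x) (x : D) (h : 0 < orderOf x) :
    orderOf x ∈ ({1, 2, 3, 4, 5, 6, 8, 10, 12} : Finset ℕ) := by
  apply phi2 _ h
  have h1 := adj (F := ℚ) hn x
  letI : CommRing (Algebra.adjoin ℚ {x}) := Algebra.adjoinCommRingOfComm ℚ (by simp)
  letI : Field (Algebra.adjoin ℚ {x}) := fieldOfFiniteDimensional ℚ _
  let y : Algebra.adjoin ℚ {x} := ⟨x, Algebra.subset_adjoin rfl⟩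
  have ho : orderOf y = orderOf x :=
    (orderOf_injective ((Algebra.adjoin ℚ {x}).val : _ →* D) Subtype.val_injective y).symm
  have h2 := phi_le y (by rw [ho]; exact h)
  rw [ho] at h2
  omega

theorem quadD {F D : Type*} [Field F] [DivisionRing D] [Algebra F D] (h4 : Module.finrank F D = 4)
    (x y : D) (hxy : x * y ≠ y * x) : ∃ p q : F, x * x = p • x + q • (1 : D) := by
  have : FiniteDimensional F D := Module.finite_of_finrank_pos (by omega)
  have h1 := adj (F := F) ⟨x, y, hxy⟩ x
  obtain ⟨p, q, r, hne, e⟩ := dep3 (F := F) (V := Algebra.adjoin F {x}) (by omega) 1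
    ⟨x, Algebra.subset_adjoin rfl⟩ ⟨x * x, mul_mem (Algebra.subset_adjoin rfl) (Algebra.subset_adjoin rfl)⟩
  have e' : p • (1 : D) + q • x + r • (x * x) = 0 := congrArg Subtype.val e
  have hr : r ≠ 0 := by
    rintro rfl
    have hq : q = 0 := by
      by_contra hq
      apply hxy
      have : x = (-(q⁻¹ * p)) • (1 : D) := by
        have : q • x = (-p) • (1 : D) := by
          rw [zero_smul, add_zero] at e'
          rw [neg_smul]; exact eq_neg_of_add_eq_zero_right e'
        rw [neg_mul_eq_mul_neg, mul_smul, ← this, smul_smul, inv_mul_cancel₀ hq, one_smul]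
      rw [this]; simp
    subst hq
    simp at e'
    simp [e'] at hne
  refine ⟨-(r⁻¹ * q), -(r⁻¹ * p), ?_⟩
  have : r • (x * x) = (-q) • x + (-p) • 1 := by
    rw [neg_smul, neg_smul]
    have := eq_neg_of_add_eq_zero_right e'
    rw [this]; abel
  calc x * x = r⁻¹ • (r • (x * x)) := by rw [smul_smul, inv_mul_cancel₀ hr, one_smul]
    _ = _ := by rw [this]; module

theorem exists_ij {F D : Type*} [Field F] [CharZero F] [DivisionRing D] [Algebra F D]
    (h4 : Module.finrank F D = 4) (hn : ∃ x y : D, x * y ≠ y * x) :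
    ∃ (a c : F) (i j : D), a ≠ 0 ∧ c ≠ 0 ∧ i * i = a • (1 : D) ∧ j * j = c • (1 : D) ∧ j * i = - (i * j) := by
  have : CharZero D := charZero_of_injective_algebraMap (algebraMap F D).injective
  obtain ⟨x, y, hxy⟩ := hn
  obtain ⟨p, q, e⟩ := quadD h4 x y hxy
  set i : D := x - (p / 2) • 1 with hi
  have hii : i * i = (q + p ^ 2 / 4) • (1 : D) := by
    simp only [hi, mul_sub, sub_mul, e, smul_mul_assoc, mul_smul_comm, one_mul, mul_one]
    module
  generalize q + p ^ 2 / 4 = a at hii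
  have hiy : i * y ≠ y * i := by
    simp only [hi, mul_sub, sub_mul, smul_mul_assoc, mul_smul_comm, one_mul, mul_one]
    intro h; exact hxy (sub_left_inj.mp h)
  clear_value i
  have hi0 : i ≠ 0 := by intro h; rw [h] at hiy; simp at hiy
  have ha : a ≠ 0 := by
    rintro rfl
    rw [zero_smul] at hii
    exact hi0 (mul_self_eq_zero.mp hii)
  set w : D := i * y - y * i with hw
  have hw0 : w ≠ 0 := sub_ne_zero.mpr hiy
  have hwi : w * i = - (i * w) := by
    rw [hw, sub_mul, mul_sub, ← mul_assoc i i, hii, mul_assoc y i i, hii]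
    simp [mul_assoc]
  have hne : w * i ≠ i * w := by
    rw [hwi]; intro h
    exact mul_ne_zero hi0 hw0 (neg_eq_self.mp h)
  obtain ⟨s, c, e2⟩ := quadD h4 w i hne
  have hs : s = 0 := by
    have h1 : i * (w * w) = (w * w) * i := by
      rw [mul_assoc w, hwi, mul_neg, ← mul_assoc w, hwi]; noncomm_ring
    rw [e2] at h1
    simp only [mul_add, add_mul, smul_mul_assoc, mul_smul_comm, one_mul, mul_one, add_left_inj] at h1
    by_contra hs
    exact hne ((smul_right_injective D hs h1).symm)
  subst hs
  rw [zero_smul, zero_add] at e2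
  refine ⟨a, c, i, w, ha, ?_, hii, e2, hwi⟩
  rintro rfl
  rw [zero_smul] at e2
  exact hw0 (mul_self_eq_zero.mp e2)

theorem exists_equiv {F D : Type*} [Field F] [CharZero F] [DivisionRing D] [Algebra F D]
    (h4 : Module.finrank F D = 4) {a c : F} (i j : D) (ha : a ≠ 0) (hc : c ≠ 0)
    (hi : i * i = a • (1 : D)) (hj : j * j = c • (1 : D)) (hji : j * i = - (i * j)) :
    ∃ e : ℍ[F,a,0,c] ≃ₐ[F] D, e ⟨0, 1, 0, 0⟩ = i ∧ e ⟨0, 0, 1, 0⟩ = j := by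
  have : FiniteDimensional F D := Module.finite_of_finrank_pos (by omega)
  let B : QuaternionAlgebra.Basis D a 0 c :=
    { i := i, j := j, k := i * j, i_mul_i := by simp [hi], j_mul_j := hj, i_mul_j := rfl,
      j_mul_i := by simp [hji] }
  let φ := B.liftHom
  have hre : ∀ x, φ x = 0 → x.re = 0 := by
    intro x hx
    have h1 : φ (a • x + ⟨0, 1, 0, 0⟩ * x * ⟨0, 1, 0, 0⟩) = 0 := by simp [hx]
    set Y := a • x + ⟨0, 1, 0, 0⟩ * x * ⟨0, 1, 0, 0⟩ with hY
    have h2 : φ (c • Y + ⟨0, 0, 1, 0⟩ * Y * ⟨0, 0, 1, 0⟩) = 0 := by simp [h1]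
    have h3 : c • Y + ⟨0, 0, 1, 0⟩ * Y * ⟨0, 0, 1, 0⟩ = (4 * a * c * x.re) • (1 : ℍ[F,a,0,c]) := by
      ext <;> simp [hY] <;> ring
    rw [h3, map_smul, map_one] at h2
    have : 4 * a * c * x.re = 0 := by
      by_contra h; exact one_ne_zero (α := D) ((smul_eq_zero.mp h2).resolve_left h)
    simpa [ha, hc] using this
  have hinj : Function.Injective φ := by
    rw [injective_iff_map_eq_zero]
    intro x hx
    have h0 := hre x hx
    have h1 := hre (x * ⟨0, 1, 0, 0⟩) (by rw [map_mul, hx, zero_mul])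
    have h2 := hre (x * ⟨0, 0, 1, 0⟩) (by rw [map_mul, hx, zero_mul])
    have h3 := hre (x * ⟨0, 0, 0, 1⟩) (by rw [map_mul, hx, zero_mul])
    simp [ha, hc] at h1 h2 h3
    ext <;> simp [*]
  have hsurj : Function.Surjective φ := by
    have := LinearMap.injective_iff_surjective_of_finrank_eq_finrank (f := φ.toLinearMap)
      (by rw [h4, QuaternionAlgebra.finrank_eq_four])
    exact this.mp hinj
  refine ⟨AlgEquiv.ofBijective φ ⟨hinj, hsurj⟩, ?_, ?_⟩
  · change B.lift ⟨0, 1, 0, 0⟩ = i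
    simp [QuaternionAlgebra.Basis.lift, B]
  · change B.lift ⟨0, 0, 1, 0⟩ = j
    simp [QuaternionAlgebra.Basis.lift, B]

theorem mkHQ {F D : Type*} [Field F] [CharZero F] [DivisionRing D] [Algebra F D] [Algebra ℚ D] [Algebra ℚ F]
    [FiniteDimensional ℚ D] [FiniteDimensional ℚ F] (hD : Module.finrank ℚ D ≤ 8) (hF : Module.finrank ℚ F ≤ 2)
    (hn : ∃ x y : D, x * y ≠ y * x)
    {a c : F} (ha : a ≠ 0) (hc : c ≠ 0) (e : ℍ[F,a,0,c] ≃ₐ[F] D) : HQ F a c where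
  ha := ha
  hc := hc
  div := by
    intro x hx
    have h1 := mul_cnj x
    rw [hx, zero_smul] at h1
    have h2 : e x * e (cnj x) = 0 := by rw [← map_mul, h1, map_zero]
    rcases mul_eq_zero.mp h2 with h | h
    · exact (map_eq_zero_iff e e.injective).mp h
    · have := (map_eq_zero_iff e e.injective).mp h
      rw [QuaternionAlgebra.ext_iff] at this
      simp [cnj] at this
      ext <;> simp [this]
  sq := field_sq hF
  ordQ := by
    intro x n hn0 hx
    have : orderOf (e x) = orderOf x := orderOf_injective (e : _ →* D) e.injective x
    rw [← this]
    exact ordD hD hn _ (by rw [this]; exact orderOf_pos_iff.mpr (isOfFinOrder_iff_pow_eq_one.mpr ⟨n, hn0, hx⟩))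
  ordK := by
    intro x n hn0 hx
    have hpos : 0 < orderOf x := orderOf_pos_iff.mpr (isOfFinOrder_iff_pow_eq_one.mpr ⟨n, hn0, hx⟩)
    exact phi1 _ hpos ((phi_le x hpos).trans hF)

end QA

open scoped Quaternion

namespace QA
set_option linter.unusedSectionVars false

set_option linter.deprecated false in
theorem cyc_of {D : Type*} [DivisionRing D] {H : Type*} [Group H] [Finite H] (g : H →* D)
    (hg : Function.Injective g) (hc : ∀ x y : H, x * y = y * x) : IsCyclic H := by
  let hcm : CommRing (Subring.closure (Set.range g)) := Subring.closureCommRingOfComm (by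
    rintro _ ⟨x, rfl⟩ _ ⟨y, rfl⟩
    rw [← map_mul, hc, map_mul])
  let g' : H →* Subring.closure (Set.range g) :=
    { toFun := fun x => ⟨g x, Subring.subset_closure ⟨x, rfl⟩⟩
      map_one' := Subtype.ext (map_one g)
      map_mul' := fun x y => Subtype.ext (map_mul g x y) }
  have hg' : Function.Injective g' := fun x y h => hg (congrArg Subtype.val h)
  exact isCyclic_of_injective_ringHom (R := Subring.closure (Set.range g)) g' hg'

theorem eq_neg_one {D : Type*} [DivisionRing D] {G : Type} [Group G] (f : G →* D)
    (hf : Function.Injective f) (z : G) (hz : z * z = 1) (h1 : z ≠ 1) : f z = -1 := by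
  have h2 : f z * f z = 1 := by rw [← map_mul, hz, map_one]
  rcases mul_self_eq_one_iff.mp h2 with h | h
  · exact absurd (hf (by rw [h, map_one])) h1
  · exact h

theorem sl5_noncomm : ∃ A B : Matrix.SpecialLinearGroup (Fin 2) (ZMod 5), A * B ≠ B * A := by
  refine ⟨⟨!![1, 1; 0, 1], by simp⟩, ⟨!![1, 0; 1, 1], by simp⟩, fun h => ?_⟩
  have h1 := congrArg (fun M : Matrix.SpecialLinearGroup (Fin 2) (ZMod 5) =>
    (M : Matrix (Fin 2) (Fin 2) (ZMod 5)) 0 0) h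
  revert h1
  decide

theorem core {F D : Type} [Field F] [DivisionRing D] [Algebra F D] [Algebra ℚ D]
    [FiniteDimensional ℚ D] (hD : Module.finrank ℚ D ≤ 8)
    (h4 : Module.finrank F D = 4) (hn : ∃ x y : D, x * y ≠ y * x)
    (G : Type) [Group G] [Fintype G] (hG : Even (Fintype.card G))
    (f : G →* D) (hf : Function.Injective f) :
    (Nonempty (G ≃* Multiplicative (ZMod 2)) ∨
     Nonempty (G ≃* Multiplicative (ZMod 4)) ∨
     Nonempty (G ≃* Multiplicative (ZMod 6)) ∨
     Nonempty (G ≃* Multiplicative (ZMod 8)) ∨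
     Nonempty (G ≃* Multiplicative (ZMod 10)) ∨
     Nonempty (G ≃* Multiplicative (ZMod 12)) ∨
     Nonempty (G ≃* QuaternionGroup 2) ∨
     Nonempty (G ≃* QuaternionGroup 3) ∨
     Nonempty (G ≃* QuaternionGroup 4) ∨
     Nonempty (G ≃* QuaternionGroup 5) ∨
     Nonempty (G ≃* QuaternionGroup 6) ∨
     Nonempty (G ≃* Matrix.SpecialLinearGroup (Fin 2) (ZMod 3)) ∨
     IsBinaryOctahedralGroup G ∨
     Nonempty (G ≃* Matrix.SpecialLinearGroup (Fin 2) (ZMod 5))) ∧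
    (IsBinaryOctahedralGroup G → ∃ x : F, x ^ 2 = 2) ∧
    (Nonempty (G ≃* Matrix.SpecialLinearGroup (Fin 2) (ZMod 5)) → ∃ x : F, x ^ 2 = 5) := by
  have : CharZero D := algebraRat.charZero D
  have : CharZero F := (algebraMap F D).charZero
  have : IsScalarTower ℚ F D := inferInstance
  have : FiniteDimensional ℚ F := FiniteDimensional.left ℚ F D
  have : FiniteDimensional F D := Module.finite_of_finrank_pos (by omega)
  have hF : Module.finrank ℚ F ≤ 2 := by
    have hmul := Module.finrank_mul_finrank ℚ F D
    rw [h4] at hmul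
    omega
  have cyc : ∀ H : Subgroup G, (∀ x ∈ H, ∀ y ∈ H, x * y = y * x) → IsCyclic H := by
    intro H hH
    refine cyc_of (f.comp H.subtype) (hf.comp Subtype.val_injective) ?_
    rintro ⟨x, hx⟩ ⟨y, hy⟩
    exact Subtype.ext (hH x hx y hy)
  obtain ⟨a, c, i, j, ha, hc, hi, hj, hji⟩ := exists_ij h4 hn
  obtain ⟨e, -, -⟩ := exists_equiv h4 i j ha hc hi hj hji
  have hq := mkHQ hD hF hn ha hc e
  let φ : G →* ℍ[F,a,0,c] := (e.symm : D →* ℍ[F,a,0,c]).comp f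
  have hφ : Function.Injective φ := e.symm.injective.comp hf
  refine ⟨?_, ?_, ?_⟩
  · by_cases hab : ∃ x y : G, x * y ≠ y * x
    swap
    · push Not at hab
      have hcyc : IsCyclic G := cyc_of f hf hab
      obtain ⟨g, hg⟩ := IsCyclic.exists_ofOrder_eq_natCard (α := G)
      have ho : orderOf (f g) = orderOf g := orderOf_injective f hf g
      have h1 := ordD hD hn (f g) (by rw [ho]; exact orderOf_pos g)
      rw [ho, hg] at h1
      have iso : ∀ n : ℕ, Nat.card G = n → Nonempty (G ≃* Multiplicative (ZMod n)) := by
        rintro n rfl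
        exact ⟨(zmodCyclicMulEquiv hcyc).symm⟩
      rw [← Nat.card_eq_fintype_card] at hG
      simp only [Finset.mem_insert, Finset.mem_singleton] at h1
      rcases h1 with h | h | h | h | h | h | h | h | h
      · rw [h] at hG; exact absurd hG (by decide)
      · exact Or.inl (iso _ h)
      · rw [h] at hG; exact absurd hG (by decide)
      · exact Or.inr (Or.inl (iso _ h))
      · rw [h] at hG; exact absurd hG (by decide)
      · exact Or.inr (Or.inr (Or.inl (iso _ h)))
      · exact Or.inr (Or.inr (Or.inr (Or.inl (iso _ h))))
      · exact Or.inr (Or.inr (Or.inr (Or.inr (Or.inl (iso _ h)))))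
      · exact Or.inr (Or.inr (Or.inr (Or.inr (Or.inr (Or.inl (iso _ h))))))
    iterate 6 right
    obtain ⟨z, hz⟩ := exists_prime_orderOf_dvd_card (G := G) 2 hG.two_dvd
    have hz1 : z ≠ 1 := by rintro rfl; simp at hz
    have hz2 : z * z = 1 := by rw [← pow_two, ← hz, pow_orderOf_eq_one]
    have hfz : f z = -1 := eq_neg_one f hf z hz2 hz1
    have hφz : φ z = -1 := by simp [φ, hfz]
    have hb := hq.bp φ hφ hab z hφz cyc
    by_cases hI : CaseI G z
    · obtain ⟨k, hk, hiso⟩ := hb.dicyclic hab hI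
      simp only [Finset.mem_insert, Finset.mem_singleton] at hk
      rcases hk with rfl | rfl | rfl | rfl | rfl <;> tauto
    iterate 5 right
    have hcl := hb.classify hab (fun x y hx => (hq.no58 φ hφ hab x y hx).1)
      (fun x y hx => (hq.no58 φ hφ hab x y hx).2) hI
    rcases hcl with ⟨hcard, h8, h12⟩ | ⟨hcard, hS⟩
    · have hd : 8 ∣ Nat.card G := by
        rcases hcard with h | h
        · rw [h.1]; norm_num
        · rw [h]; norm_num
      obtain ⟨x, y, hx, hy, hxy⟩ := hb.exists_Q8 h8 hd
      have fx : f x * f x = (-1 : F) • (1 : D) := by rw [← map_mul, hx, hfz]; simp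
      have fy : f y * f y = (-1 : F) • (1 : D) := by rw [← map_mul, hy, hfz]; simp
      have fxy : f y * f x = - (f x * f y) := by
        have h1 : f x * f y * (f x * f y) = -1 := by rw [← map_mul, ← map_mul, hxy, hfz]
        rw [neg_one_smul] at fx fy
        calc f y * f x = (f x * f x) * (f y * f x) * (f y * f y) := by rw [fx, fy]; simp
          _ = f x * (f x * f y * (f x * f y)) * f y := by noncomm_ring
          _ = _ := by rw [h1]; simp
      have h1 : (-1 : F) ≠ 0 := by simp
      obtain ⟨e', he1, he2⟩ := exists_equiv h4 (f x) (f y) h1 h1 fx fy fxy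
      have hq' := mkHQ hD hF hn h1 h1 e'
      let ψ : G →* ℍ[F,-1,0,-1] := (e'.symm : D →* ℍ[F,-1,0,-1]).comp f
      have hψ : Function.Injective ψ := e'.symm.injective.comp hf
      have hx' : ψ x = ⟨0, 1, 0, 0⟩ := by
        change e'.symm (f x) = _
        rw [← he1, AlgEquiv.symm_apply_apply]
      have hy' : ψ y = ⟨0, 0, 1, 0⟩ := by
        change e'.symm (f y) = _
        rw [← he2, AlgEquiv.symm_apply_apply]
      rcases hcard with h | h
      · exact Or.inl (hq'.iso3 ψ hψ hab hb hI h8 h12 h.1 x y hx' hy')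
      · exact Or.inr (Or.inr (hq'.iso5 ψ hψ hab hb hI h8 h12 h x y hx' hy'))
    · right; left
      refine ⟨by rw [← Nat.card_eq_fintype_card, hcard], z, ⟨hz, hS⟩, ?_⟩
      rintro w ⟨hw, -⟩
      apply hf
      rw [hfz]
      exact eq_neg_one f hf w (by rw [← pow_two, ← hw, pow_orderOf_eq_one])
        (by rintro rfl; simp at hw)
  · rintro ⟨-, z, ⟨hz, ⟨π⟩⟩, -⟩
    have hz1 : z ≠ 1 := by rintro rfl; simp at hz
    have hz2 : z * z = 1 := by rw [← pow_two, ← hz, pow_orderOf_eq_one]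
    have hfz : f z = -1 := eq_neg_one f hf z hz2 hz1
    have inv : ∀ w : G, w * w = 1 → w = 1 ∨ w = z := by
      intro w hw
      by_cases h1 : w = 1
      · exact Or.inl h1
      · exact Or.inr (hf (by rw [hfz, eq_neg_one f hf w hw h1]))
    have cen : ∀ g : G, g * z = z * g := by
      intro g; apply hf; rw [map_mul, map_mul, hfz]; simp
    have hker : ∀ k ∈ Subgroup.normalClosure ({z} : Set G), k * k = 1 := by
      have hN : (Subgroup.zpowers z).Normal := by
        constructor
        intro n hn g
        obtain ⟨m, rfl⟩ := Subgroup.mem_zpowers_iff.mp hn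
        have : Commute g (z ^ m) := (show Commute g z from cen g).zpow_right m
        rw [this.eq, mul_inv_cancel_right]
        exact hn
      intro k hk
      have := Subgroup.normalClosure_le_normal (N := Subgroup.zpowers z)
        (Set.singleton_subset_iff.mpr (Subgroup.mem_zpowers z)) hk
      obtain ⟨m, rfl⟩ := Subgroup.mem_zpowers_iff.mp this
      rw [← (Commute.refl z).mul_zpow, hz2, one_zpow]
    let ρ : G →* Equiv.Perm (Fin 4) := (π.toMonoidHom).comp (QuotientGroup.mk' _)
    have hρs : Function.Surjective ρ := π.surjective.comp (QuotientGroup.mk'_surjective _)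
    have hρ : ∀ g, ρ g = 1 → g * g = 1 := by
      intro g hg
      apply hker
      have : π (QuotientGroup.mk' _ g) = 1 := hg
      rw [map_eq_one_iff π π.injective] at this
      exact (QuotientGroup.eq_one_iff g).mp this
    have hρz : ρ z = 1 := by
      have : (QuotientGroup.mk' (Subgroup.normalClosure ({z} : Set G))) z = 1 :=
        (QuotientGroup.eq_one_iff z).mpr (Subgroup.subset_normalClosure rfl)
      change π _ = 1
      rw [this, map_one]
    have hab : ∃ x y : G, x * y ≠ y * x := by
      obtain ⟨x, hx⟩ := hρs (Equiv.swap 0 1)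
      obtain ⟨y, hy⟩ := hρs (Equiv.swap 1 2)
      refine ⟨x, y, fun h => ?_⟩
      have := congrArg ρ h
      rw [map_mul, map_mul, hx, hy] at this
      revert this; decide
    obtain ⟨g, hg⟩ := hρs (finRotate 4)
    have h8 : g ^ 2 ^ 3 = 1 := by
      have : g ^ 2 ^ 3 = g ^ 4 * g ^ 4 := by rw [← pow_add]; norm_num
      rw [this]
      apply hρ
      rw [map_pow, hg]; decide
    have h4' : ¬ g ^ 2 ^ 2 = 1 := by
      intro h
      have h2 : ρ (g ^ 2) = 1 := by
        rcases inv (g ^ 2) (by rw [← pow_add]; exact h) with h | h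
        · rw [h, map_one]
        · rw [h, hρz]
      rw [map_pow, hg] at h2
      revert h2; decide
    have ho : orderOf g = 8 := orderOf_eq_prime_pow h4' h8
    refine ⟨tr (φ g), ?_⟩
    rcases hq.tr_types φ hφ hab g with e | e | e | e | e | e | e | e | e <;> first | exact e.2 | (exfalso; omega)
  · rintro ⟨π⟩
    have hcard : Nat.card G = 120 := by rw [Nat.card_congr π.toEquiv, cardSL5]
    have hab : ∃ x y : G, x * y ≠ y * x := by
      obtain ⟨A, B, hAB⟩ := sl5_noncomm
      refine ⟨π.symm A, π.symm B, fun h => hAB ?_⟩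
      rw [← map_mul, ← map_mul] at h
      exact π.symm.injective h
    obtain ⟨g, hg⟩ := exists_prime_orderOf_dvd_card' (G := G) 5 (by rw [hcard]; norm_num)
    have ht : tr (φ g) ^ 2 + tr (φ g) = 1 := by
      rcases hq.tr_types φ hφ hab g with e | e | e | e | e | e | e | e | e <;> first | exact e.2 | (exfalso; omega)
    exact ⟨2 * tr (φ g) + 1, by linear_combination 4 * ht⟩

end QA

theorem finite_subgroups_of_quaternion_division_algebra
    (D : Type) [DivisionRing D] [Algebra ℚ D] [FiniteDimensional ℚ D]
    (hD : Module.finrank ℚ D ≤ 8)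
    (hK : Module.finrank (Subalgebra.center ℚ D) D = 4)
    (G : Type) [Group G] [Fintype G] (hG : Even (Fintype.card G))
    (f : G →* Dˣ) (hf : Function.Injective f) :
    (Nonempty (G ≃* Multiplicative (ZMod 2)) ∨
     Nonempty (G ≃* Multiplicative (ZMod 4)) ∨
     Nonempty (G ≃* Multiplicative (ZMod 6)) ∨
     Nonempty (G ≃* Multiplicative (ZMod 8)) ∨
     Nonempty (G ≃* Multiplicative (ZMod 10)) ∨
     Nonempty (G ≃* Multiplicative (ZMod 12)) ∨
     Nonempty (G ≃* QuaternionGroup 2) ∨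
     Nonempty (G ≃* QuaternionGroup 3) ∨
     Nonempty (G ≃* QuaternionGroup 4) ∨
     Nonempty (G ≃* QuaternionGroup 5) ∨
     Nonempty (G ≃* QuaternionGroup 6) ∨
     Nonempty (G ≃* Matrix.SpecialLinearGroup (Fin 2) (ZMod 3)) ∨
     IsBinaryOctahedralGroup G ∨
     Nonempty (G ≃* Matrix.SpecialLinearGroup (Fin 2) (ZMod 5))) ∧
    (IsBinaryOctahedralGroup G → ∃ x ∈ Subalgebra.center ℚ D, x ^ 2 = 2) ∧
    (Nonempty (G ≃* Matrix.SpecialLinearGroup (Fin 2) (ZMod 5)) →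
      ∃ x ∈ Subalgebra.center ℚ D, x ^ 2 = 5) := by
  let fF : Field (Subalgebra.center ℚ D) := fieldOfFiniteDimensional ℚ (Subalgebra.center ℚ D)
  have hK' : Module.finrank (Subalgebra.center ℚ D) D = 4 := hK
  have hn : ∃ x y : D, x * y ≠ y * x := by
    by_contra hc
    push Not at hc
    have : Module.finrank (Subalgebra.center ℚ D) D ≤ 1 := by
      apply finrank_le_one (1 : D)
      intro w
      exact ⟨⟨w, Subalgebra.mem_center_iff.mpr fun b => hc b w⟩, mul_one w⟩
    omega
  have hinj : Function.Injective ((Units.coeHom D).comp f) := Units.val_injective.comp hf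
  let alg : Algebra (Subalgebra.center ℚ D) D := Algebra.ofModule
    (fun r x y => mul_assoc (r : D) x y) (fun r x y => by
      change x * ((r : D) * y) = (r : D) * (x * y)
      rw [← mul_assoc, Subalgebra.mem_center_iff.mp r.2 x, mul_assoc])
  have key := QA.core (F := Subalgebra.center ℚ D) (D := D) hD hK' hn G hG _ hinj
  refine ⟨key.1, fun h => ?_, fun h => ?_⟩
  · obtain ⟨x, hx⟩ := key.2.1 h
    exact ⟨x, x.2, by have := congrArg Subtype.val hx; exact this⟩
  · obtain ⟨x, hx⟩ := key.2.2 h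
    exact ⟨x, x.2, by have := congrArg Subtype.val hx; exact this⟩
end

section
/- Let D be a division ring that is a finite-dimensional ℚ-algebra with dim_ℚ D ≤ 8, and let K be the center of D; assume dim_K D = 4 (so D is a quaternion division algebra over K). If there exists an injective group homomorphism from the binary octahedral group 2O into the unit group Dˣ, then there exists x in K with x² = 2. -/
/-- In a ring of rank four over its center, if `b` inverts `u ≠ u⁻¹` by conjugation,
then `u + u⁻¹` is central. -/
theorem quat_trace_central (D : Type) [DivisionRing D] [Algebra ℚ D] [FiniteDimensional ℚ D]
    (hK : Module.finrank (Subalgebra.center ℚ D) D = 4)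
    (u v b : D) (huv : u * v = 1) (hvu : v * u = 1) (hb : b ≠ 0)
    (hbu : b * u = v * b) (hne : u ≠ v) :
    u + v ∈ Subalgebra.center ℚ D := by
  have hfin : Module.Finite (Subalgebra.center ℚ D) D :=
    Module.Finite.of_restrictScalars_finite ℚ _ D
  have hli : ¬ LinearIndependent (Subalgebra.center ℚ D) ![1, u, u ^ 2, b, b * u] := by
    intro h
    have := h.fintype_card_le_finrank
    rw [hK] at this
    simp at this
  rw [Fintype.not_linearIndependent_iff] at hli
  obtain ⟨g, hg, i, hi⟩ := hli
  have hc : ∀ i x, (g i : D) * x = x * (g i : D) := fun i x =>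
    ((Subalgebra.mem_center_iff.mp (g i).2) x).symm
  simp only [Fin.sum_univ_five, Subalgebra.smul_def, smul_eq_mul] at hg
  simp at hg
  have hbv : b * v = u * b := by
    calc b * v = (u * v) * b * v := by rw [huv, one_mul]
      _ = u * (v * b) * v := by noncomm_ring
      _ = u * b * (u * v) := by rw [← hbu]; noncomm_ring
      _ = u * b := by rw [huv, mul_one]
  have hnc : u * b - b * u ≠ 0 := by
    intro h
    rw [hbu, ← sub_mul] at h
    rcases mul_eq_zero.mp h with h | h
    · exact hne (sub_eq_zero.mp h)
    · exact hb h
  have hucen : ∀ p q : D, (∀ x, p * x = x * p) → (∀ x, q * x = x * q) → p + q * u = 0 →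
      q = 0 := by
    intro p q hp hq h
    have h1 : q * (u * b - b * u) = (p + q * u) * b - b * (p + q * u) := by
      rw [add_mul, mul_add, hp b, mul_sub, mul_assoc, ← mul_assoc b q, ← hq b, mul_assoc]
      abel
    rw [h] at h1
    simp only [zero_mul, mul_zero, sub_zero] at h1
    exact (mul_eq_zero.mp h1).resolve_right hnc
  generalize hp0 : (g 0 : D) = p0 at *
  generalize hp1 : (g 1 : D) = p1 at *
  generalize hp2 : (g 2 : D) = p2 at *
  generalize hr0 : (g 3 : D) = r0 at *
  generalize hr1 : (g 4 : D) = r1 at *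
  have c0 := hc 0
  have c1 := hc 1
  have c2 := hc 2
  have c3 := hc 3
  have c4 := hc 4
  rw [hp0] at c0
  rw [hp1] at c1
  rw [hp2] at c2
  rw [hr0] at c3
  rw [hr1] at c4
  have hR : r0 + r1 * u = 0 := by
    have hRu : Commute u (r0 + r1 * u) :=
      Commute.add_right (c3 u).symm (Commute.mul_right (c4 u).symm rfl)
    have hPu : Commute u (p0 + p1 * u + p2 * u ^ 2) :=
      Commute.add_right (Commute.add_right (c0 u).symm (Commute.mul_right (c1 u).symm rfl))
        (Commute.mul_right (c2 u).symm ((Commute.refl u).pow_right 2))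
    have hbR : b * (r0 + r1 * u) = -(p0 + p1 * u + p2 * u ^ 2) := by
      rw [eq_neg_iff_add_eq_zero, ← hg, mul_add, c3 b, ← mul_assoc r1, c4 b, mul_assoc]
      abel
    have h1 : (u * b - b * u) * (r0 + r1 * u) = 0 := by
      rw [sub_mul, mul_assoc, mul_assoc, hRu.eq, ← mul_assoc b, hbR, mul_neg, neg_mul, hPu.eq,
        sub_self]
    exact (mul_eq_zero.mp h1).resolve_left hnc
  have hr1' : r1 = 0 := hucen r0 r1 c3 c4 hR
  have hr0' : r0 = 0 := by simpa [hr1'] using hR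
  have hP : p0 + p1 * u + p2 * u ^ 2 = 0 := by simpa [hr1', hr0'] using hg
  have hp2' : p2 ≠ 0 := by
    intro h
    have h0 : p0 + p1 * u = 0 := by simpa [h] using hP
    have h1 := hucen p0 p1 c0 c1 h0
    have h2 : p0 = 0 := by simpa [h1] using h0
    apply hi
    apply Subtype.ext
    fin_cases i
    · exact hp0.trans h2
    · exact hp1.trans h1
    · exact hp2.trans h
    · exact hr0.trans hr0'
    · exact hr1.trans hr1'
  have hP' : p0 + p1 * v + p2 * v ^ 2 = 0 := by
    have h1 : (p0 + p1 * v + p2 * v ^ 2) * b = b * (p0 + p1 * u + p2 * u ^ 2) := by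
      have e2 : v ^ 2 * b = b * u ^ 2 := by
        rw [pow_two, pow_two, mul_assoc, ← hbu, ← mul_assoc, ← hbu, mul_assoc]
      rw [add_mul, add_mul, mul_add, mul_add, mul_assoc, mul_assoc, e2, ← hbu, c0 b,
        ← mul_assoc, ← mul_assoc, ← mul_assoc, ← mul_assoc, c1 b, c2 b]
    rw [hP, mul_zero] at h1
    exact (mul_eq_zero.mp h1).resolve_right hb
  have hS : p1 + p2 * (u + v) = 0 := by
    have h1 : (p1 + p2 * (u + v)) * (u - v) =
        (p0 + p1 * u + p2 * u ^ 2) - (p0 + p1 * v + p2 * v ^ 2) := by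
      have : (u + v) * (u - v) = u ^ 2 - v ^ 2 := by
        rw [add_mul, mul_sub, mul_sub, huv, hvu, pow_two, pow_two]; abel
      rw [add_mul, mul_assoc, this, mul_sub, mul_sub]; abel
    rw [hP, hP', sub_zero] at h1
    exact (mul_eq_zero.mp h1).resolve_right (sub_ne_zero.mpr hne)
  rw [Subalgebra.mem_center_iff]
  intro x
  apply mul_left_cancel₀ hp2'
  have hS' : p2 * (u + v) = -p1 := by
    rw [eq_neg_iff_add_eq_zero, add_comm]; exact hS
  rw [← mul_assoc, ← mul_assoc, hS', c2 x, mul_assoc, hS', neg_mul, c1 x, mul_neg]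

theorem sqrt_two_in_center_of_binary_octahedral_embedding
    (D : Type) [DivisionRing D] [Algebra ℚ D] [FiniteDimensional ℚ D]
    (hD : Module.finrank ℚ D ≤ 8)
    (hK : Module.finrank (Subalgebra.center ℚ D) D = 4)
    (G : Type) [Group G] [Fintype G] (hG : IsBinaryOctahedralGroup G)
    (f : G →* Dˣ) (hf : Function.Injective f) :
    ∃ x ∈ Subalgebra.center ℚ D, x ^ 2 = 2 := by
  obtain ⟨-, z, ⟨hz, ⟨e⟩⟩, -⟩ := hG
  have hfz : f z = -1 := by
    have h1 : z ^ 2 = 1 := by rw [← hz]; exact pow_orderOf_eq_one z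
    have h2 : z ≠ 1 := by rintro rfl; simp at hz
    have h3 : ((f z : Dˣ) : D) ^ 2 = 1 := by
      rw [← Units.val_pow_eq_pow_val, ← map_pow, h1, map_one, Units.val_one]
    rcases mul_self_eq_one_iff.mp ((pow_two _).symm.trans h3) with h | h
    · exact absurd (hf ((Units.ext h).trans (map_one f).symm)) h2
    · exact Units.ext (by simpa using h)
  let q : G →* Equiv.Perm (Fin 4) :=
    e.toMonoidHom.comp (QuotientGroup.mk' (Subgroup.normalClosure ({z} : Set G)))
  have hqs : Function.Surjective q :=
    e.surjective.comp (QuotientGroup.mk'_surjective _)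
  have hq1 : ∀ g, q g = 1 ↔ g ∈ Subgroup.normalClosure ({z} : Set G) := by
    intro g
    simp [q]
  have hzc : ∀ g, g * z = z * g := by
    intro g
    apply hf
    simp [hfz]
  have hA : ∀ g, q g = 1 → f g = 1 ∨ f g = -1 := by
    intro g hg
    rw [hq1] at hg
    let N : Subgroup G :=
      { carrier := {g | f g = 1 ∨ f g = -1}
        one_mem' := by simp
        mul_mem' := by
          rintro a b (ha | ha) (hb | hb) <;> simp [ha, hb]
        inv_mem' := by
          rintro a (ha | ha) <;> simp [ha] }
    have hN : N.Normal := ⟨by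
      rintro a (ha | ha) g
      · left; simp [ha]
      · right; simp [ha]⟩
    have : Subgroup.normalClosure ({z} : Set G) ≤ N :=
      Subgroup.normalClosure_le_normal (by
        rintro _ rfl
        exact Or.inr hfz)
    exact this hg
  have hB : ∀ g, (f g) ^ 2 = 1 → q g = 1 := by
    intro g hg
    have h3 : ((f g : Dˣ) : D) ^ 2 = 1 := by
      rw [← Units.val_pow_eq_pow_val, hg, Units.val_one]
    rcases mul_self_eq_one_iff.mp ((pow_two _).symm.trans h3) with h | h
    · have : g = 1 := hf ((Units.ext h).trans (map_one f).symm)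
      rw [this, map_one]
    · have : g = z := hf ((Units.ext (by simpa using h)).trans hfz.symm)
      rw [this, hq1]
      exact Subgroup.subset_normalClosure rfl
  obtain ⟨a, ha⟩ := hqs (finRotate 4)
  obtain ⟨b, hb⟩ := hqs (Equiv.swap 0 2)
  have hne1 : (1 : Dˣ) ≠ -1 := by
    have : CharZero D := algebraRat.charZero D
    intro h
    have := congrArg Units.val h
    simp at this
    exact absurd this.symm (by norm_num)
  have ha4 : f a ^ 4 = -1 := by
    rcases hA (a ^ 4) (by rw [map_pow, ha]; decide) with h | h
    · exfalso
      have := hB (a ^ 2) (by rw [map_pow, ← pow_mul]; rwa [map_pow] at h)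
      rw [map_pow, ha] at this
      revert this; decide
    · rwa [map_pow] at h
  have hb2 : f b ^ 2 = -1 := by
    rcases hA (b ^ 2) (by rw [map_pow, hb]; decide) with h | h
    · exfalso
      have := hB b (by rwa [map_pow] at h)
      rw [hb] at this
      revert this; decide
    · rwa [map_pow] at h
  have hconj : f b * f a = (f a)⁻¹ * f b := by
    rcases hA (b * a * b⁻¹ * a) (by simp only [map_mul, map_inv, ha, hb]; decide) with h | h
    · simp only [map_mul, map_inv] at h
      rw [← eq_inv_iff_mul_eq_one] at h
      rw [← h]; group
    · exfalso
      simp only [map_mul, map_inv] at h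
      have := hB (b * a) (by
        rw [map_mul]
        have hbi : f b = (f b)⁻¹ * -1 := by rw [← hb2]; group
        calc (f b * f a) ^ 2 = f b * f a * f b * f a := by rw [pow_two]; group
          _ = f b * f a * ((f b)⁻¹ * -1) * f a := by rw [← hbi]
          _ = - (f b * f a * (f b)⁻¹ * f a) := by simp
          _ = 1 := by rw [h]; simp)
      rw [map_mul, ha, hb] at this
      revert this; decide
  have hu4 : ((f a : Dˣ) : D) ^ 4 = -1 := by
    rw [← Units.val_pow_eq_pow_val, ha4]; simp
  have huv : ((f a : Dˣ) : D) * (((f a)⁻¹ : Dˣ) : D) = 1 := by simp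
  have hvu : (((f a)⁻¹ : Dˣ) : D) * ((f a : Dˣ) : D) = 1 := by simp
  have hne : f a ≠ (f a)⁻¹ := by
    intro h
    have h2 : f a ^ 2 = 1 := by
      rw [pow_two]; nth_rewrite 2 [h]; simp
    apply hne1
    rw [← ha4, show 4 = 2 * 2 from rfl, pow_mul, h2, one_pow]
  refine ⟨(f a : D) + (((f a)⁻¹ : Dˣ) : D),
    quat_trace_central D hK _ _ (f b : D) huv hvu (f b).ne_zero ?_ ?_, ?_⟩
  · rw [← Units.val_mul, hconj, Units.val_mul]
  · exact fun h => hne (Units.ext h)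
  · have h2 : (f a)⁻¹ ^ 2 = - (f a ^ 2) := by
      have : (f a)⁻¹ ^ 2 = (f a ^ 4)⁻¹ * f a ^ 2 := by group
      rw [this, ha4]; simp
    have h2' := congrArg Units.val h2
    simp only [Units.val_neg, Units.val_pow_eq_pow_val] at h2'
    rw [pow_two, add_mul, mul_add, mul_add, huv, hvu, ← pow_two, ← pow_two, h2']
    rw [← one_add_one_eq_two (R := D)]; generalize (f a : D) ^ 2 = w; generalize (1 : D) = o; abel
end

section
/- Let D be a division ring that is a finite-dimensional ℚ-algebra with dim_ℚ D ≤ 8, and let K be the center of D; assume dim_K D = 4 (so D is a quaternion division algebra over K). If there exists an injective group homomorphism from SL(2, 𝔽₅) into the unit group Dˣ, then there exists x in K with x² = 5. -/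
open Polynomial

theorem quad_aux (K D : Type) [Field K] [DivisionRing D] [Algebra K D]
    (hK : Module.finrank K D = 4) (hc : ¬ ∀ x y : D, x * y = y * x) (u : D)
    (hu : ∀ k : K, algebraMap K D k ≠ u) :
    ∃ a b : K, u ^ 2 = algebraMap K D a * u + algebraMap K D b := by
  have hfd : FiniteDimensional K D := Module.finite_of_finrank_pos (by omega)
  have hint : IsIntegral K u := Algebra.IsIntegral.isIntegral u
  have hirr := minpoly.irreducible hint
  have hmon := minpoly.monic hint
  have : Fact (Irreducible (minpoly K u)) := ⟨hirr⟩
  let φ : AdjoinRoot (minpoly K u) →ₐ[K] D :=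
    Ideal.Quotient.liftₐ _ (aeval u) (by
      intro p hp
      obtain ⟨q, rfl⟩ := Ideal.mem_span_singleton.1 hp
      simp [minpoly.aeval])
  have hF : Module.finrank K (AdjoinRoot (minpoly K u)) = (minpoly K u).natDegree := by
    rw [(AdjoinRoot.powerBasis hirr.ne_zero).finrank, AdjoinRoot.powerBasis_dim]
  let _ : Module (AdjoinRoot (minpoly K u)) D := Module.compHom D (φ : AdjoinRoot (minpoly K u) →+* D)
  have : IsScalarTower K (AdjoinRoot (minpoly K u)) D := ⟨by
    intro x y z
    change φ (x • y) * z = x • (φ y * z)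
    rw [map_smul, smul_mul_assoc]⟩
  have hmul := Module.finrank_mul_finrank K (AdjoinRoot (minpoly K u)) D
  rw [hF, hK] at hmul
  have h4 : (minpoly K u).natDegree ≠ 4 := by
    intro h
    apply hc
    have hs : Function.Surjective φ := by
      have hfF : FiniteDimensional K (AdjoinRoot (minpoly K u)) := Module.finite_of_finrank_pos (by omega)
      have := (LinearMap.injective_iff_surjective_of_finrank_eq_finrank (f := φ.toLinearMap) (by omega)).1 φ.toRingHom.injective
      exact this
    intro x y
    obtain ⟨x, rfl⟩ := hs x
    obtain ⟨y, rfl⟩ := hs y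
    rw [← map_mul, mul_comm, map_mul]
  have h1 : (minpoly K u).natDegree ≠ 1 := by
    intro h
    obtain ⟨k, hk⟩ := minpoly.natDegree_eq_one_iff.1 h
    exact hu k hk
  have h2 : (minpoly K u).natDegree = 2 := by
    have : (minpoly K u).natDegree ≤ 4 := Nat.le_of_dvd (by norm_num) ⟨_, hmul.symm⟩
    interval_cases (minpoly K u).natDegree <;> omega
  have hz := minpoly.aeval K u
  rw [aeval_eq_sum_range, h2] at hz
  have hl : (minpoly K u).coeff 2 = 1 := by rw [← h2]; exact hmon
  simp [Finset.sum_range_succ, hl, Algebra.smul_def] at hz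
  refine ⟨-(minpoly K u).coeff 1, -(minpoly K u).coeff 0, ?_⟩
  simp only [map_neg]
  rw [neg_mul, ← neg_add, eq_neg_iff_add_eq_zero, ← hz]
  abel

theorem no_root (K : Type) [Field K] [Algebra ℚ K] [FiniteDimensional ℚ K]
    (h : Module.finrank ℚ K ≤ 2) (c : K) (hc : c^4+c^3+c^2+c+1 = 0) : False := by
  have h1 : minpoly ℚ c = cyclotomic 5 ℚ := by
    symm
    apply minpoly.eq_of_irreducible_of_monic (cyclotomic.irreducible_rat (by norm_num)) _ (cyclotomic.monic _ _)
    have : Fact (Nat.Prime 5) := ⟨by norm_num⟩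
    rw [cyclotomic_prime]
    simp [Finset.sum_range_succ]
    linear_combination hc
  have h2 := minpoly.natDegree_le (A := ℚ) c
  rw [h1, natDegree_cyclotomic] at h2
  have : Nat.totient 5 = 4 := by decide
  omega

theorem main_aux (K D : Type) [Field K] [DivisionRing D] [Algebra ℚ K] [Algebra K D] [FiniteDimensional ℚ K]
    (h : Module.finrank ℚ K ≤ 2) 
    (hK : Module.finrank K D = 4) (hc : ¬ ∀ x y : D, x * y = y * x) (u : D)
    (hu1 : u ≠ 1) (hu5 : u ^ 5 = 1) : ∃ x : K, x ^ 2 = 5 := by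
  have hu : u^4+u^3+u^2+u+1 = 0 := by
    have : (u - 1) * (u^4+u^3+u^2+u+1) = 0 := by
      have : (u - 1) * (u^4+u^3+u^2+u+1) = u^5 - 1 := by noncomm_ring
      rw [this, hu5, sub_self]
    exact (mul_eq_zero.1 this).resolve_left (sub_ne_zero.2 hu1)
  have hnk : ∀ k : K, algebraMap K D k ≠ u := by
    rintro k rfl
    apply no_root K h k
    apply (algebraMap K D).injective
    simpa using hu
  obtain ⟨a, b, hab⟩ := quad_aux K D hK hc u hnk
  have e3 : u ^ 3 = algebraMap K D (a^2+b) * u + algebraMap K D (a*b) := by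
    rw [pow_succ, hab, add_mul, mul_assoc, ← pow_two, hab]
    simp only [map_add, map_mul, map_pow]
    noncomm_ring
  have e4 : u ^ 4 = algebraMap K D (a^3+2*a*b) * u + algebraMap K D (a^2*b+b^2) := by
    have : u ^ 4 = algebraMap K D ((a^2+b)*a) * u + algebraMap K D ((a^2+b)*b) + algebraMap K D (a*b) * u := by
      rw [pow_succ, e3, add_mul, mul_assoc, ← pow_two, hab]
      simp only [map_mul, mul_add, mul_assoc]
    rw [this, add_right_comm, ← add_mul, ← map_add]
    congr 3 <;> ring
  have e : algebraMap K D (a^3+2*a*b+a^2+b+a+1) * u + algebraMap K D (a^2*b+b^2+a*b+b+1) = 0 := by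
    rw [e4, e3, hab] at hu
    rw [← hu]
    simp only [map_add, add_mul, map_one, one_mul]
    abel
  have hp : a^3+2*a*b+a^2+b+a+1 = 0 := by
    by_contra hne
    apply hnk (-(a^3+2*a*b+a^2+b+a+1)⁻¹ * (a^2*b+b^2+a*b+b+1))
    have h0 : algebraMap K D (a^3+2*a*b+a^2+b+a+1) ≠ 0 := by
      simpa only [ne_eq, map_eq_zero] using hne
    apply mul_left_cancel₀ h0
    rw [eq_neg_of_add_eq_zero_left e, ← map_mul, ← map_neg]
    congr 1
    rw [neg_mul, mul_neg, mul_inv_cancel_left₀ hne]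
  have hq : a^2*b+b^2+a*b+b+1 = 0 := by
    rw [hp, map_zero, zero_mul, zero_add] at e
    simpa only [map_eq_zero] using e
  have hb : b ^ 5 = -1 := by grind
  by_cases hb1 : b = -1
  · subst hb1
    exact ⟨2*a+1, by linear_combination -4*hq⟩
  · exfalso
    apply no_root K h (-b)
    have : (b + 1) * ((-b)^4+(-b)^3+(-b)^2+(-b)+1) = 0 := by linear_combination hb
    exact (mul_eq_zero.1 this).resolve_left (fun h => hb1 (eq_neg_of_add_eq_zero_left h))

theorem sqrt_five_in_center_of_binary_icosahedral_embedding
    (D : Type) [DivisionRing D] [Algebra ℚ D] [FiniteDimensional ℚ D]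
    (hD : Module.finrank ℚ D ≤ 8)
    (hK : Module.finrank (Subalgebra.center ℚ D) D = 4)
    (f : Matrix.SpecialLinearGroup (Fin 2) (ZMod 5) →* Dˣ)
    (hf : Function.Injective f) :
    ∃ x ∈ Subalgebra.center ℚ D, x ^ 2 = 5 := by
  have hK' : Module.finrank (Subring.center D) D = 4 := hK
  have : CharZero D := algebraRat.charZero D
  have : CharZero (Subring.center D) := (Subring.center D).subtype.charZero
  have hst : IsScalarTower ℚ (Subring.center D) D := ⟨by
    intro q k d
    rw [Algebra.smul_def q k, mul_smul]
    rw [Subring.smul_def (algebraMap ℚ (Subring.center D) q)]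
    have : ((algebraMap ℚ (Subring.center D) q : Subring.center D) : D) = algebraMap ℚ D q :=
      congrArg (fun r : ℚ →+* D => r q)
        (Subsingleton.elim ((Subring.center D).subtype.comp (algebraMap ℚ _)) (algebraMap ℚ D))
    rw [this, smul_eq_mul, ← Algebra.smul_def]⟩
  have hinj : Function.Injective ((Algebra.linearMap (Subring.center D) D).restrictScalars ℚ) :=
    Subtype.val_injective
  have hfd : FiniteDimensional ℚ (Subring.center D) := Module.Finite.of_injective _ hinj
  have hmul := Module.finrank_mul_finrank ℚ (Subring.center D) D
  have hc : ¬ ∀ x y : D, x * y = y * x := by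
    intro h
    have h1 : Module.finrank (Subring.center D) D ≤ 1 := by
      apply finrank_le_one (1 : D)
      intro w
      exact ⟨⟨w, Subring.mem_center_iff.2 fun y => h y w⟩, mul_one w⟩
    omega
  let g : Matrix.SpecialLinearGroup (Fin 2) (ZMod 5) := ⟨!![1,1;0,1], by simp⟩
  have g5 : g ^ 5 = 1 := by
    apply Subtype.ext
    rw [Matrix.SpecialLinearGroup.coe_pow, Matrix.SpecialLinearGroup.coe_one]
    decide
  have g1 : g ≠ 1 := by
    intro h
    have := congrArg (fun m => m.1 0 1) h
    revert this
    simp only [g]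
    decide
  obtain ⟨x, hx⟩ := main_aux (Subring.center D) D (by rw [hK'] at hmul; omega) hK' hc (f g : D)
    (fun h => g1 (hf (by rw [map_one]; exact Units.ext h)))
    (by rw [← Units.val_pow_eq_pow_val, ← map_pow, g5, map_one, Units.val_one])
  exact ⟨x, x.2, by 
    have h5 := congrArg (Subring.center D).subtype hx
    rw [map_pow, map_ofNat] at h5
    exact h5⟩
end
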